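/- The following statements are equivalent: (1) there is no sentence φ in the language of set theory satisfying all three of (a) ZFC + "Ord is essentially subtle" proves φ, (b) ZFC + "Ord is essentially faint" + φ proves "Ord is essentially subtle", and (c) ZFC + ¬φ proves "Ord is essentially faint"; (2) there is no sentence φ in the language of set theory satisfying (a) and (b); (3) the theory ZFC + "There is a proper class of subtle cardinals" + "Ord is essentially subtle" is consistent. -/

import Mathlib

namespace Paper

/-- First-order formulas in the language of set theory (one binary relation, membership),
using de Bruijn variables; `all` binds the last variable. -/
inductive SetFormula : ℕ → Type
  | mem {n : ℕ} (i j : Fin n) : SetFormula n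
  | eq {n : ℕ} (i j : Fin n) : SetFormula n
  | fal {n : ℕ} : SetFormula n
  | imp {n : ℕ} (φ ψ : SetFormula n) : SetFormula n
  | all {n : ℕ} (φ : SetFormula (n + 1)) : SetFormula n

namespace SetFormula

/-- Negation. -/
def not {n : ℕ} (φ : SetFormula n) : SetFormula n := φ.imp .fal

/-- Conjunction. -/
def and {n : ℕ} (φ ψ : SetFormula n) : SetFormula n := (φ.imp ψ.not).not

/-- Existential quantification (over the last variable). -/
def ex {n : ℕ} (φ : SetFormula (n + 1)) : SetFormula n := (SetFormula.all φ.not).not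

end SetFormula

/-- Satisfaction of a set-theoretic formula in a structure `(M, E)`, where `E` interprets
the membership relation. -/
def Realize {M : Type*} (E : M → M → Prop) : ∀ {n : ℕ}, SetFormula n → (Fin n → M) → Prop
  | _, .mem i j, v => E (v i) (v j)
  | _, .eq i j, v => v i = v j
  | _, .fal, _ => False
  | _, .imp φ ψ, v => Realize E φ v → Realize E ψ v
  | _, .all φ, v => ∀ a, Realize E φ (Fin.snoc v a)

/-- Satisfaction of a formula relativized to the subclass `S` of `M`; all quantifiers
range over `S`, and the assignment is required to take values in `S`. -/
def RealizeIn {M : Type*} (E : M → M → Prop) (S : M → Prop) {n : ℕ}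
    (φ : SetFormula n) (v : Fin n → M) : Prop :=
  ∃ h : ∀ i, S (v i),
    Realize (fun a b : {x : M // S x} => E a.1 b.1) φ fun i => ⟨v i, h i⟩

/-- `Δ₀`-formulas: formulas all of whose quantifiers are bounded. -/
inductive IsDelta0 : ∀ {n : ℕ}, SetFormula n → Prop
  | mem {n : ℕ} (i j : Fin n) : IsDelta0 (.mem i j)
  | eq {n : ℕ} (i j : Fin n) : IsDelta0 (.eq i j)
  | fal {n : ℕ} : IsDelta0 (n := n) .fal
  | imp {n : ℕ} {φ ψ : SetFormula n} : IsDelta0 φ → IsDelta0 ψ → IsDelta0 (φ.imp ψ)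
  | ball {n : ℕ} (j : Fin n) {φ : SetFormula (n + 1)} :
      IsDelta0 φ → IsDelta0 (.all ((SetFormula.mem (Fin.last n) j.castSucc).imp φ))
  | bex {n : ℕ} (j : Fin n) {φ : SetFormula (n + 1)} :
      IsDelta0 φ → IsDelta0 (SetFormula.ex ((SetFormula.mem (Fin.last n) j.castSucc).and φ))

mutual
  /-- `Σₙ`-formulas of the Lévy hierarchy. -/
  inductive IsSigma : ℕ → ∀ {n : ℕ}, SetFormula n → Prop
    | ofDelta0 {k n : ℕ} {φ : SetFormula n} : IsDelta0 φ → IsSigma k φ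
    | ofPi {k n : ℕ} {φ : SetFormula n} : IsPi k φ → IsSigma (k + 1) φ
    | ex {k n : ℕ} {φ : SetFormula (n + 1)} : IsSigma (k + 1) φ → IsSigma (k + 1) φ.ex
  /-- `Πₙ`-formulas of the Lévy hierarchy. -/
  inductive IsPi : ℕ → ∀ {n : ℕ}, SetFormula n → Prop
    | ofDelta0 {k n : ℕ} {φ : SetFormula n} : IsDelta0 φ → IsPi k φ
    | ofSigma {k n : ℕ} {φ : SetFormula n} : IsSigma k φ → IsPi (k + 1) φ
    | all {k n : ℕ} {φ : SetFormula (n + 1)} : IsPi (k + 1) φ → IsPi (k + 1) φ.all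
end

end Paper
namespace Paper

section Generic

variable {M : Type*} (E : M → M → Prop)

/-- `x` is a transitive set (relative to the membership relation `E`). -/
def TransE (x : M) : Prop := ∀ y, E y x → ∀ z, E z y → E z x

/-- `x` is an ordinal: a transitive set all of whose elements are transitive. -/
def OrdE (x : M) : Prop := TransE E x ∧ ∀ y, E y x → TransE E y

/-- `a ⊆ b`. -/
def SubE (a b : M) : Prop := ∀ z, E z a → E z b

/-- `a ≤ b` for ordinals. -/
def LeE (a b : M) : Prop := E a b ∨ a = b

/-- `x` is the empty set. -/
def EmptyE (x : M) : Prop := ∀ z, ¬ E z x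

/-- `s = y ∪ {y}`. -/
def SuccSpecE (s y : M) : Prop := ∀ z, E z s ↔ (E z y ∨ z = y)

/-- `l` is a (nonzero) limit ordinal. -/
def LimitE (l : M) : Prop := OrdE E l ∧ (∃ w, E w l) ∧ ∀ α, E α l → ∃ β, E β l ∧ E α β

/-- `w` is the first infinite ordinal `ω`. -/
def OmegaSpecE (w : M) : Prop := LimitE E w ∧ ∀ x, E x w → ¬ LimitE E x

/-- `x` is an infinite ordinal, i.e. an ordinal with `ω ≤ x`. -/
def InfiniteOrdE (x : M) : Prop := OrdE E x ∧ ∃ w, OmegaSpecE E w ∧ LeE E w x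

/-- `p = {a, b}`. -/
def UPairE (p a b : M) : Prop := ∀ z, E z p ↔ (z = a ∨ z = b)

/-- `p` is the Kuratowski ordered pair `⟨a, b⟩`. -/
def OPairE (p a b : M) : Prop :=
  ∃ s t, UPairE E s a a ∧ UPairE E t a b ∧ UPairE E p s t

/-- The ordered pair `⟨x, y⟩` is an element of `f`. -/
def PairMemE (f x y : M) : Prop := ∃ p, E p f ∧ OPairE E p x y

/-- `f` is (the graph of) a function from `a` to `b`. -/
def IsFuncE (f a b : M) : Prop :=
  (∀ p, E p f → ∃ x y, E x a ∧ E y b ∧ OPairE E p x y) ∧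
    ∀ x, E x a → (∃ y, PairMemE E f x y) ∧
      ∀ y y', PairMemE E f x y → PairMemE E f x y' → y = y'

/-- `f` is a surjection from `a` onto `b`. -/
def SurjE (f a b : M) : Prop :=
  IsFuncE E f a b ∧ ∀ y, E y b → ∃ x, E x a ∧ PairMemE E f x y

/-- `f` is an injection from `a` into `b`. -/
def InjE (f a b : M) : Prop :=
  IsFuncE E f a b ∧ ∀ x x' y, E x a → E x' a →
    PairMemE E f x y → PairMemE E f x' y → x = x'

/-- `f` is a bijection between `a` and `b`. -/
def BijE (f a b : M) : Prop := SurjE E f a b ∧ InjE E f a b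

/-- `κ` is a cardinal: an ordinal not in bijection with any of its elements. -/
def CardE (κ : M) : Prop := OrdE E κ ∧ ∀ α, E α κ → ¬ ∃ f, BijE E f α κ

/-- `κ` is an infinite cardinal. -/
def InfCardE (κ : M) : Prop := CardE E κ ∧ InfiniteOrdE E κ

/-- `b = a ∩ c`. -/
def InterSpecE (b a c : M) : Prop := ∀ z, E z b ↔ (E z a ∧ E z c)

/-- `c` is unbounded in the ordinal `κ`. -/
def UnboundedInE (c κ : M) : Prop := ∀ α, E α κ → ∃ β, E β c ∧ E α β

/-- `c` is closed in the ordinal `κ`: it contains each of its limit points below `κ`. -/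
def ClosedInE (c κ : M) : Prop :=
  ∀ l, E l κ → (∃ w, E w l) → (∀ α, E α l → ∃ β, E β c ∧ E α β ∧ E β l) → E l c

/-- `c` is a closed unbounded subset of the ordinal `κ`. -/
def ClubInE (c κ : M) : Prop := SubE E c κ ∧ UnboundedInE E c κ ∧ ClosedInE E c κ

/-- `f` is (the graph of) a sequence `⟨A_α | α < κ⟩` with `A_α ⊆ α` for all `α < κ`. -/
def SeqSpecE (f κ : M) : Prop :=
  ∀ α, E α κ → (∃ A, PairMemE E f α A ∧ SubE E A α) ∧
    ∀ A A', PairMemE E f α A → PairMemE E f α A' → A = A'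

/-- `κ` is a subtle cardinal. -/
def SubtleE (κ : M) : Prop :=
  InfCardE E κ ∧ ∀ f, SeqSpecE E f κ → ∀ c, ClubInE E c κ →
    ∃ α β, E α c ∧ E β c ∧ E α β ∧
      ∃ A B, PairMemE E f α A ∧ PairMemE E f β B ∧ InterSpecE E A B α

/-- `κ` is a regular ordinal: every function from an element of `κ` to `κ` has
bounded range. -/
def RegularE (κ : M) : Prop :=
  OrdE E κ ∧ ∀ γ f, E γ κ → IsFuncE E f γ κ →
    ∃ β, E β κ ∧ ∀ x y, PairMemE E f x y → E y β

/-- `p = 𝒫(a)`. -/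
def PowSpecE (p a : M) : Prop := ∀ z, E z p ↔ SubE E z a

/-- `κ` is a strong limit cardinal: for every `α < κ`, `2^|α| < κ`. -/
def StrongLimitE (κ : M) : Prop :=
  ∀ α, E α κ → ∀ p, PowSpecE E p α → ∃ β f, E β κ ∧ InjE E f p β

/-- `κ` is a strongly inaccessible cardinal: an uncountable regular strong limit
cardinal. -/
def InaccE (κ : M) : Prop :=
  CardE E κ ∧ (∃ w, OmegaSpecE E w ∧ E w κ) ∧ RegularE E κ ∧ StrongLimitE E κ

/-- `z` belongs to the transitive closure of `x`. -/
def TCMemE (z x : M) : Prop := ∀ t, TransE E t → SubE E x t → E z t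

/-- `x ∈ H(θ)`: the transitive closure of `x` has cardinality less than `θ`. -/
def HMemE (x θ : M) : Prop :=
  ∃ t, TransE E t ∧ SubE E x t ∧ ∃ β f, E β θ ∧ SurjE E f β t

/-- `f` is (the graph of) the cumulative-hierarchy sequence `⟨V_β | β < α⟩`,
determined by the recursion `V_β = {z | ∃ γ < β, z ⊆ V_γ}`. -/
def VHierE (f α : M) : Prop :=
  OrdE E α ∧ ∀ β, E β α →
    (∃ w, PairMemE E f β w ∧
      ∀ z, E z w ↔ ∃ γ, E γ β ∧ ∃ u, PairMemE E f γ u ∧ SubE E z u) ∧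
    ∀ w w', PairMemE E f β w → PairMemE E f β w' → w = w'

/-- `x ∈ V_α`. -/
def VMemE (x α : M) : Prop :=
  OrdE E α ∧ ∃ f, VHierE E f α ∧ ∃ β u, E β α ∧ PairMemE E f β u ∧ SubE E x u

/-- The class `S` is a `Σₙ`-elementary subclass of the class `T`. -/
def SigmaElemPairE (n : ℕ) (S T : M → Prop) : Prop :=
  (∀ x, S x → T x) ∧
    ∀ ⦃k : ℕ⦄ (φ : SetFormula k), IsSigma n φ → ∀ v : Fin k → M, (∀ i, S (v i)) →
      (RealizeIn E S φ v ↔ RealizeIn E T φ v)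

/-- The class `S` is a (fully) elementary subclass of the class `T`. -/
def ElemPairE (S T : M → Prop) : Prop :=
  (∀ x, S x → T x) ∧
    ∀ ⦃k : ℕ⦄ (φ : SetFormula k) (v : Fin k → M), (∀ i, S (v i)) →
      (RealizeIn E S φ v ↔ RealizeIn E T φ v)

/-- `j` is an elementary map from the class `S` into the class `T`. -/
def ElemMapE (S T : M → Prop) (j : M → M) : Prop :=
  (∀ x, S x → T (j x)) ∧
    ∀ ⦃k : ℕ⦄ (φ : SetFormula k) (v : Fin k → M), (∀ i, S (v i)) →
      (RealizeIn E S φ v ↔ RealizeIn E T φ fun i => j (v i))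

/-- `α ∈ C⁽ⁿ⁾`: the ordinal `α` is `Σₙ`-correct, i.e. `V_α` is a `Σₙ`-elementary
submodel of the universe. -/
def CnE (n : ℕ) (α : M) : Prop :=
  OrdE E α ∧ SigmaElemPairE E n (fun x => VMemE E x α) fun _ => True

/-- `κ` is a weakly shrewd cardinal. -/
def WeaklyShrewdE (κ : M) : Prop :=
  CardE E κ ∧ ∀ (φ : SetFormula 2) (θ z : M), CardE E θ → E κ θ → SubE E z κ →
    RealizeIn E (fun x => HMemE E x θ) φ ![z, κ] →
    ∃ κ' θ' z', CardE E κ' ∧ CardE E θ' ∧ E κ' θ' ∧ E κ' κ ∧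
      InterSpecE E z' z κ' ∧ RealizeIn E (fun x => HMemE E x θ') φ ![z', κ']

/-- `κ` is a `C⁽ⁿ⁾`-weakly shrewd cardinal. -/
def CnWeaklyShrewdE (n : ℕ) (κ : M) : Prop :=
  CardE E κ ∧ ∀ (φ : SetFormula 2) (θ z : M), CardE E θ → CnE E n θ → E κ θ →
    SubE E z κ → RealizeIn E (fun x => HMemE E x θ) φ ![z, κ] →
    ∃ κ' θ' z', CardE E κ' ∧ CardE E θ' ∧ CnE E n θ' ∧ E κ' θ' ∧ E κ' κ ∧
      InterSpecE E z' z κ' ∧ RealizeIn E (fun x => HMemE E x θ') φ ![z', κ']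

/-- Axiom of extensionality for `(M, E)`. -/
def AxExtE : Prop := ∀ x y : M, (∀ z, E z x ↔ E z y) → x = y

/-- Axiom of pairing for `(M, E)`. -/
def AxPairE : Prop := ∀ a b : M, ∃ p, UPairE E p a b

/-- Axiom of union for `(M, E)`. -/
def AxUnionE : Prop := ∀ a : M, ∃ u, ∀ z, E z u ↔ ∃ y, E y a ∧ E z y

/-- Axiom of power set for `(M, E)`. -/
def AxPowE : Prop := ∀ a : M, ∃ p, PowSpecE E p a

/-- Axiom of infinity for `(M, E)`. -/
def AxInfE : Prop :=
  ∃ I : M, (∃ e, E e I ∧ EmptyE E e) ∧ ∀ y, E y I → ∃ s, E s I ∧ SuccSpecE E s y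

/-- Axiom of foundation for `(M, E)`. -/
def AxFoundE : Prop :=
  ∀ a : M, (∃ z, E z a) → ∃ m, E m a ∧ ∀ z, E z a → ¬ E z m

/-- Separation scheme for `(M, E)`. -/
def AxSepE : Prop :=
  ∀ (k : ℕ) (φ : SetFormula (k + 1)) (p : Fin k → M) (a : M),
    ∃ s : M, ∀ z, E z s ↔ (E z a ∧ Realize E φ (Fin.cons z p))

/-- Replacement scheme for `(M, E)`. -/
def AxReplE : Prop :=
  ∀ (k : ℕ) (φ : SetFormula (k + 2)) (p : Fin k → M) (a : M),
    (∀ x, E x a → ∀ y y', Realize E φ (Fin.cons x (Fin.cons y p)) →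
      Realize E φ (Fin.cons x (Fin.cons y' p)) → y = y') →
    ∃ b : M, ∀ y, E y b ↔ ∃ x, E x a ∧ Realize E φ (Fin.cons x (Fin.cons y p))

/-- Axiom of choice for `(M, E)`. -/
def AxChoiceE : Prop :=
  ∀ a : M, (∀ x, E x a → ∃ z, E z x) →
    (∀ x y, E x a → E y a → x ≠ y → ¬ ∃ z, E z x ∧ E z y) →
    ∃ c, ∀ x, E x a → ∃ z, E z c ∧ E z x ∧ ∀ z', E z' c → E z' x → z' = z

/-- `(M, E)` is a model of `ZF⁻` (Zermelo–Fraenkel set theory without the power set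
axiom). -/
def IsZFMinusE : Prop :=
  AxExtE E ∧ AxPairE E ∧ AxUnionE E ∧ AxInfE E ∧ AxFoundE E ∧ AxSepE E ∧ AxReplE E

/-- `(M, E)` is a model of `ZFC`. -/
def IsZFCE : Prop :=
  Nonempty M ∧ IsZFMinusE E ∧ AxPowE E ∧ AxChoiceE E

/-- The set `m` is, with the induced membership relation, a transitive model
of `ZF⁻`. -/
def ZFMinusModelE (m : M) : Prop :=
  IsZFMinusE fun a b : {x : M // E x m} => E a.1 b.1

/-- `x` has cardinality `κ`. -/
def CardEqE (x κ : M) : Prop := ∃ f, BijE E f κ x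

/-- `m` is closed under sequences of length less than `κ`: `^{<κ}m ⊆ m`. -/
def SmallSeqClosedE (m κ : M) : Prop := ∀ γ f, E γ κ → IsFuncE E f γ m → E f m

/-- `κ` is a `C⁽ⁿ⁾`-strongly unfoldable cardinal. -/
def CnStronglyUnfoldableE (n : ℕ) (κ : M) : Prop :=
  InaccE E κ ∧ ∀ lam, CnE E n lam → E κ lam →
    ∀ m, TransE E m → ZFMinusModelE E m → CardEqE E m κ → E κ m →
      SmallSeqClosedE E m κ →
      ∃ N j κ', TransE E N ∧ (∀ x, VMemE E x lam → E x N) ∧ IsFuncE E j m N ∧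
        (∀ ⦃k : ℕ⦄ (φ : SetFormula k) (v w : Fin k → M), (∀ i, E (v i) m) →
          (∀ i, PairMemE E j (v i) (w i)) →
          (RealizeIn E (fun x => E x m) φ v ↔ RealizeIn E (fun x => E x N) φ w)) ∧
        (∀ α, E α κ → PairMemE E j α α) ∧ PairMemE E j κ κ' ∧ E lam κ' ∧
        SigmaElemPairE E n (fun x => VMemE E x lam) fun x => E x N ∧ VMemE E x κ'

/-- `x` is ordinal definable. -/
def IsODE (x : M) : Prop :=
  ∃ (k : ℕ) (φ : SetFormula (k + 1)) (p : Fin k → M), (∀ i, OrdE E (p i)) ∧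
    Realize E φ (Fin.cons x p) ∧ ∀ y, Realize E φ (Fin.cons y p) → y = x

/-- `x` is hereditarily ordinal definable, i.e. `x ∈ HOD`. -/
def IsHODE (x : M) : Prop := IsODE E x ∧ ∀ z, TCMemE E z x → IsODE E z

/-- The instance of the principle "`Ord` is essentially faint" for the class
sequence `⟨{A | Efam α A} | α ∈ Ord⟩`. -/
def FaintForE (Efam : M → M → Prop) : Prop :=
  (∀ α, OrdE E α → (∃ A, Efam α A) ∧ ∀ A, Efam α A → SubE E A α) →
    ∀ ξ, OrdE E ξ → ∃ α β A B, OrdE E α ∧ OrdE E β ∧ E ξ α ∧ E α β ∧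
      Efam β A ∧ InterSpecE E B A α ∧ Efam α B

/-- `C` is a closed unbounded class of ordinals. -/
def ClubClassE (C : M → Prop) : Prop :=
  (∀ x, C x → OrdE E x) ∧ (∀ α, OrdE E α → ∃ β, C β ∧ E α β) ∧
    ∀ l, OrdE E l → (∃ w, E w l) → (∀ α, E α l → ∃ β, C β ∧ E α β ∧ E β l) → C l

/-- The instance of the principle "`Ord` is essentially subtle" for the class
sequence `⟨{A | Efam α A} | α ∈ Ord⟩` and the class `C`. -/
def SubtleForE (Efam : M → M → Prop) (C : M → Prop) : Prop :=
  (∀ α, OrdE E α → (∃ A, Efam α A) ∧ ∀ A, Efam α A → SubE E A α) →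
    ClubClassE E C →
    ∃ α β A B, C α ∧ C β ∧ E α β ∧ Efam β A ∧ InterSpecE E B A α ∧ Efam α B

/-- The scheme "`Ord` is essentially faint" holds in `(M, E)`: every instance for a
definable (with parameters) class sequence holds. -/
def OrdFaintDefE : Prop :=
  ∀ (k : ℕ) (φ : SetFormula (k + 2)) (p : Fin k → M),
    FaintForE E fun α A => Realize E φ (Fin.cons α (Fin.cons A p))

/-- The scheme "`Ord` is essentially subtle" holds in `(M, E)`: every instance for
definable (with parameters) class sequences and club classes holds. -/
def OrdSubtleDefE : Prop :=
  ∀ (k k' : ℕ) (φ : SetFormula (k + 2)) (p : Fin k → M)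
    (ψ : SetFormula (k' + 1)) (q : Fin k' → M),
    SubtleForE E (fun α A => Realize E φ (Fin.cons α (Fin.cons A p)))
      fun x => Realize E ψ (Fin.cons x q)

/-- There is a proper class of subtle cardinals in `(M, E)`. -/
def ProperClassSubtleE : Prop := ∀ α, OrdE E α → ∃ κ, SubtleE E κ ∧ E α κ

/-- There are no strongly inaccessible cardinals in `(M, E)`. -/
def NoInaccE : Prop := ∀ κ, ¬ InaccE E κ

end Generic

end Paper

namespace Paper

/-- `ZFC + "Ord is essentially subtle"` proves `φ`. -/
def SubtleProves (φ : SetFormula 0) : Prop :=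
  ∀ (M : Type) (E : M → M → Prop), IsZFCE E → OrdSubtleDefE E → Realize E φ ![]

/-- `ZFC + "Ord is essentially faint" + φ` proves the scheme
"`Ord` is essentially subtle". -/
def FaintPlusProvesSubtle (φ : SetFormula 0) : Prop :=
  ∀ (M : Type) (E : M → M → Prop), IsZFCE E → OrdFaintDefE E → Realize E φ ![] →
    OrdSubtleDefE E

/-- `ZFC + ¬φ` proves the scheme "`Ord` is essentially faint". -/
def NegProvesFaint (φ : SetFormula 0) : Prop :=
  ∀ (M : Type) (E : M → M → Prop), IsZFCE E → ¬ Realize E φ ![] → OrdFaintDefE E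

end Paper

set_option linter.all false
namespace Paper

/-- A model of ZFC. -/
class Mdl (M : Type) where
  E : M → M → Prop
  ax : IsZFCE E

infix:50 "∊" => Mdl.E

/-- Formulas with de Bruijn variables and constants. -/
inductive Fm (M : Type) : Type
  | mem (s t : ℕ ⊕ M) : Fm M
  | eq (s t : ℕ ⊕ M) : Fm M
  | fal : Fm M
  | imp (φ ψ : Fm M) : Fm M
  | all (φ : Fm M) : Fm M

section FW
variable {M : Type}

def cs (a : M) (v : ℕ → M) : ℕ → M
  | 0 => a
  | i + 1 => v i

def ev (v : ℕ → M) : ℕ ⊕ M → M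
  | .inl i => v i
  | .inr c => c

def trm (C : M → Prop) : ℕ ⊕ M → Prop
  | .inl _ => True
  | .inr c => C c

def Fm.cn (C : M → Prop) : Fm M → Prop
  | .mem s t => trm C s ∧ trm C t
  | .eq s t => trm C s ∧ trm C t
  | .fal => True
  | .imp φ ψ => φ.cn C ∧ ψ.cn C
  | .all φ => φ.cn C

def satR [Mdl M] (S : M → Prop) : Fm M → (ℕ → M) → Prop
  | .mem s t, v => ev v s ∊ ev v t
  | .eq s t, v => ev v s = ev v t
  | .fal, _ => False
  | .imp φ ψ, v => satR S φ v → satR S ψ v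
  | .all φ, v => ∀ a, S a → satR S φ (cs a v)

def Any : M → Prop := fun _ => True

abbrev sat [Mdl M] (φ : Fm M) (v : ℕ → M) : Prop := satR Any φ v

def liftρ (ρ : ℕ → ℕ ⊕ M) : ℕ → ℕ ⊕ M
  | 0 => .inl 0
  | i + 1 => (ρ i).map Nat.succ id

def sbt (ρ : ℕ → ℕ ⊕ M) : ℕ ⊕ M → ℕ ⊕ M
  | .inl i => ρ i
  | .inr c => .inr c

def Fm.ren : (ℕ → ℕ ⊕ M) → Fm M → Fm M
  | ρ, .mem s t => .mem (sbt ρ s) (sbt ρ t)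
  | ρ, .eq s t => .eq (sbt ρ s) (sbt ρ t)
  | _, .fal => .fal
  | ρ, .imp φ ψ => .imp (φ.ren ρ) (ψ.ren ρ)
  | ρ, .all φ => .all (φ.ren (liftρ ρ))

theorem ev_sbt (ρ : ℕ → ℕ ⊕ M) (v : ℕ → M) (s) : ev v (sbt ρ s) = ev (fun i => ev v (ρ i)) s := by
  cases s <;> rfl

theorem ev_lift (ρ : ℕ → ℕ ⊕ M) (v : ℕ → M) (a : M) :
    (fun i => ev (cs a v) (liftρ ρ i)) = cs a (fun i => ev v (ρ i)) := by
  funext i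
  cases i with
  | zero => rfl
  | succ i => simp only [liftρ, cs]; cases ρ i <;> rfl

theorem satR_ren [Mdl M] (S : M → Prop) (φ : Fm M) : ∀ (ρ : ℕ → ℕ ⊕ M) (v : ℕ → M),
    satR S (φ.ren ρ) v ↔ satR S φ (fun i => ev v (ρ i)) := by
  induction φ with
  | mem s t => intro ρ v; simp [Fm.ren, satR, ev_sbt]
  | eq s t => intro ρ v; simp [Fm.ren, satR, ev_sbt]
  | fal => intro ρ v; simp [Fm.ren, satR]
  | imp φ ψ h1 h2 => intro ρ v; simp [Fm.ren, satR, h1, h2]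
  | all φ h => intro ρ v; simp [Fm.ren, satR, h, ev_lift]

theorem cn_ren (C : M → Prop) (φ : Fm M) : ∀ (ρ : ℕ → ℕ ⊕ M), (∀ i, trm C (ρ i)) → φ.cn C →
    (φ.ren ρ).cn C := by
  have hs : ∀ (ρ : ℕ → ℕ ⊕ M), (∀ i, trm C (ρ i)) → ∀ s, trm C s → trm C (sbt ρ s) := by
    intro ρ h s hs
    cases s with
    | inl i => exact h i
    | inr c => exact hs
  induction φ with
  | mem s t => intro ρ h hc; exact ⟨hs ρ h _ hc.1, hs ρ h _ hc.2⟩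
  | eq s t => intro ρ h hc; exact ⟨hs ρ h _ hc.1, hs ρ h _ hc.2⟩
  | fal => intro ρ h hc; trivial
  | imp φ ψ h1 h2 => intro ρ h hc; exact ⟨h1 ρ h hc.1, h2 ρ h hc.2⟩
  | all φ ih =>
    intro ρ h hc
    refine ih _ ?_ hc
    intro i
    cases i with
    | zero => trivial
    | succ i => have := h i; simp only [liftρ]; cases hh : ρ i <;> rw [hh] at this <;> exact this

theorem cn_mono {C D : M → Prop} (h : ∀ x, C x → D x) (φ : Fm M) : φ.cn C → φ.cn D := by
  have hs : ∀ s, trm C s → trm D s := by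
    intro s hs
    cases s with
    | inl i => trivial
    | inr c => exact h _ hs
  induction φ with
  | mem s t => intro hc; exact ⟨hs _ hc.1, hs _ hc.2⟩
  | eq s t => intro hc; exact ⟨hs _ hc.1, hs _ hc.2⟩
  | fal => intro hc; trivial
  | imp φ ψ h1 h2 => intro hc; exact ⟨h1 hc.1, h2 hc.2⟩
  | all φ ih => exact ih

/-- Definability with constants in `C`. -/
class Df [Mdl M] (C : M → Prop) (P : (ℕ → M) → Prop) : Prop where
  out : ∃ φ : Fm M, φ.cn C ∧ ∀ v, sat φ v ↔ P v

/-- Definability of terms. -/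
class DfT [Mdl M] (C : M → Prop) (t : (ℕ → M) → M) : Prop where
  out : Df C (fun v => v 0 = t (fun i => v (i + 1)))

class InC (C : M → Prop) (a : M) : Prop where
  out : C a

instance (a : M) : InC (Any : M → Prop) a := ⟨trivial⟩

variable [Mdl M] {C : M → Prop}

theorem Df.congr {P Q : (ℕ → M) → Prop} (h : Df C P) (hq : ∀ v, P v ↔ Q v) : Df C Q :=
  ⟨h.out.imp fun _ h => ⟨h.1, fun v => (h.2 v).trans (hq v)⟩⟩

theorem Df.mono {D : M → Prop} {P : (ℕ → M) → Prop} (h : Df C P) (hq : ∀ v, C v → D v) : Df D P :=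
  ⟨h.out.imp fun _ h => ⟨cn_mono hq _ h.1, h.2⟩⟩

theorem Df.any {P : (ℕ → M) → Prop} (h : Df C P) : Df Any P := h.mono fun _ _ => trivial

instance Df.fal : Df C (fun _ => False) := ⟨.fal, trivial, fun _ => Iff.rfl⟩

instance Df.imp {P Q : (ℕ → M) → Prop} [h1 : Df C P] [h2 : Df C Q] : Df C (fun v => P v → Q v) := by
  obtain ⟨φ, a, b⟩ := h1.out
  obtain ⟨ψ, a', b'⟩ := h2.out
  exact ⟨.imp φ ψ, ⟨a, a'⟩, fun v => by simp only [sat, satR] at *; rw [b, b']⟩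

instance Df.all {Q : (ℕ → M) → M → Prop} [h1 : Df C (fun w => Q (fun i => w (i + 1)) (w 0))] :
    Df C (fun v => ∀ a, Q v a) := by
  obtain ⟨φ, a, b⟩ := h1.out
  refine ⟨.all φ, a, fun v => ?_⟩
  simp only [sat, satR] at *
  exact forall_congr' fun a => ⟨fun h => (b _).1 (h trivial), fun h _ => (b _).2 h⟩

instance Df.not {P : (ℕ → M) → Prop} [h1 : Df C P] : Df C (fun v => ¬ P v) :=
  Df.imp (h1 := h1) (h2 := Df.fal)

instance Df.and {P Q : (ℕ → M) → Prop} [h1 : Df C P] [h2 : Df C Q] : Df C (fun v => P v ∧ Q v) :=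
  Df.congr (P := fun v => ¬ (P v → ¬ Q v)) inferInstance (fun v => by tauto)

instance Df.or {P Q : (ℕ → M) → Prop} [h1 : Df C P] [h2 : Df C Q] : Df C (fun v => P v ∨ Q v) :=
  Df.congr (P := fun v => (¬ P v → Q v)) inferInstance (fun v => by tauto)

instance Df.iff {P Q : (ℕ → M) → Prop} [h1 : Df C P] [h2 : Df C Q] : Df C (fun v => P v ↔ Q v) :=
  Df.congr (P := fun v => (P v → Q v) ∧ (Q v → P v)) inferInstance (fun v => by tauto)

instance Df.tru : Df C (fun _ => True) :=
  Df.congr (P := fun _ => ¬ False) inferInstance (fun v => by tauto)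

instance Df.ex {Q : (ℕ → M) → M → Prop} [h1 : Df C (fun w => Q (fun i => w (i + 1)) (w 0))] :
    Df C (fun v => ∃ a, Q v a) :=
  Df.congr (P := fun v => ¬ ∀ a, ¬ Q v a) inferInstance (fun v => by simp)

theorem Df.ren {P : (ℕ → M) → Prop} (h : Df C P) (ρ : ℕ → ℕ ⊕ M) (hρ : ∀ i, trm C (ρ i)) :
    Df C (fun v => P (fun i => ev v (ρ i))) := by
  obtain ⟨φ, a, b⟩ := h.out
  exact ⟨φ.ren ρ, cn_ren _ _ _ hρ a, fun v => by rw [sat, satR_ren, ← b]⟩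

theorem Df.shift {P : (ℕ → M) → Prop} (h : Df C P) (f : ℕ → ℕ) :
    Df C (fun v => P (fun i => v (f i))) := h.ren (fun i => .inl (f i)) (fun _ => trivial)

instance (priority := 900) DfT.var (i : ℕ) : DfT C (fun v => v i) :=
  ⟨⟨.eq (.inl 0) (.inl (i+1)), ⟨trivial, trivial⟩, fun _ => Iff.rfl⟩⟩

instance (priority := 100) DfT.const (c : M) [h : InC C c] : DfT C (fun _ => c) :=
  ⟨⟨.eq (.inl 0) (.inr c), ⟨trivial, h.out⟩, fun _ => Iff.rfl⟩⟩

theorem Df.eqv (i j : ℕ) : Df C (fun v => v i = v j) :=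
  ⟨.eq (.inl i) (.inl j), ⟨trivial, trivial⟩, fun _ => Iff.rfl⟩

theorem Df.memv (i j : ℕ) : Df C (fun v => v i ∊ v j) :=
  ⟨.mem (.inl i) (.inl j), ⟨trivial, trivial⟩, fun _ => Iff.rfl⟩

theorem DfT.shift {t : (ℕ → M) → M} (h : DfT C t) (f : ℕ → ℕ) :
    DfT C (fun v => t (fun i => v (f i))) :=
  ⟨h.out.shift (fun | 0 => 0 | i + 1 => f i + 1)⟩

theorem Df.bin {t s : (ℕ → M) → M} (ht : DfT C t) (hs : DfT C s) (R : M → M → Prop)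
    (hR : Df C (fun v => R (v 1) (v 0))) : Df C (fun v => R (t v) (s v)) := by
  have h1 : Df C (fun v => v 1 = t (fun i => v (i+2))) :=
    ht.out.shift (fun | 0 => 1 | i + 1 => i + 2)
  have h2 : Df C (fun v => v 0 = s (fun i => v (i+2))) :=
    hs.out.shift (fun | 0 => 0 | i + 1 => i + 2)
  refine Df.congr (P := fun v => ∃ x, ∃ y, (x = t v ∧ y = s v) ∧ R x y) ?_ (fun v => by aesop)
  have h3 : Df C (fun v => (v 1 = t (fun i => v (i+2)) ∧ v 0 = s (fun i => v (i+2))) ∧ R (v 1) (v 0)) :=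
    inferInstance
  have h4 : Df C (fun v => ∃ y, (v 0 = t (fun i => v (i+1)) ∧ y = s (fun i => v (i+1))) ∧ R (v 0) y) :=
    @Df.ex _ _ _ (fun v y => (v 0 = t (fun i => v (i+1)) ∧ y = s (fun i => v (i+1))) ∧ R (v 0) y) h3
  exact @Df.ex _ _ _ _ h4

instance Df.eq {t s : (ℕ → M) → M} [ht : DfT C t] [hs : DfT C s] : Df C (fun v => t v = s v) :=
  Df.bin ht hs _ (Df.eqv 1 0)

instance Df.mem {t s : (ℕ → M) → M} [ht : DfT C t] [hs : DfT C s] : Df C (fun v => t v ∊ s v) :=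
  Df.bin ht hs _ (Df.memv 1 0)

theorem Df.subst {P : (ℕ → M) → Prop} (h : Df C P) (t : ℕ → (ℕ → M) → M)
    (ht : ∀ i, DfT C (t i)) : Df C (fun v => P (fun i => t i v)) := by
  obtain ⟨φ, a, b⟩ := h.out
  suffices ∀ (φ : Fm M), φ.cn C → ∀ (t : ℕ → (ℕ → M) → M), (∀ i, DfT C (t i)) →
      Df C (fun v => sat φ (fun i => t i v)) from
    (this φ a t ht).congr fun v => b _
  have tm : ∀ s, trm C s → ∀ (t : ℕ → (ℕ → M) → M), (∀ i, DfT C (t i)) →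
      DfT C (fun v => ev (fun i => t i v) s) := by
    intro s hs t ht
    cases s with
    | inl i => exact ht i
    | inr c => exact @DfT.const _ _ _ c ⟨hs⟩
  intro φ
  induction φ with
  | mem s u =>
    intro hc t ht
    have := tm s hc.1 t ht
    have := tm u hc.2 t ht
    exact Df.mem
  | eq s u =>
    intro hc t ht
    have := tm s hc.1 t ht
    have := tm u hc.2 t ht
    exact Df.eq
  | fal => intro hc t ht; exact Df.fal
  | imp φ ψ h1 h2 =>
    intro hc t ht
    have := h1 hc.1 t ht
    have := h2 hc.2 t ht
    exact Df.imp
  | all φ ih =>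
    intro hc t ht
    let t' : ℕ → (ℕ → M) → M := fun
      | 0 => fun v => v 0
      | i + 1 => fun v => t i (fun j => v (j + 1))
    have ht' : ∀ i, DfT C (t' i) := by
      intro i
      cases i with
      | zero => exact DfT.var 0
      | succ i => exact (ht i).shift _
    have := ih hc t' ht'
    have h2 : Df C (fun v => ∀ a, sat φ (cs a (fun i => t i v))) := by
      refine @Df.all _ _ _ (fun v a => sat φ (cs a (fun i => t i v))) (this.congr fun v => ?_)
      have : (fun i => t' i v) = cs (v 0) (fun i => t i (fun j => v (j+1))) := by
        funext i; cases i <;> rfl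
      rw [this]
    refine h2.congr fun v => ?_
    exact ⟨fun h a _ => h a, fun h a => h a trivial⟩

theorem Df.sub1 {P : M → Prop} (h : Df C (fun v => P (v 0))) {t : (ℕ → M) → M} (ht : DfT C t) :
    Df C (fun v => P (t v)) := h.subst (fun _ => t) (fun _ => ht)

theorem Df.sub2 {P : M → M → Prop} (h : Df C (fun v => P (v 0) (v 1))) {t s : (ℕ → M) → M}
    (ht : DfT C t) (hs : DfT C s) :
    Df C (fun v => P (t v) (s v)) := h.subst (fun | 0 => t | _ => s) (fun | 0 => ht | _ + 1 => hs)

theorem Df.sub3 {P : M → M → M → Prop} (h : Df C (fun v => P (v 0) (v 1) (v 2)))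
    {t s u : (ℕ → M) → M} (ht : DfT C t) (hs : DfT C s) (hu : DfT C u) :
    Df C (fun v => P (t v) (s v) (u v)) :=
  h.subst (fun | 0 => t | 1 => s | _ => u) (fun | 0 => ht | 1 => hs | _ + 2 => hu)

theorem Df.sub4 {P : M → M → M → M → Prop} (h : Df C (fun v => P (v 0) (v 1) (v 2) (v 3)))
    {t s u w : (ℕ → M) → M} (ht : DfT C t) (hs : DfT C s) (hu : DfT C u) (hw : DfT C w) :
    Df C (fun v => P (t v) (s v) (u v) (w v)) :=
  h.subst (fun | 0 => t | 1 => s | 2 => u | _ => w)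
    (fun | 0 => ht | 1 => hs | 2 => hu | _ + 3 => hw)

/-- Definable term from a definable specification. -/
theorem DfT.of {t : (ℕ → M) → M} (R : (ℕ → M) → M → Prop) (h : ∀ v x, x = t v ↔ R v x)
    (hR : Df C (fun w => R (fun i => w (i+1)) (w 0))) : DfT C t :=
  ⟨hR.congr fun v => (h _ _).symm⟩

theorem DfT.sub1 {f : M → M} (h : DfT C (fun v => f (v 0))) {t : (ℕ → M) → M} (ht : DfT C t) :
    DfT C (fun v => f (t v)) := by
  have h2 : Df C (fun v => v 0 = f (v 1)) := h.out
  exact ⟨h2.sub2 (P := fun x y => x = f y) (DfT.var 0) (ht.shift _)⟩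

theorem DfT.sub2 {f : M → M → M} (h : DfT C (fun v => f (v 0) (v 1))) {t s : (ℕ → M) → M}
    (ht : DfT C t) (hs : DfT C s) : DfT C (fun v => f (t v) (s v)) := by
  have h2 : Df C (fun v => v 0 = f (v 1) (v 2)) := h.out
  exact ⟨h2.sub3 (P := fun x y z => x = f y z) (DfT.var 0) (ht.shift _) (hs.shift _)⟩

theorem DfT.sub3 {f : M → M → M → M} (h : DfT C (fun v => f (v 0) (v 1) (v 2)))
    {t s u : (ℕ → M) → M}
    (ht : DfT C t) (hs : DfT C s) (hu : DfT C u) : DfT C (fun v => f (t v) (s v) (u v)) := by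
  have h2 : Df C (fun v => v 0 = f (v 1) (v 2) (v 3)) := h.out
  exact ⟨h2.sub4 (P := fun x y z w => x = f y z w) (DfT.var 0) (ht.shift _) (hs.shift _)
    (hu.shift _)⟩

theorem DfT.subst {f : (ℕ → M) → M} (h : DfT C f) (t : ℕ → (ℕ → M) → M)
    (ht : ∀ i, DfT C (t i)) : DfT C (fun v => f (fun i => t i v)) := by
  refine ⟨(h.out.subst (fun | 0 => fun v => v 0 | i + 1 => fun v => t i (fun j => v (j+1))) ?_)⟩
  intro i
  cases i with
  | zero => exact DfT.var 0
  | succ i => exact (ht i).shift _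

/-- Sections of definable predicates. -/
theorem Df.sec {Q : (ℕ → M) → M → Prop} (h : Df C (fun w => Q (fun i => w (i + 1)) (w 0)))
    (v : ℕ → M) : Df Any (fun w => Q v (w 0)) :=
  h.any.subst (fun | 0 => fun w => w 0 | i + 1 => fun _ => v i)
    (fun | 0 => inferInstance | i + 1 => inferInstance)

theorem Df.sec2 {Q : (ℕ → M) → M → M → Prop}
    (h : Df C (fun w => Q (fun i => w (i + 2)) (w 1) (w 0)))
    (v : ℕ → M) : Df Any (fun w => Q v (w 0) (w 1)) :=
  h.any.subst (fun | 0 => fun w => w 1 | 1 => fun w => w 0 | i + 2 => fun _ => v i)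
    (fun | 0 => inferInstance | 1 => inferInstance | i + 2 => inferInstance)

theorem DfT.any {t : (ℕ → M) → M} (h : DfT C t) : DfT Any t := ⟨h.out.any⟩

theorem DfT.sec {f : (ℕ → M) → M → M} (h : DfT C (fun w => f (fun i => w (i + 1)) (w 0)))
    (v : ℕ → M) : DfT Any (fun w => f v (w 0)) :=
  h.any.subst (fun | 0 => fun w => w 0 | i + 1 => fun _ => v i)
    (fun | 0 => inferInstance | i + 1 => inferInstance)

theorem DfT.sec2 {f : (ℕ → M) → M → M → M}
    (h : DfT C (fun w => f (fun i => w (i + 2)) (w 1) (w 0)))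
    (v : ℕ → M) : DfT Any (fun w => f v (w 0) (w 1)) :=
  h.any.subst (fun | 0 => fun w => w 1 | 1 => fun w => w 0 | i + 2 => fun _ => v i)
    (fun | 0 => inferInstance | 1 => inferInstance | i + 2 => inferInstance)

/-- Translation to `SetFormula`. -/
theorem tr_ex (φ : Fm M) : ∀ (n : ℕ) (ρ : ℕ → Fin n) (σ : M → Fin n),
    ∃ ψ : SetFormula n, ∀ u : Fin n → M, φ.cn (fun c => u (σ c) = c) →
      (Realize Mdl.E ψ u ↔ sat φ (fun i => u (ρ i))) := by
  have tm : ∀ (n : ℕ) (ρ : ℕ → Fin n) (σ : M → Fin n) (s : ℕ ⊕ M), ∃ i : Fin n,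
      ∀ u : Fin n → M, trm (fun c => u (σ c) = c) s → u i = ev (fun i => u (ρ i)) s := by
    intro n ρ σ s
    cases s with
    | inl i => exact ⟨ρ i, fun u _ => rfl⟩
    | inr c => exact ⟨σ c, fun u h => h⟩
  induction φ with
  | mem s t =>
    intro n ρ σ
    obtain ⟨i, hi⟩ := tm n ρ σ s
    obtain ⟨j, hj⟩ := tm n ρ σ t
    exact ⟨.mem i j, fun u h => by simp only [Realize, sat, satR]; rw [hi u h.1, hj u h.2]⟩
  | eq s t =>
    intro n ρ σ
    obtain ⟨i, hi⟩ := tm n ρ σ s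
    obtain ⟨j, hj⟩ := tm n ρ σ t
    exact ⟨.eq i j, fun u h => by simp only [Realize, sat, satR]; rw [hi u h.1, hj u h.2]⟩
  | fal => intro n ρ σ; exact ⟨.fal, fun u h => Iff.rfl⟩
  | imp φ ψ h1 h2 =>
    intro n ρ σ
    obtain ⟨a, ha⟩ := h1 n ρ σ
    obtain ⟨b, hb⟩ := h2 n ρ σ
    exact ⟨.imp a b, fun u h => by simp only [Realize, sat, satR]; rw [ha u h.1, hb u h.2]⟩
  | all φ ih =>
    intro n ρ σ
    obtain ⟨a, ha⟩ := ih (n+1) (fun | 0 => Fin.last n | i + 1 => (ρ i).castSucc)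
      (fun c => (σ c).castSucc)
    refine ⟨.all a, fun u h => ?_⟩
    simp only [Realize, sat, satR]
    refine forall_congr' fun x => ?_
    rw [ha]
    · have : (fun i => (Fin.snoc u x : Fin (n+1) → M) (match i with
        | 0 => Fin.last n | i + 1 => (ρ i).castSucc)) = cs x (fun i => u (ρ i)) := by
        funext i; cases i <;> simp [cs]
      rw [this]
      exact ⟨fun h _ => h, fun h => h trivial⟩
    · simp only [Fm.cn] at h
      simpa using h

def Fm.cl : Fm M → List M
  | .mem s t => (s.elim (fun _ => []) (fun c => [c])) ++ (t.elim (fun _ => []) (fun c => [c]))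
  | .eq s t => (s.elim (fun _ => []) (fun c => [c])) ++ (t.elim (fun _ => []) (fun c => [c]))
  | .fal => []
  | .imp φ ψ => φ.cl ++ ψ.cl
  | .all φ => φ.cl

theorem cn_cl (φ : Fm M) : φ.cn (fun c => c ∈ φ.cl) := by
  have tm : ∀ (D : M → Prop) (s : ℕ ⊕ M), (∀ c ∈ (s.elim (fun _ => []) (fun c => [c]) : List M), D c) →
      trm D s := by
    intro D s h
    cases s with
    | inl i => trivial
    | inr c => exact h c (by simp)
  induction φ with
  | mem s t => exact ⟨tm _ s (by simp [Fm.cl]; tauto), tm _ t (by simp [Fm.cl]; tauto)⟩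
  | eq s t => exact ⟨tm _ s (by simp [Fm.cl]; tauto), tm _ t (by simp [Fm.cl]; tauto)⟩
  | fal => trivial
  | imp φ ψ h1 h2 =>
    exact ⟨cn_mono (fun x h => by simp [Fm.cl, h]) _ h1, cn_mono (fun x h => by simp [Fm.cl, h]) _ h2⟩
  | all φ ih => exact ih

open Classical in
theorem tr1 (P : M → Prop) (h : Df Any (fun v => P (v 0))) :
    ∃ (k : ℕ) (φ : SetFormula (k+1)) (p : Fin k → M), ∀ z, Realize Mdl.E φ (Fin.cons z p) ↔ P z := by
  obtain ⟨φ, -, hφ⟩ := h.out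
  obtain ⟨ψ, hψ⟩ := tr_ex φ (φ.cl.length + 1) (fun _ => 0)
    (fun c => if h : φ.cl.idxOf c < φ.cl.length then Fin.succ ⟨_, h⟩ else 0)
  refine ⟨_, ψ, fun i => φ.cl.get i, fun z => ?_⟩
  rw [hψ, hφ]
  · simp
  · refine cn_mono ?_ _ (cn_cl φ)
    intro c hc
    have := List.idxOf_lt_length_iff.2 hc
    rw [dif_pos this, Fin.cons_succ]; simp

open Classical in
theorem tr2 (P : M → M → Prop) (h : Df Any (fun v => P (v 0) (v 1))) :
    ∃ (k : ℕ) (φ : SetFormula (k+2)) (p : Fin k → M),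
      ∀ x y, Realize Mdl.E φ (Fin.cons x (Fin.cons y p)) ↔ P x y := by
  obtain ⟨φ, -, hφ⟩ := h.out
  obtain ⟨ψ, hψ⟩ := tr_ex φ (φ.cl.length + 2) (fun | 0 => 0 | _ => 1)
    (fun c => if h : φ.cl.idxOf c < φ.cl.length then Fin.succ (Fin.succ ⟨_, h⟩) else 0)
  refine ⟨_, ψ, fun i => φ.cl.get i, fun x y => ?_⟩
  rw [hψ, hφ]
  · simp
  · refine cn_mono ?_ _ (cn_cl φ)
    intro c hc
    have := List.idxOf_lt_length_iff.2 hc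
    rw [dif_pos this, Fin.cons_succ, Fin.cons_succ]; simp

/-- Relativized realization. -/
def RelR (S : M → Prop) : ∀ {n : ℕ}, SetFormula n → (Fin n → M) → Prop
  | _, .mem i j, v => v i ∊ v j
  | _, .eq i j, v => v i = v j
  | _, .fal, _ => False
  | _, .imp φ ψ, v => RelR S φ v → RelR S ψ v
  | _, .all φ, v => ∀ a, S a → RelR S φ (Fin.snoc v a)

theorem snoc_comp {A B : Type} {n : ℕ} (f : A → B) (u : Fin n → A) (a : A) :
    (fun i => f ((Fin.snoc u a : Fin (n+1) → A) i)) = Fin.snoc (fun i => f (u i)) (f a) := by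
  funext i
  refine Fin.lastCases ?_ (fun i => ?_) i <;> simp

theorem realize_sub (S : M → Prop) {n : ℕ} (φ : SetFormula n) : ∀ (u : Fin n → {x : M // S x}),
    Realize (fun a b : {x : M // S x} => a.1 ∊ b.1) φ u ↔ RelR S φ (fun i => (u i).1) := by
  induction φ with
  | mem i j => intro u; rfl
  | eq i j => intro u; simp only [Realize, RelR]; exact Subtype.ext_iff
  | fal => intro u; rfl
  | imp φ ψ h1 h2 => intro u; simp only [Realize, RelR, h1, h2]
  | all φ ih =>
    intro u
    simp only [Realize, RelR, ih, Subtype.forall]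
    refine forall_congr' fun a => forall_congr' fun h => ?_
    rw [snoc_comp (fun x : {x : M // S x} => x.1)]

theorem realize_any {n : ℕ} (φ : SetFormula n) : ∀ (u : Fin n → M),
    Realize Mdl.E φ u ↔ RelR Any φ u := by
  induction φ with
  | mem i j => intro u; rfl
  | eq i j => intro u; rfl
  | fal => intro u; rfl
  | imp φ ψ h1 h2 => intro u; simp only [Realize, RelR, h1, h2]
  | all φ ih =>
    intro u
    simp only [Realize, RelR, ih]
    exact forall_congr' fun a => ⟨fun h _ => h, fun h => h trivial⟩

theorem Df.relR {S : M → M → Prop} (hS : Df C (fun v => S (v 0) (v 1))) {w : (ℕ → M) → M}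
    (hw : DfT C w) {n : ℕ} (φ : SetFormula n) : ∀ (t : Fin n → (ℕ → M) → M),
    (∀ i, DfT C (t i)) → Df C (fun v => RelR (S (w v)) φ (fun i => t i v)) := by
  induction φ generalizing w with
  | mem i j => intro t ht; have := ht i; have := ht j; exact Df.mem
  | eq i j => intro t ht; have := ht i; have := ht j; exact Df.eq
  | fal => intro t ht; exact Df.fal
  | imp φ ψ h1 h2 => intro t ht; have := h1 hw t ht; have := h2 hw t ht; exact Df.imp
  | @all n φ ih =>
    intro t ht
    have hw' : DfT C (fun v => w (fun i => v (i+1))) := hw.shift _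
    have h1 : Df C (fun v => S (w (fun i => v (i+1))) (v 0)) := hS.sub2 hw' (DfT.var 0)
    have h2 := ih hw' (Fin.snoc (fun i v => t i (fun j => v (j+1))) (fun v => v 0)) (by
      intro i
      refine Fin.lastCases ?_ (fun i => ?_) i
      · simp only [Fin.snoc_last]; infer_instance
      · simp only [Fin.snoc_castSucc]; exact (ht i).shift _)
    refine @Df.all _ _ _ (fun v a => S (w v) a → RelR (S (w v)) φ (Fin.snoc (fun i => t i v) a)) ?_
    refine @Df.imp _ _ _ _ _ h1 (h2.congr fun v => ?_)
    rw [snoc_comp (fun f : (ℕ → M) → M => f v)]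

theorem Df.realize {n : ℕ} (φ : SetFormula n) (t : Fin n → (ℕ → M) → M)
    (ht : ∀ i, DfT C (t i)) : Df C (fun v => Realize Mdl.E φ (fun i => t i v)) := by
  have h : Df C (fun v : ℕ → M => (fun _ _ => True : M → M → Prop) (v 0) (v 1)) := Df.tru
  exact (Df.relR (S := fun _ => Any) h (DfT.var 0) φ t ht).congr fun v => (realize_any _ _).symm

end FW
end Paper

set_option linter.all false
namespace Paper

infix:50 "⊑" => SubE Mdl.E
notation "Od" => OrdE Mdl.E

section S2
variable {M : Type} [Mdl M] {C : M → Prop}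

instance : Nonempty M := (Mdl.ax (M := M)).1

theorem sext {a b : M} (h : ∀ z, z ∊ a ↔ z ∊ b) : a = b := (Mdl.ax (M := M)).2.1.1 a b h

theorem sub_antisymm {a b : M} (h : a ⊑ b) (h' : b ⊑ a) : a = b := sext fun z => ⟨h z, h' z⟩

def IsSet (P : M → Prop) : Prop := ∃ s, ∀ z, z ∊ s ↔ P z

noncomputable def mk (P : M → Prop) : M := Classical.epsilon (fun s => ∀ z, z ∊ s ↔ P z)

theorem mem_mk {P : M → Prop} (h : IsSet P) (z : M) : z ∊ mk P ↔ P z := Classical.epsilon_spec h z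

theorem eq_mk {P : M → Prop} (h : IsSet P) (x : M) : x = mk P ↔ ∀ z, z ∊ x ↔ P z :=
  ⟨fun e z => by rw [e, mem_mk h], fun e => sext fun z => by rw [e, mem_mk h]⟩

theorem DfT.ofMk {P : (ℕ → M) → M → Prop} (hs : ∀ v, IsSet (P v))
    [hP : Df C (fun w => P (fun i => w (i+1)) (w 0))] :
    DfT C (fun v => Paper.mk (P v)) := by
  refine DfT.of (fun v x => ∀ z, z ∊ x ↔ P v z) (fun v x => eq_mk (hs v) x) ?_
  refine @Df.all _ _ _ (fun w z => z ∊ w 0 ↔ P (fun i => w (i+1)) z) ?_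
  have h1 : Df C (fun w => P (fun i => w (i+2)) (w 0)) := hP.shift (fun | 0 => 0 | i + 1 => i + 2)
  exact @Df.iff _ _ _ _ _ inferInstance h1

theorem isSet_sep (a : M) (P : M → Prop) [h : Df Any (fun v => P (v 0))] :
    IsSet (fun z => z ∊ a ∧ P z) := by
  obtain ⟨k, φ, p, hp⟩ := tr1 P h
  obtain ⟨s, hs⟩ := (Mdl.ax (M := M)).2.1.2.2.2.2.2.1 k φ p a
  exact ⟨s, fun z => by rw [hs, hp]⟩

theorem IsSet.congr {P Q : M → Prop} (h : IsSet P) (e : ∀ z, P z ↔ Q z) : IsSet Q :=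
  h.imp fun _ h z => (h z).trans (e z)

theorem isSet_of_bound (a : M) (P : M → Prop) [h : Df Any (fun v => P (v 0))]
    (hb : ∀ z, P z → z ∊ a) : IsSet P :=
  (isSet_sep a P).congr fun z => ⟨fun h => h.2, fun h => ⟨hb z h, h⟩⟩

theorem isSet_upair (a b : M) : IsSet (fun z => z = a ∨ z = b) := (Mdl.ax (M := M)).2.1.2.1 a b
theorem isSet_un (a : M) : IsSet (fun z => ∃ y, y ∊ a ∧ z ∊ y) := (Mdl.ax (M := M)).2.1.2.2.1 a
theorem isSet_pow (a : M) : IsSet (fun z => z ⊑ a) := (Mdl.ax (M := M)).2.2.1 a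

theorem isSet_emp : IsSet (fun _ : M => False) := by
  obtain ⟨a⟩ := (inferInstance : Nonempty M)
  exact (isSet_sep a (fun _ => False)).congr (by simp)

theorem isSet_img (a : M) (f : M → M) [h : DfT Any (fun v => f (v 0))] :
    IsSet (fun z => ∃ x, x ∊ a ∧ z = f x) := by
  have h2 : Df Any (fun v => v 1 = f (v 0)) :=
    Df.eq (hs := h)
  obtain ⟨k, φ, p, hp⟩ := tr2 (fun x y => y = f x) h2
  obtain ⟨s, hs⟩ := (Mdl.ax (M := M)).2.1.2.2.2.2.2.2 k φ p a (by
    intro x _ y y' h1 h2; rw [hp] at h1 h2; rw [h1, h2])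
  exact ⟨s, fun z => by simp only [hs, hp]⟩

noncomputable def emp : M := mk (fun _ => False)
noncomputable def upair (a b : M) : M := mk (fun z => z = a ∨ z = b)
noncomputable def un (a : M) : M := mk (fun z => ∃ y, y ∊ a ∧ z ∊ y)
noncomputable def pow (a : M) : M := mk (fun z => z ⊑ a)
noncomputable def sep (a : M) (P : M → Prop) : M := mk (fun z => z ∊ a ∧ P z)
noncomputable def img (a : M) (f : M → M) : M := mk (fun z => ∃ x, x ∊ a ∧ z = f x)

@[simp] theorem mem_emp (z : M) : ¬ z ∊ (emp : M) := fun h => (mem_mk isSet_emp z).1 h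
@[simp] theorem mem_upair (a b z : M) : z ∊ upair a b ↔ z = a ∨ z = b := mem_mk (isSet_upair a b) z
@[simp] theorem mem_un (a z : M) : z ∊ un a ↔ ∃ y, y ∊ a ∧ z ∊ y := mem_mk (isSet_un a) z
@[simp] theorem mem_pow (a z : M) : z ∊ pow a ↔ z ⊑ a := mem_mk (isSet_pow a) z
theorem mem_sep (a : M) (P : M → Prop) [Df Any (fun v => P (v 0))] (z : M) :
    z ∊ sep a P ↔ z ∊ a ∧ P z := mem_mk (isSet_sep a P) z
theorem mem_img (a : M) (f : M → M) [DfT Any (fun v => f (v 0))] (z : M) :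
    z ∊ img a f ↔ ∃ x, x ∊ a ∧ z = f x := mem_mk (isSet_img a f) z

instance iP_sub {t s : (ℕ → M) → M} [ht : DfT C t] [hs : DfT C s] : Df C (fun v => t v ⊑ s v) := by
  refine Df.sub2 (P := SubE Mdl.E) ?_ ht hs
  unfold SubE; infer_instance

instance : DfT C (fun _ => (emp : M)) := DfT.ofMk (fun _ => isSet_emp)

instance (priority := 2000) iT_upair {t s : (ℕ → M) → M} [ht : DfT C t] [hs : DfT C s] :
    DfT C (fun v => upair (t v) (s v)) :=
  DfT.sub2 (DfT.ofMk (P := fun v z => z = v 0 ∨ z = v 1) (fun _ => isSet_upair _ _)) ht hs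

instance iT_un {t : (ℕ → M) → M} [ht : DfT C t] : DfT C (fun v => un (t v)) :=
  DfT.sub1 (DfT.ofMk (P := fun v z => ∃ y, y ∊ v 0 ∧ z ∊ y) (fun _ => isSet_un _)) ht

instance iT_pow {t : (ℕ → M) → M} [ht : DfT C t] : DfT C (fun v => pow (t v)) :=
  DfT.sub1 (DfT.ofMk (P := fun v z => z ⊑ v 0) (fun _ => isSet_pow _)) ht

instance iT_sep {t : (ℕ → M) → M} {P : (ℕ → M) → M → Prop} [ht : DfT C t]
    [hP : Df C (fun w => P (fun i => w (i+1)) (w 0))] : DfT C (fun v => sep (t v) (P v)) := by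
  have h1 : DfT C (fun v => t (fun i => v (i+1))) := ht.shift _
  have : ∀ v, Df Any (fun w => P v (w 0)) := fun v => hP.sec v
  exact DfT.ofMk (P := fun v z => z ∊ t v ∧ P v z) (fun v => isSet_sep (t v) (P v))

instance iT_img {t : (ℕ → M) → M} {f : (ℕ → M) → M → M} [ht : DfT C t]
    [hf : DfT C (fun w => f (fun i => w (i+1)) (w 0))] : DfT C (fun v => img (t v) (f v)) := by
  have h1 : DfT C (fun v => t (fun i => v (i+1+1))) := ht.shift _
  have h2 : DfT C (fun v => f (fun i => v (i+1+1)) (v 0)) :=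
    hf.shift (fun | 0 => 0 | i + 1 => i + 2)
  have : ∀ v, DfT Any (fun w => f v (w 0)) := fun v => hf.sec v
  exact DfT.ofMk (P := fun v z => ∃ x, x ∊ t v ∧ z = f v x) (fun v => isSet_img (t v) (f v))

instance iT_ite {P : (ℕ → M) → Prop} {t s : (ℕ → M) → M} [hP : Df C P] [ht : DfT C t]
    [hs : DfT C s] [inst : ∀ v, Decidable (P v)] : DfT C (fun v => if P v then t v else s v) := by
  have h1 : DfT C (fun v => t (fun i => v (i+1))) := ht.shift _
  have h2 : DfT C (fun v => s (fun i => v (i+1))) := hs.shift _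
  have h3 : Df C (fun v => P (fun i => v (i+1))) := hP.shift _
  refine DfT.of (fun v x => (P v ∧ x = t v) ∨ (¬ P v ∧ x = s v)) (fun v x => ?_) inferInstance
  by_cases h : P v <;> simp [h]

noncomputable def pair (a b : M) : M := upair (upair a a) (upair a b)

instance iT_pair {t s : (ℕ → M) → M} [ht : DfT C t] [hs : DfT C s] :
    DfT C (fun v => pair (t v) (s v)) := by unfold Paper.pair; infer_instance

theorem upair_inj {a b c d : M} (h : upair a b = upair c d) : (a = c ∧ b = d) ∨ (a = d ∧ b = c) := by
  have h' : ∀ z, (z = a ∨ z = b) ↔ (z = c ∨ z = d) := fun z => by rw [← mem_upair, h, mem_upair]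
  have := h' a; have := h' b; have := h' c; have := h' d
  grind

theorem pair_inj {a b c d : M} : pair a b = pair c d ↔ a = c ∧ b = d := by
  refine ⟨fun h => ?_, fun h => by rw [h.1, h.2]⟩
  rcases upair_inj h with ⟨h1, h2⟩ | ⟨h1, h2⟩ <;> rcases upair_inj h1 with ⟨h3, h4⟩ | ⟨h3, h4⟩ <;>
    rcases upair_inj h2 with ⟨h5, h6⟩ | ⟨h5, h6⟩ <;> grind

theorem upairE_iff (p a b : M) : UPairE Mdl.E p a b ↔ p = upair a b :=
  ⟨fun h => sext fun z => by rw [h, mem_upair], fun h z => by rw [h, mem_upair]⟩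

theorem oPairE_iff (p a b : M) : OPairE Mdl.E p a b ↔ p = pair a b := by
  simp only [OPairE, upairE_iff]
  constructor
  · rintro ⟨s, t, rfl, rfl, rfl⟩; rfl
  · rintro rfl; exact ⟨_, _, rfl, rfl, rfl⟩

theorem pairMemE_iff (f x y : M) : PairMemE Mdl.E f x y ↔ pair x y ∊ f := by
  simp [PairMemE, oPairE_iff]

noncomputable def fst (z : M) : M :=
  mk (fun u => ∃ x y, z = pair x y ∧ u ∊ x)
noncomputable def snd (z : M) : M :=
  mk (fun u => ∃ x y, z = pair x y ∧ u ∊ y)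

theorem isSet_fst (z : M) : IsSet (fun u => ∃ x y, z = pair x y ∧ u ∊ x) := by
  refine isSet_of_bound (un (un z)) _ ?_
  rintro u ⟨x, y, rfl, h⟩
  simp only [mem_un]; exact ⟨x, ⟨upair x y, by simp [pair], by simp⟩, h⟩
theorem isSet_snd (z : M) : IsSet (fun u => ∃ x y, z = pair x y ∧ u ∊ y) := by
  refine isSet_of_bound (un (un z)) _ ?_
  rintro u ⟨x, y, rfl, h⟩
  simp only [mem_un]; exact ⟨y, ⟨upair x y, by simp [pair], by simp⟩, h⟩

@[simp] theorem fst_pair (a b : M) : fst (pair a b) = a := sext fun z => by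
  rw [fst, mem_mk (isSet_fst _)]
  constructor
  · rintro ⟨x, y, h, h'⟩; rw [pair_inj] at h; rw [h.1]; exact h'
  · intro h; exact ⟨a, b, rfl, h⟩
@[simp] theorem snd_pair (a b : M) : snd (pair a b) = b := sext fun z => by
  rw [snd, mem_mk (isSet_snd _)]
  constructor
  · rintro ⟨x, y, h, h'⟩; rw [pair_inj] at h; rw [h.2]; exact h'
  · intro h; exact ⟨a, b, rfl, h⟩

instance iT_fst {t : (ℕ → M) → M} [ht : DfT C t] : DfT C (fun v => fst (t v)) :=
  DfT.sub1 (DfT.ofMk (P := fun v u => ∃ x y, v 0 = pair x y ∧ u ∊ x) (fun _ => isSet_fst _)) ht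
instance iT_snd {t : (ℕ → M) → M} [ht : DfT C t] : DfT C (fun v => snd (t v)) :=
  DfT.sub1 (DfT.ofMk (P := fun v u => ∃ x y, v 0 = pair x y ∧ u ∊ y) (fun _ => isSet_snd _)) ht

/-- Application of a function coded as a set of pairs. -/
noncomputable def app (f x : M) : M := mk (fun z => ∃ y, pair x y ∊ f ∧ z ∊ y)

theorem isSet_app (f x : M) : IsSet (fun z => ∃ y, pair x y ∊ f ∧ z ∊ y) := by
  refine isSet_of_bound (un (un (un f))) _ ?_
  rintro z ⟨y, h, h'⟩
  simp only [mem_un]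
  exact ⟨y, ⟨upair x y, ⟨_, h, by simp [pair]⟩, by simp⟩, h'⟩

theorem app_eq {f x y : M} (h : pair x y ∊ f) (hu : ∀ y', pair x y' ∊ f → y' = y) : app f x = y :=
  sext fun z => by
    rw [app, mem_mk (isSet_app _ _)]
    constructor
    · rintro ⟨y', h1, h2⟩; rw [← hu _ h1]; exact h2
    · intro h2; exact ⟨y, h, h2⟩

instance iT_app {t s : (ℕ → M) → M} [ht : DfT C t] [hs : DfT C s] :
    DfT C (fun v => app (t v) (s v)) :=
  DfT.sub2 (DfT.ofMk (P := fun v z => ∃ y, pair (v 1) y ∊ v 0 ∧ z ∊ y) (fun _ => isSet_app _ _)) ht hs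

/-- Graph of a definable function on a set. -/
noncomputable def gr (a : M) (f : M → M) : M := img a (fun x => pair x (f x))

instance iT_gr {t : (ℕ → M) → M} {f : (ℕ → M) → M → M} [ht : DfT C t]
    [hf : DfT C (fun w => f (fun i => w (i+1)) (w 0))] : DfT C (fun v => gr (t v) (f v)) := by
  unfold Paper.gr; infer_instance

theorem mem_gr (a : M) (f : M → M) [DfT Any (fun v => f (v 0))] (x y : M) :
    pair x y ∊ gr a f ↔ x ∊ a ∧ y = f x := by
  rw [gr, mem_img]; simp only [pair_inj]
  constructor
  · rintro ⟨x', h1, rfl, rfl⟩; exact ⟨h1, rfl⟩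
  · rintro ⟨h, rfl⟩; exact ⟨x, h, rfl, rfl⟩

theorem app_gr {a : M} {f : M → M} [DfT Any (fun v => f (v 0))] {x : M} (h : x ∊ a) :
    app (gr a f) x = f x :=
  app_eq ((mem_gr _ _ _ _).2 ⟨h, rfl⟩) (fun y' h => ((mem_gr _ _ _ _).1 h).2)

noncomputable def cup (a b : M) : M := un (upair a b)
@[simp] theorem mem_cup (a b z : M) : z ∊ cup a b ↔ z ∊ a ∨ z ∊ b := by
  simp [cup, or_and_right, exists_or]
instance iT_cup {t s : (ℕ → M) → M} [ht : DfT C t] [hs : DfT C s] :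
    DfT C (fun v => cup (t v) (s v)) := by unfold Paper.cup; infer_instance

noncomputable def cap (a b : M) : M := sep a (fun z => z ∊ b)
@[simp] theorem mem_cap (a b z : M) : z ∊ cap a b ↔ z ∊ a ∧ z ∊ b := by rw [cap, mem_sep]
instance iT_cap {t s : (ℕ → M) → M} [ht : DfT C t] [hs : DfT C s] :
    DfT C (fun v => cap (t v) (s v)) := by
  refine DfT.sub2 (f := Paper.cap) ?_ ht hs
  unfold Paper.cap; infer_instance

theorem interE_iff (b a c : M) : InterSpecE Mdl.E b a c ↔ b = cap a c :=
  ⟨fun h => sext fun z => by rw [h, mem_cap], fun h z => by rw [h, mem_cap]⟩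

noncomputable def succ (a : M) : M := cup a (upair a a)
@[simp] theorem mem_succ (a z : M) : z ∊ succ a ↔ z ∊ a ∨ z = a := by simp [succ]
instance iT_succ {t : (ℕ → M) → M} [ht : DfT C t] :
    DfT C (fun v => succ (t v)) := by unfold Paper.succ; infer_instance

theorem succE_iff (s y : M) : SuccSpecE Mdl.E s y ↔ s = succ y :=
  ⟨fun h => sext fun z => by rw [h, mem_succ], fun h z => by rw [h, mem_succ]⟩

theorem emptyE_iff (s : M) : EmptyE Mdl.E s ↔ s = emp :=
  ⟨fun h => sext fun z => ⟨fun h' => (h z h').elim, fun h' => (mem_emp _ h').elim⟩,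
    fun h z => by rw [h]; exact mem_emp z⟩

theorem ne_emp {a : M} (h : a ≠ emp) : ∃ z, z ∊ a := by
  by_contra h'; push Not at h'; exact h ((emptyE_iff a).1 h')

instance iP_trans {t : (ℕ → M) → M} [ht : DfT C t] : Df C (fun v => TransE Mdl.E (t v)) := by
  refine Df.sub1 (P := TransE Mdl.E) ?_ ht
  unfold TransE; infer_instance
instance iP_ord {t : (ℕ → M) → M} [ht : DfT C t] : Df C (fun v => Od (t v)) := by
  refine Df.sub1 (P := Od) ?_ ht
  unfold OrdE; infer_instance

theorem found {a z : M} (h : z ∊ a) : ∃ m, m ∊ a ∧ ∀ z, z ∊ a → ¬ z ∊ m :=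
  (Mdl.ax (M := M)).2.1.2.2.2.2.1 a ⟨z, h⟩

theorem mem_irrefl (x : M) : ¬ x ∊ x := by
  obtain ⟨m, hm, h⟩ := found (a := upair x x) (z := x) (by simp)
  simp at hm h; subst hm; exact h
theorem mem_asymm {x y : M} (h1 : x ∊ y) (h2 : y ∊ x) : False := by
  obtain ⟨m, hm, h⟩ := found (a := upair x y) (z := x) (by simp)
  simp at hm h; rcases hm with rfl | rfl
  · exact h.2 h2
  · exact h.1 h1

/-! Ordinals -/
theorem OrdE.mem {a b : M} (ha : Od a) (hb : b ∊ a) : Od b :=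
  ⟨ha.2 b hb, fun y hy => ha.2 y (ha.1 b hb y hy)⟩
theorem OrdE.tr {a b c : M} (ha : Od a) (hb : b ∊ a) (hc : c ∊ b) : c ∊ a := ha.1 b hb c hc

theorem OrdE.succ {a : M} (ha : Od a) : Od (succ a) := by
  constructor
  · intro y hy z hz
    simp at hy ⊢
    rcases hy with hy | rfl
    · exact .inl (ha.tr hy hz)
    · exact .inl hz
  · intro y hy
    simp at hy
    rcases hy with hy | rfl
    · exact ha.2 y hy
    · exact ha.1

theorem ord_tri {a b : M} (ha : Od a) (hb : Od b) : a ∊ b ∨ a = b ∨ b ∊ a := by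
  by_contra hab
  let X := sep (succ a) (fun x => ∃ y, y ∊ succ b ∧ ¬ (x ∊ y ∨ x = y ∨ y ∊ x))
  have hX : a ∊ X := (mem_sep _ _ _).2 ⟨by simp, b, by simp, hab⟩
  obtain ⟨x, hx, hxm⟩ := found hX
  obtain ⟨hxa, y0, hy0⟩ := (mem_sep _ _ _).1 hx
  let Y := sep (succ b) (fun y => ¬ (x ∊ y ∨ x = y ∨ y ∊ x))
  have hY : y0 ∊ Y := (mem_sep _ _ _).2 hy0
  obtain ⟨y, hy, hym⟩ := found hY
  obtain ⟨hyb, hxy⟩ := (mem_sep _ _ _).1 hy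
  have ox := ha.succ.mem hxa
  have oy := hb.succ.mem hyb
  refine hxy (.inr (.inl (sub_antisymm (fun u hu => ?_) (fun u hu => ?_))))
  · by_contra huy
    refine hxm u ((mem_sep _ _ _).2 ⟨ha.succ.tr hxa hu, y, hyb, ?_⟩) hu
    rintro (h | rfl | h)
    · exact huy h
    · exact hxy (.inr (.inr hu))
    · exact hxy (.inr (.inr (ox.tr hu h)))
  · by_contra huy
    refine hym u ((mem_sep _ _ _).2 ⟨hb.succ.tr hyb hu, ?_⟩) hu
    rintro (h | rfl | h)
    · exact hxy (.inl (oy.tr hu h))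
    · exact hxy (.inl hu)
    · exact huy h

theorem OrdE.sub {a b : M} (ha : Od a) (hb : b ∊ a) : b ⊑ a := fun _ h => ha.tr hb h

theorem sub_refl (a : M) : a ⊑ a := fun _ h => h
theorem sub_trans {a b c : M} (h1 : a ⊑ b) (h2 : b ⊑ c) : a ⊑ c := fun z h => h2 z (h1 z h)

theorem ord_le_or_lt {a b : M} (ha : Od a) (hb : Od b) : a ⊑ b ∨ b ∊ a := by
  rcases ord_tri ha hb with h | rfl | h
  · exact .inl (hb.sub h)
  · exact .inl (sub_refl _)
  · exact .inr h

theorem ord_le_iff {a b : M} (ha : Od a) (hb : Od b) : a ⊑ b ↔ a ∊ b ∨ a = b := by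
  constructor
  · intro h
    rcases ord_tri ha hb with h' | h' | h'
    · exact .inl h'
    · exact .inr h'
    · exact (mem_irrefl _ (h _ h')).elim
  · rintro (h | rfl)
    · exact hb.sub h
    · exact sub_refl _

theorem ord_not_lt {a b : M} (ha : Od a) (hb : Od b) : ¬ b ∊ a ↔ a ⊑ b :=
  ⟨fun h => (ord_le_or_lt ha hb).resolve_right h, fun h h' => mem_irrefl _ (h _ h')⟩

theorem ord_lt_of_le_lt {a b c : M} (ha : Od a) (hc : Od c) (h1 : a ⊑ b) (h2 : b ∊ c) : a ∊ c := by
  rcases (ord_le_iff ha (hc.mem h2)).1 h1 with h | rfl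
  · exact hc.tr h2 h
  · exact h2

theorem ord_succ_le {a b : M} (hb : Od b) : succ a ⊑ b ↔ a ∊ b := by
  constructor
  · intro h; exact h a (by simp)
  · intro h z hz; simp at hz; rcases hz with hz | rfl
    · exact hb.tr h hz
    · exact h

theorem ord_lt_succ {a b : M} (ha : Od a) (hb : Od b) : a ∊ succ b ↔ a ⊑ b := by
  rw [ord_le_iff ha hb]; simp

theorem ord_emp : Od (emp : M) := ⟨fun y h => (mem_emp _ h).elim, fun y h => (mem_emp _ h).elim⟩

theorem ord_un {a : M} (h : ∀ x, x ∊ a → Od x) : Od (un a) := by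
  constructor
  · intro y hy z hz; simp at hy ⊢
    obtain ⟨x, hx, hyx⟩ := hy
    exact ⟨x, hx, (h x hx).tr hyx hz⟩
  · intro y hy; simp at hy
    obtain ⟨x, hx, hyx⟩ := hy
    exact (h x hx).2 y hyx

theorem le_un {a x : M} (h : x ∊ a) : x ⊑ un a := fun z hz => by simp; exact ⟨x, h, hz⟩
theorem un_le {a b : M} (h : ∀ x, x ∊ a → x ⊑ b) : un a ⊑ b := fun z hz => by
  simp at hz; obtain ⟨x, hx, hz⟩ := hz; exact h x hx z hz

theorem ord_of_trans {a : M} (h : ∀ x, x ∊ a → Od x) (ht : TransE Mdl.E a) : Od a :=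
  ⟨ht, fun y hy => (h y hy).1⟩

/-- Least element principle. -/
theorem ord_min (P : M → Prop) [Df Any (fun v => P (v 0))] {a : M} (ha : Od a) (hP : P a) :
    ∃ m, Od m ∧ P m ∧ ∀ z, z ∊ m → ¬ P z := by
  have h : a ∊ sep (succ a) P := (mem_sep _ _ _).2 ⟨by simp, hP⟩
  obtain ⟨m, hm, hmin⟩ := found h
  rw [mem_sep] at hm
  refine ⟨m, ha.succ.mem hm.1, hm.2, fun z hz hPz => ?_⟩
  exact hmin z ((mem_sep _ _ _).2 ⟨ha.succ.tr hm.1 hz, hPz⟩) hz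

theorem ord_ind (P : M → Prop) [Df Any (fun v => P (v 0))]
    (h : ∀ a, Od a → (∀ b, b ∊ a → P b) → P a) : ∀ a, Od a → P a := by
  intro a ha
  by_contra hP
  obtain ⟨m, hm, h1, h2⟩ := ord_min (fun x => ¬ P x) ha hP
  exact h1 (h m hm fun b hb => by have := h2 b hb; tauto)

/-- The least ordinal satisfying `P`, as the set of ordinals all of whose `≤` elements fail. -/
noncomputable def lst (P : M → Prop) : M :=
  Classical.epsilon (fun m => (Od m ∧ P m ∧ ∀ z, z ∊ m → ¬ P z) ∨ ((¬ ∃ a, Od a ∧ P a) ∧ m = emp))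

theorem lst_spec' (P : M → Prop) [Df Any (fun v => P (v 0))] :
    (Od (lst P) ∧ P (lst P) ∧ ∀ z, z ∊ lst P → ¬ P z) ∨
    ((¬ ∃ a, Od a ∧ P a) ∧ lst P = emp) := by
  apply Classical.epsilon_spec (p := fun m => (Od m ∧ P m ∧ ∀ z, z ∊ m → ¬ P z) ∨ ((¬ ∃ a, Od a ∧ P a) ∧ m = emp))
  by_cases h : ∃ a, Od a ∧ P a
  · obtain ⟨a, ha, hP⟩ := h
    obtain ⟨m, hm⟩ := ord_min P ha hP
    exact ⟨m, .inl hm⟩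
  · exact ⟨emp, .inr ⟨h, rfl⟩⟩

theorem lst_spec (P : M → Prop) [Df Any (fun v => P (v 0))] (h : ∃ a, Od a ∧ P a) :
    Od (lst P) ∧ P (lst P) ∧ ∀ z, z ∊ lst P → ¬ P z := by
  rcases lst_spec' P with h1 | h1
  · exact h1
  · exact (h1.1 h).elim

theorem lst_ord (P : M → Prop) [Df Any (fun v => P (v 0))] : Od (lst P) := by
  rcases lst_spec' P with h1 | h1
  · exact h1.1
  · rw [h1.2]; exact ord_emp

theorem lst_le (P : M → Prop) [Df Any (fun v => P (v 0))] {a : M} (ha : Od a) (h : P a) :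
    lst P ⊑ a := by
  have := lst_spec P ⟨a, ha, h⟩
  rw [← ord_not_lt this.1 ha]
  intro h'; exact this.2.2 _ h' h

theorem eq_lst (P : M → Prop) [Df Any (fun v => P (v 0))] (x : M) :
    x = lst P ↔ (Od x ∧ P x ∧ ∀ z, z ∊ x → ¬ P z) ∨ ((¬ ∃ a, Od a ∧ P a) ∧ x = emp) := by
  constructor
  · rintro rfl; exact lst_spec' P
  · rintro (h | h)
    · have := lst_spec P ⟨x, h.1, h.2.1⟩
      rcases ord_tri h.1 this.1 with h' | h' | h'
      · exact (this.2.2 _ h' h.2.1).elim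
      · exact h'
      · exact (h.2.2 _ h' this.2.1).elim
    · rcases lst_spec' P with h' | h'
      · exact (h.1 ⟨_, h'.1, h'.2.1⟩).elim
      · rw [h.2, h'.2]

instance iT_lst {P : (ℕ → M) → M → Prop} [hP : Df C (fun w => P (fun i => w (i+1)) (w 0))] :
    DfT C (fun v => lst (P v)) := by
  have : ∀ v, Df Any (fun w => P v (w 0)) := fun v => hP.sec v
  have h1 : Df C (fun w => P (fun i => w (i+1+1)) (w 0)) := hP.shift (fun | 0 => 0 | i + 1 => i + 2)
  exact DfT.of (fun v x => (Od x ∧ P v x ∧ ∀ z, z ∊ x → ¬ P v z) ∨ ((¬ ∃ a, Od a ∧ P v a) ∧ x = emp))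
    (fun v x => eq_lst (P v) x) inferInstance

/-! Limits and omega -/
instance iP_limit {t : (ℕ → M) → M} [ht : DfT C t] : Df C (fun v => LimitE Mdl.E (t v)) := by
  refine Df.sub1 (P := LimitE Mdl.E) ?_ ht
  unfold LimitE; infer_instance

notation "Lim" => LimitE Mdl.E

theorem ord_zero_succ_lim {a : M} (ha : Od a) : a = emp ∨ (∃ b, Od b ∧ a = succ b) ∨ Lim a := by
  by_cases h0 : a = emp
  · exact .inl h0
  by_cases h1 : ∃ b, Od b ∧ a = succ b
  · exact .inr (.inl h1)
  refine .inr (.inr ⟨ha, ne_emp h0, fun b hb => ⟨succ b, ?_, by simp⟩⟩)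
  have ob := ha.mem hb
  refine ((ord_le_iff ob.succ ha).1 ((ord_succ_le ha).2 hb)).resolve_right fun h => h1 ⟨b, ob, h.symm⟩

theorem lim_succ {a b : M} (ha : Lim a) (hb : b ∊ a) : succ b ∊ a := by
  obtain ⟨c, hc, h⟩ := ha.2.2 b hb
  have oc := ha.1.mem hc
  exact ord_lt_of_le_lt (oc.mem h).succ ha.1 ((ord_succ_le oc).2 h) hc

theorem lim_emp {a : M} (ha : Lim a) : emp ∊ a := by
  obtain ⟨w, hw⟩ := ha.2.1
  rcases ord_tri ord_emp ha.1 with h | rfl | h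
  · exact h
  · exact (mem_emp _ hw).elim
  · exact (mem_emp _ h).elim

theorem not_lim_succ (a : M) : ¬ Lim (succ a) := fun h => mem_irrefl _ (lim_succ h (by simp : a ∊ succ a))

theorem exists_limit : ∃ a : M, Lim a := by
  obtain ⟨I, ⟨e, he, he'⟩, hs⟩ := (Mdl.ax (M := M)).2.1.2.2.2.1
  rw [emptyE_iff] at he'; subst he'
  -- ordinals all of whose elements and itself lie in I
  let a := sep I (fun x => Od x ∧ ∀ y, y ∊ x → y ∊ I)
  have hm : ∀ z, z ∊ a ↔ z ∊ I ∧ Od z ∧ ∀ y, y ∊ z → y ∊ I := fun z => mem_sep _ _ _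
  have oa : Od a := ord_of_trans (fun x hx => ((hm x).1 hx).2.1) (fun x hx y hy => by
    have := (hm x).1 hx
    exact (hm y).2 ⟨this.2.2 y hy, this.2.1.mem hy, fun z hz => this.2.2 z (this.2.1.tr hy hz)⟩)
  refine ⟨a, oa, ⟨emp, (hm _).2 ⟨he, ord_emp, fun y h => (mem_emp _ h).elim⟩⟩, fun x hx => ⟨succ x, ?_, by simp⟩⟩
  have hx' := (hm x).1 hx
  obtain ⟨s, hs1, hs2⟩ := hs x hx'.1
  rw [succE_iff] at hs2; subst hs2
  refine (hm _).2 ⟨hs1, hx'.2.1.succ, fun y hy => ?_⟩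
  simp at hy; rcases hy with hy | rfl
  · exact hx'.2.2 y hy
  · exact hx'.1

noncomputable def omega : M := lst (fun a => Lim a)
instance iT_omega : DfT C (fun _ => (omega : M)) := by unfold Paper.omega; infer_instance

theorem omega_lim : Lim (omega : M) := (lst_spec (fun a : M => Lim a) (exists_limit.imp fun _ h => ⟨h.1, h⟩)).2.1
theorem omega_ord : Od (omega : M) := omega_lim.1
theorem omega_min {z : M} (h : z ∊ (omega : M)) : ¬ Lim z :=
  (lst_spec (fun a : M => Lim a) (exists_limit.imp fun _ h => ⟨h.1, h⟩)).2.2 z h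
theorem omegaE_iff (w : M) : OmegaSpecE Mdl.E w ↔ w = omega := by
  constructor
  · intro h
    rcases ord_tri h.1.1 omega_ord with h' | h' | h'
    · exact (omega_min h' h.1).elim
    · exact h'
    · exact (h.2 _ h' omega_lim).elim
  · rintro rfl; exact ⟨omega_lim, fun x hx => omega_min hx⟩

theorem omega_cases {n : M} (h : n ∊ (omega : M)) : n = emp ∨ ∃ m, m ∊ (omega : M) ∧ n = succ m := by
  rcases ord_zero_succ_lim (omega_ord.mem h) with h' | ⟨b, ob, rfl⟩ | h'
  · exact .inl h'
  · exact .inr ⟨b, omega_ord.tr h (by simp), rfl⟩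
  · exact (omega_min h h').elim

theorem omega_le_lim {a : M} (h : Lim a) : (omega : M) ⊑ a := lst_le (fun a : M => Lim a) h.1 h

theorem nat_ind (P : M → Prop) [Df Any (fun v => P (v 0))] (h0 : P emp)
    (hs : ∀ n, n ∊ (omega : M) → P n → P (succ n)) : ∀ n, n ∊ (omega : M) → P n := by
  intro n hn
  refine ord_ind (fun n => n ∊ (omega : M) → P n) (fun a _ ih ha => ?_) n (omega_ord.mem hn) hn
  rcases omega_cases ha with rfl | ⟨m, hm, rfl⟩
  · exact h0
  · exact hs m hm (ih m (by simp) hm)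

theorem succ_inj {a b : M} (h : succ a = succ b) : a = b := by
  have h1 : a ∊ succ b := by rw [← h]; simp
  have h2 : b ∊ succ a := by rw [h]; simp
  simp at h1 h2
  rcases h1 with h1 | h1
  · rcases h2 with h2 | h2
    · exact (mem_asymm h1 h2).elim
    · exact h2.symm
  · exact h1

end S2
end Paper

set_option linter.all false
namespace Paper
section S3
variable {M : Type} [Mdl M] {C : M → Prop}

def Att (pr : M → M) (G : M → M → M) (x f : M) : Prop :=
  f = gr (pr x) (fun y => G y (gr (pr y) (fun z => app f z)))

def AttU (pr : M → M) (G : M → M → M) (x f : M) : Prop :=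
  Att pr G x f ∧ ∀ f', Att pr G x f' → f' = f

noncomputable def recF (pr : M → M) (G : M → M → M) (x : M) : M :=
  Classical.epsilon (fun y => (∃ f, AttU pr G x f ∧ y = G x f) ∨ ((¬ ∃ f, AttU pr G x f) ∧ y = emp))

theorem eq_recF (pr : M → M) (G : M → M → M) (x y : M) : y = recF pr G x ↔
    (∃ f, AttU pr G x f ∧ y = G x f) ∨ ((¬ ∃ f, AttU pr G x f) ∧ y = emp) := by
  have hex : ∃ y, (∃ f, AttU pr G x f ∧ y = G x f) ∨ ((¬ ∃ f, AttU pr G x f) ∧ y = emp) := by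
    by_cases h : ∃ f, AttU pr G x f
    · obtain ⟨f, hf⟩ := h; exact ⟨_, .inl ⟨f, hf, rfl⟩⟩
    · exact ⟨emp, .inr ⟨h, rfl⟩⟩
  have := Classical.epsilon_spec hex
  constructor
  · rintro rfl; exact this
  · change _ ∨ _ at this
    have e : recF pr G x = Classical.epsilon (fun y => (∃ f, AttU pr G x f ∧ y = G x f) ∨ ((¬ ∃ f, AttU pr G x f) ∧ y = emp)) := rfl
    rw [← e] at this
    rintro (⟨f, hf, rfl⟩ | ⟨h, rfl⟩)
    · rcases this with ⟨f', hf', h⟩ | ⟨h, -⟩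
      · rw [h, hf.2 f' hf'.1]
      · exact (h ⟨f, hf⟩).elim
    · rcases this with ⟨f', hf', h'⟩ | ⟨h', h''⟩
      · exact (h ⟨_, hf'⟩).elim
      · exact h''.symm

instance iT_recF {pr : (ℕ → M) → M → M} {G : (ℕ → M) → M → M → M} {t : (ℕ → M) → M}
    [h1 : DfT C (fun w => pr (fun i => w (i+1)) (w 0))]
    [h2 : DfT C (fun w => G (fun i => w (i+1+1)) (w 1) (w 0))] [ht : DfT C t] :
    DfT C (fun v => recF (pr v) (G v) (t v)) := by
  have hp : ∀ (n : ℕ) (s : (ℕ → M) → M) [DfT C s], DfT C (fun w => pr (fun i => w (i+n)) (s w)) := by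
    intro n s hs
    exact h1.subst (fun | 0 => s | i + 1 => fun w => w (i+n)) (fun | 0 => hs | i + 1 => DfT.var _)
  have hG : ∀ (n : ℕ) (s u : (ℕ → M) → M) [DfT C s] [DfT C u],
      DfT C (fun w => G (fun i => w (i+n)) (s w) (u w)) := by
    intro n s u hs hu
    exact h2.subst (fun | 0 => u | 1 => s | i + 2 => fun w => w (i+n))
      (fun | 0 => hu | 1 => hs | i + 2 => DfT.var _)
  have ht' : ∀ n : ℕ, DfT C (fun w => t (fun i => w (i+n))) := fun n => ht.shift _
  have hA : ∀ (n : ℕ) (s u : (ℕ → M) → M) [DfT C s] [DfT C u],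
      Df C (fun w => Att (pr (fun i => w (i+n))) (G (fun i => w (i+n))) (s w) (u w)) := by
    intro n s u hs hu
    have hA0 : Df C (fun w => Att (pr (fun i => w (i+2))) (G (fun i => w (i+2))) (w 0) (w 1)) := by
      unfold Att
      have a1 := hp 2 (fun w => w 0)
      have a2 := hp 3 (fun w => w 0)
      have a3 : DfT C (fun w => gr (pr (fun i => w (i + 3)) (w 0)) fun z => app (w 2) z) := inferInstance
      have a4 := hG 3 (fun w => w 0) (fun w => gr (pr (fun i => w (i + 3)) (w 0)) fun z => app (w 2) z)
      infer_instance
    exact hA0.subst (fun | 0 => s | 1 => u | i + 2 => fun w => w (i+n))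
      (fun | 0 => hs | 1 => hu | i + 2 => DfT.var _)
  have hU : Df C (fun w => AttU (pr (fun i => w (i+2))) (G (fun i => w (i+2))) (t (fun i => w (i+2))) (w 0)) := by
    unfold AttU
    have b0 := ht' 2
    have b1 := hA 2 (fun w => t (fun i => w (i+2))) (fun w => w 0)
    have b3 := ht' 3
    have b2 := hA 3 (fun w => t (fun i => w (i+3))) (fun w => w 0)
    infer_instance
  have b0 := ht' 2
  have c1 := hG 2 (fun w => t (fun i => w (i+2))) (fun w => w 0)
  exact DfT.of (fun v y => (∃ f, AttU (pr v) (G v) (t v) f ∧ y = G v (t v) f) ∨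
    ((¬ ∃ f, AttU (pr v) (G v) (t v) f) ∧ y = emp)) (fun v y => eq_recF _ _ _ _) inferInstance

structure WFR (D : M → Prop) (pr : M → M) : Prop where
  dom : ∀ x, D x → ∀ y, y ∊ pr x → D y
  tr : ∀ x, D x → ∀ y, y ∊ pr x → ∀ z, z ∊ pr y → z ∊ pr x
  ind : ∀ P : M → Prop, Df Any (fun v => P (v 0)) → (∀ x, D x → (∀ y, y ∊ pr x → P y) → P x) →
    ∀ x, D x → P x

theorem gr_congr {a : M} {f g : M → M} [DfT Any (fun v => f (v 0))] [DfT Any (fun v => g (v 0))]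
    (h : ∀ x, x ∊ a → f x = g x) : gr a f = gr a g := by
  refine sext fun z => ?_
  rw [gr, gr, mem_img, mem_img]
  exact exists_congr fun x => and_congr_right fun hx => by rw [h x hx]

section
variable {D : M → Prop} {pr : M → M} {G : M → M → M} [hpr : DfT Any (fun v => pr (v 0))]
  [hG : DfT Any (fun v => G (v 1) (v 0))]

theorem pr_inst : ∀ s : (ℕ → M) → M, [DfT Any s] → DfT Any (fun v => pr (s v)) :=
  fun s hs => hpr.sub1 hs
theorem G_inst : ∀ s u : (ℕ → M) → M, [DfT Any s] → [DfT Any u] → DfT Any (fun v => G (s v) (u v)) :=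
  fun s u hs hu => DfT.sub2 (f := fun a b => G b a) hG hu hs

theorem att_unique (hw : WFR D pr) {x x' f f' : M} (hx : D x) (hx' : D x') (h : Att pr G x f)
    (h' : Att pr G x' f') : ∀ y, D y → y ∊ pr x → y ∊ pr x' → app f y = app f' y := by
  have i1 := pr_inst (pr := pr)
  have i2 := G_inst (G := G)
  refine hw.ind (fun y => y ∊ pr x → y ∊ pr x' → app f y = app f' y) inferInstance ?_
  intro y hy ih h1 h2
  have e1 : app f y = G y (gr (pr y) (fun z => app f z)) := by
    conv_lhs => rw [h]
    exact app_gr (f := fun y => G y (gr (pr y) (fun z => app f z))) h1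
  have e2 : app f' y = G y (gr (pr y) (fun z => app f' z)) := by
    conv_lhs => rw [h']
    exact app_gr (f := fun y => G y (gr (pr y) (fun z => app f' z))) h2
  rw [e1, e2]
  congr 1
  exact gr_congr fun z hz => ih z hz (hw.tr x hx y h1 z hz) (hw.tr x' hx' y h2 z hz)

theorem att_ex (hw : WFR D pr) : ∀ x, D x → ∃ f, AttU pr G x f := by
  have i1 := pr_inst (pr := pr)
  have i2 := G_inst (G := G)
  have u : ∀ x f f', D x → Att pr G x f → Att pr G x f' → f' = f := by
    intro x f f' hx h h'
    have := att_unique hw hx hx h h'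
    rw [h, h']
    refine gr_congr fun y hy => ?_
    congr 1
    exact gr_congr fun z hz =>
      (this z (hw.dom _ (hw.dom _ hx y hy) z hz) (hw.tr _ hx _ hy _ hz) (hw.tr _ hx _ hy _ hz)).symm
  have hA : Df Any (fun w : ℕ → M => Att pr G (w 0) (w 1)) := by unfold Att; infer_instance
  have hA' : ∀ s t : (ℕ → M) → M, [DfT Any s] → [DfT Any t] → Df Any (fun w => Att pr G (s w) (t w)) :=
    fun s t hs ht => hA.sub2 hs ht
  suffices ∀ x, D x → ∃ f, Att pr G x f from fun x hx => by
    obtain ⟨f, hf⟩ := this x hx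
    exact ⟨f, hf, fun f' h' => u x f f' hx hf h'⟩
  refine hw.ind _ inferInstance ?_
  intro x hx ih
  have i3 : ∀ s : (ℕ → M) → M, [DfT Any s] → DfT Any (fun v => recF pr G (s v)) := fun s _ => inferInstance
  have hrec : ∀ y f, D y → Att pr G y f → recF pr G y = G y f := fun y f hy hf =>
    ((eq_recF pr G y _).2 (.inl ⟨f, ⟨hf, fun f' h' => u y f f' hy hf h'⟩, rfl⟩)).symm
  refine ⟨gr (pr x) (fun y => recF pr G y), ?_⟩
  unfold Att
  refine gr_congr fun y hy => ?_
  have dy := hw.dom x hx y hy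
  obtain ⟨f, hf⟩ := ih y hy
  rw [hrec y f dy hf]
  congr 1
  conv_lhs => rw [hf]
  refine gr_congr fun z hz => ?_
  have hzx := hw.tr x hx y hy z hz
  rw [app_gr (f := fun y => recF pr G y) hzx]
  have dz := hw.dom _ dy _ hz
  rw [hrec z (gr (pr z) (fun u => app f u)) dz]
  unfold Att
  refine gr_congr fun u hu => ?_
  have huy := hw.tr y dy z hz u hu
  conv_lhs => rw [hf]
  rw [app_gr (f := fun y => G y (gr (pr y) (fun z => app f z))) huy]
  congr 1
  refine gr_congr fun t ht => ?_
  rw [app_gr]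
  exact hw.tr z dz u hu t ht

theorem recF_eq (hw : WFR D pr) {x : M} (hx : D x) :
    recF pr G x = G x (gr (pr x) (fun y => recF pr G y)) := by
  have i1 := pr_inst (pr := pr)
  have i2 := G_inst (G := G)
  have i3 : ∀ s : (ℕ → M) → M, [DfT Any s] → DfT Any (fun v => recF pr G (s v)) := fun s _ => inferInstance
  obtain ⟨f, hf⟩ := att_ex (G := G) hw x hx
  rw [(eq_recF pr G x _).2 (.inl ⟨f, hf, rfl⟩) |>.symm]
  congr 1
  conv_lhs => rw [hf.1]
  refine gr_congr fun y hy => ?_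
  have dy := hw.dom x hx y hy
  obtain ⟨f', hf'⟩ := att_ex (G := G) hw y dy
  rw [(eq_recF pr G y _).2 (.inl ⟨f', hf', rfl⟩) |>.symm]
  congr 1
  conv_rhs => rw [hf'.1]
  refine gr_congr fun z hz => ?_
  have hzx := hw.tr x hx y hy z hz
  conv_lhs => rw [hf.1]
  rw [app_gr (f := fun y => G y (gr (pr y) (fun z => app f z))) hzx]
  congr 1
  refine gr_congr fun u hu => ?_
  have dz := hw.dom _ dy _ hz
  exact att_unique hw hx dy hf.1 hf'.1 u (hw.dom _ dz _ hu) (hw.tr _ hx _ hzx _ hu) (hw.tr _ dy _ hz _ hu)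
end

theorem wfr_ord : WFR (M := M) Od (fun x => x) where
  dom := fun x hx y hy => hx.mem hy
  tr := fun x hx y hy z hz => hx.tr hy hz
  ind := fun P hP h x hx => ord_ind P h x hx

/-- Recursion on ordinals -/
noncomputable def orec (G : M → M → M) (x : M) : M := recF (fun x => x) G x

instance iT_orec {G : (ℕ → M) → M → M → M} {t : (ℕ → M) → M}
    [h2 : DfT C (fun w => G (fun i => w (i+1+1)) (w 1) (w 0))] [ht : DfT C t] :
    DfT C (fun v => orec (G v) (t v)) := by unfold orec; infer_instance

theorem orec_eq {G : M → M → M} [hG : DfT Any (fun v => G (v 1) (v 0))] {x : M} (hx : Od x) :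
    orec G x = G x (gr x (fun y => orec G y)) := recF_eq wfr_ord hx

/-! The cumulative hierarchy -/
noncomputable def V (a : M) : M := orec (fun a g => un (img a (fun b => pow (app g b)))) a

instance iT_V {t : (ℕ → M) → M} [ht : DfT C t] : DfT C (fun v => V (t v)) := by
  unfold V; infer_instance

theorem mem_V {a : M} (ha : Od a) (z : M) : z ∊ V a ↔ ∃ b, b ∊ a ∧ z ⊑ V b := by
  have h : V a = un (img a (fun b => pow (app (gr a (fun y => V y)) b))) := orec_eq ha
  rw [h]
  simp only [mem_un, mem_img]
  constructor
  · rintro ⟨y, ⟨b, hb, rfl⟩, hz⟩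
    rw [app_gr hb, mem_pow] at hz
    exact ⟨b, hb, hz⟩
  · rintro ⟨b, hb, hz⟩
    exact ⟨_, ⟨b, hb, rfl⟩, by rw [app_gr hb, mem_pow]; exact hz⟩

theorem V_mono {a b : M} (ha : Od a) (hb : Od b) (h : a ⊑ b) : V a ⊑ V b := fun z hz => by
  rw [mem_V ha] at hz; rw [mem_V hb]
  obtain ⟨c, hc, hz⟩ := hz; exact ⟨c, h c hc, hz⟩

theorem V_trans {a : M} (ha : Od a) {x y : M} (h : x ∊ V a) (hy : y ∊ x) : y ∊ V a := by
  obtain ⟨b, hb, hx⟩ := (mem_V ha _).1 h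
  exact V_mono (ha.mem hb) ha (ha.sub hb) y (hx y hy)

theorem V_sub {a : M} (ha : Od a) {x y : M} (h : x ∊ V a) (hy : y ⊑ x) : y ∊ V a := by
  obtain ⟨b, hb, hx⟩ := (mem_V ha _).1 h
  exact (mem_V ha _).2 ⟨b, hb, sub_trans hy hx⟩

theorem mem_V_succ {a : M} (ha : Od a) (z : M) : z ∊ V (succ a) ↔ z ⊑ V a := by
  rw [mem_V ha.succ]
  constructor
  · rintro ⟨b, hb, hz⟩
    have ob := ha.succ.mem hb
    exact sub_trans hz (V_mono ob ha ((ord_lt_succ ob ha).1 hb))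
  · intro h; exact ⟨a, by simp, h⟩

theorem mem_V_lim {a : M} (ha : Lim a) (z : M) : z ∊ V a ↔ ∃ b, b ∊ a ∧ z ∊ V b := by
  constructor
  · intro h
    obtain ⟨b, hb, hz⟩ := (mem_V ha.1 _).1 h
    exact ⟨succ b, lim_succ ha hb, (mem_V_succ (ha.1.mem hb) _).2 hz⟩
  · rintro ⟨b, hb, hz⟩
    exact V_mono (ha.1.mem hb) ha.1 (ha.1.sub hb) z hz

theorem ord_sub_V : ∀ a : M, Od a → a ⊑ V a :=
  ord_ind _ fun a ha ih z hz => (mem_V ha _).2 ⟨z, hz, ih z hz⟩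

theorem V_mem_V {a b : M} (hb : Od b) (h : a ∊ b) : V a ∊ V b := (mem_V hb _).2 ⟨a, h, sub_refl _⟩

theorem ord_mem_V : ∀ a : M, Od a → ∀ z, Od z → z ∊ V a → z ∊ a := by
  refine ord_ind (fun a => ∀ z, Od z → z ∊ V a → z ∊ a) fun a ha ih z oz hz => ?_
  obtain ⟨b, hb, hz⟩ := (mem_V ha _).1 hz
  have : z ⊑ b := fun u hu => ih b hb u (oz.mem hu) (hz u hu)
  exact ord_lt_of_le_lt oz ha this hb

/-- replacement sup: bound for a definable function into ordinals -/
theorem ord_bound (a : M) (f : M → M) [DfT Any (fun v => f (v 0))] (h : ∀ x, x ∊ a → Od (f x)) :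
    ∃ d, Od d ∧ ∀ x, x ∊ a → f x ∊ d := by
  have ho : Od (un (img a f)) := ord_un fun x hx => by
    rw [mem_img] at hx; obtain ⟨y, hy, rfl⟩ := hx; exact h y hy
  refine ⟨succ (un (img a f)), ho.succ, fun x hx => ?_⟩
  rw [ord_lt_succ (h x hx) ho]
  exact le_un ((mem_img _ _ _).2 ⟨x, hx, rfl⟩)

theorem exists_trans (x : M) : ∃ t, TransE Mdl.E t ∧ x ⊑ t := by
  let F : M → M := orec (fun n g => cup x (un (un (img n (fun m => app g m)))))
  have hF : ∀ s : (ℕ → M) → M, [DfT Any s] → DfT Any (fun v => F (s v)) := fun s _ => by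
    change DfT Any (fun v => orec (fun n g => cup x (un (un (img n (fun m => app g m))))) (s v))
    infer_instance
  have e : ∀ n, Od n → ∀ z, z ∊ F n ↔ z ∊ x ∨ ∃ m, m ∊ n ∧ ∃ y, y ∊ F m ∧ z ∊ y := by
    intro n hn z
    have h : F n = cup x (un (un (img n (fun m => app (gr n (fun y => F y)) m)))) := orec_eq hn
    rw [h]; simp only [mem_cup, mem_un, mem_img]
    refine or_congr_right ⟨?_, ?_⟩
    · rintro ⟨y, ⟨_, ⟨m, hm, rfl⟩, hy⟩, hz⟩
      rw [app_gr hm] at hy; exact ⟨m, hm, y, hy, hz⟩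
    · rintro ⟨m, hm, y, hy, hz⟩
      exact ⟨y, ⟨_, ⟨m, hm, rfl⟩, by rw [app_gr hm]; exact hy⟩, hz⟩
  refine ⟨un (img omega F), fun y hy z hz => ?_, fun z hz => ?_⟩
  · simp only [mem_un, mem_img] at hy ⊢
    obtain ⟨_, ⟨n, hn, rfl⟩, hy⟩ := hy
    exact ⟨_, ⟨succ n, lim_succ omega_lim hn, rfl⟩,
      (e _ (omega_ord.mem hn).succ _).2 (.inr ⟨n, by simp, y, hy, hz⟩)⟩
  · simp only [mem_un, mem_img]
    exact ⟨_, ⟨emp, lim_emp omega_lim, rfl⟩, (e _ ord_emp _).2 (.inl hz)⟩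

theorem exists_V (x : M) : ∃ a, Od a ∧ x ∊ V a := by
  by_contra hx
  obtain ⟨t, ht, hxt⟩ := exists_trans x
  let B := sep (cup t (upair x x)) (fun z => ¬ ∃ a, Od a ∧ z ∊ V a)
  have hB : x ∊ B := (mem_sep _ _ _).2 ⟨by simp, hx⟩
  obtain ⟨m, hm, hmin⟩ := found hB
  obtain ⟨hmt, hm'⟩ := (mem_sep _ _ _).1 hm
  have hel : ∀ y, y ∊ m → ∃ a, Od a ∧ y ∊ V a := by
    intro y hy
    by_contra h
    refine hmin y ((mem_sep _ _ _).2 ⟨?_, h⟩) hy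
    simp at hmt ⊢
    rcases hmt with h' | rfl
    · exact .inl (ht _ h' _ hy)
    · exact .inl (hxt _ hy)
  obtain ⟨d, hd, hb⟩ := ord_bound m (fun y => lst (fun a => y ∊ V a)) (fun y hy => lst_ord _)
  refine hm' ⟨succ d, hd.succ, (mem_V_succ hd _).2 fun y hy => ?_⟩
  have := lst_spec (fun a => y ∊ V a) (hel y hy)
  exact V_mono this.1 hd (hd.sub (hb y hy)) y this.2.1

/-- Class foundation. -/
theorem class_found (P : M → Prop) [Df Any (fun v => P (v 0))] {x : M} (h : P x) :
    ∃ m, P m ∧ ∀ z, z ∊ m → ¬ P z := by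
  obtain ⟨a, ha, hx⟩ := exists_V x
  obtain ⟨m, hm, hmin⟩ := found ((mem_sep (V a) P x).2 ⟨hx, h⟩)
  rw [mem_sep] at hm
  exact ⟨m, hm.2, fun z hz hP => hmin z ((mem_sep _ _ _).2 ⟨V_trans ha hm.1 hz, hP⟩) hz⟩

/-- Collection. -/
theorem collection (a : M) (Q : M → M → Prop) [hQ : Df Any (fun v => Q (v 0) (v 1))] :
    ∃ d, Od d ∧ ∀ x, x ∊ a → (∃ y, Q x y) → ∃ y, y ∊ V d ∧ Q x y := by
  have hQ' : ∀ s t : (ℕ → M) → M, [DfT Any s] → [DfT Any t] → Df Any (fun w => Q (s w) (t w)) :=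
    fun s t hs ht => hQ.sub2 hs ht
  obtain ⟨d, hd, hb⟩ := ord_bound a (fun x => lst (fun b => ∃ y, y ∊ V b ∧ Q x y)) (fun x hx => lst_ord _)
  refine ⟨d, hd, fun x hx ⟨y, hy⟩ => ?_⟩
  obtain ⟨b, ob, hb'⟩ := exists_V y
  have := lst_spec (fun b => ∃ y, y ∊ V b ∧ Q x y) ⟨b, ob, y, hb', hy⟩
  obtain ⟨y', h1, h2⟩ := this.2.1
  exact ⟨y', V_mono this.1 hd (hd.sub (hb x hx)) y' h1, h2⟩

/-- choice function for nonempty subsets -/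
theorem choice_fn (X : M) : ∃ c, ∀ y, y ⊑ X → (∃ z, z ∊ y) → app c y ∊ y := by
  -- family of sets {y} × y
  let a := img (sep (pow X) (fun y => ∃ z, z ∊ y)) (fun y => img y (fun z => pair y z))
  have ha : ∀ x, x ∊ a ↔ ∃ y, (y ⊑ X ∧ ∃ z, z ∊ y) ∧ x = img y (fun z => pair y z) := by
    intro x; simp only [a, mem_img, mem_sep, mem_pow]
  obtain ⟨c, hc⟩ := (Mdl.ax (M := M)).2.2.2 a (by
    intro x hx
    obtain ⟨y, ⟨h1, z, hz⟩, rfl⟩ := (ha x).1 hx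
    exact ⟨pair y z, (mem_img _ _ _).2 ⟨z, hz, rfl⟩⟩) (by
    rintro x x' hx hx' hne ⟨z, hz, hz'⟩
    obtain ⟨y, -, rfl⟩ := (ha x).1 hx
    obtain ⟨y', -, rfl⟩ := (ha x').1 hx'
    obtain ⟨u, -, rfl⟩ := (mem_img _ _ _).1 hz
    obtain ⟨u', -, h⟩ := (mem_img _ _ _).1 hz'
    rw [pair_inj] at h
    exact hne (by rw [h.1]))
  refine ⟨sep c (fun p => ∃ y z, p = pair y z ∧ z ∊ y), fun y hy hne => ?_⟩
  obtain ⟨z, h1, h2, h3⟩ := hc _ ((ha _).2 ⟨y, ⟨hy, hne⟩, rfl⟩)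
  obtain ⟨u, hu, rfl⟩ := (mem_img _ _ _).1 h2
  rw [app_eq (y := u)]
  · exact hu
  · rw [mem_sep]; exact ⟨h1, y, u, rfl, hu⟩
  · intro y' h; rw [mem_sep] at h
    obtain ⟨h4, yy, zz, h5, h6⟩ := h
    obtain ⟨rfl, rfl⟩ := pair_inj.1 h5
    have := h3 _ h4 ((mem_img _ _ _).2 ⟨y', h6, rfl⟩)
    exact (pair_inj.1 this).2

/-- Every set is the image of an ordinal. -/
theorem wo (X : M) : ∃ l h : M, Od l ∧ ∀ x, x ∊ X → ∃ i, i ∊ l ∧ app h i = x := by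
  obtain ⟨c, hc⟩ := choice_fn X
  let F : M → M := orec (fun n g => app c (sep X (fun z => ¬ z ∊ img n (fun m => app g m))))
  have hF : ∀ s : (ℕ → M) → M, [DfT Any s] → DfT Any (fun v => F (s v)) := fun s _ => by
    change DfT Any (fun v => orec (fun n g => app c (sep X (fun z => ¬ z ∊ img n (fun m => app g m)))) (s v))
    infer_instance
  have e : ∀ n, Od n → F n = app c (sep X (fun z => ¬ z ∊ img n F)) := by
    intro n hn
    have h : F n = app c (sep X (fun z => ¬ z ∊ img n (fun m => app (gr n (fun y => F y)) m))) := orec_eq hn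
    rw [h]
    congr 1
    refine sext fun z => ?_
    simp only [mem_sep, mem_img]
    have : (∃ m, m ∊ n ∧ z = app (gr n (fun y => F y)) m) ↔ (∃ m, m ∊ n ∧ z = F m) :=
      exists_congr fun m => and_congr_right fun hm => by rw [app_gr hm]
    rw [this]
  by_cases hs : ∃ l, Od l ∧ ∀ x, x ∊ X → x ∊ img l F
  · obtain ⟨l, ol, hl⟩ := hs
    refine ⟨l, gr l F, ol, fun x hx => ?_⟩
    obtain ⟨i, hi, rfl⟩ := (mem_img _ _ _).1 (hl x hx)
    exact ⟨i, hi, app_gr hi⟩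
  · exfalso
    have key : ∀ n, Od n → F n ∊ X ∧ ¬ F n ∊ img n F := by
      intro n hn
      have : ∃ z, z ∊ sep X (fun z => ¬ z ∊ img n F) := by
        by_contra h; push Not at h
        refine hs ⟨n, hn, fun x hx => ?_⟩
        by_contra h'; exact h x ((mem_sep _ _ _).2 ⟨hx, h'⟩)
      have h2 := hc _ (fun z hz => ((mem_sep _ _ _).1 hz).1) this
      rw [← e n hn, mem_sep] at h2
      exact h2
    obtain ⟨d, hd, hb⟩ := ord_bound X (fun x => lst (fun i => F i = x)) (fun x _ => lst_ord _)
    have h1 := hb _ (key d hd).1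
    have h2 := lst_spec (fun i => F i = F d) ⟨d, hd, rfl⟩
    exact (key d hd).2 ((mem_img _ _ _).2 ⟨_, h1, h2.2.1.symm⟩)

theorem choice (a : M) (Q : M → M → Prop) [hQ : Df Any (fun v => Q (v 0) (v 1))]
    (h : ∀ x, x ∊ a → ∃ y, Q x y) : ∃ f, f = gr a (fun x => app f x) ∧ ∀ x, x ∊ a → Q x (app f x) := by
  have hQ' : ∀ s t : (ℕ → M) → M, [DfT Any s] → [DfT Any t] → Df Any (fun w => Q (s w) (t w)) :=
    fun s t hs ht => hQ.sub2 hs ht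
  obtain ⟨d, hd, hc⟩ := collection a Q
  obtain ⟨l, e, ol, he⟩ := wo (V d)
  let f := gr a (fun x => app e (lst (fun i => Q x (app e i))))
  have hf : ∀ x, x ∊ a → app f x = app e (lst (fun i => Q x (app e i))) := fun x hx => app_gr hx
  refine ⟨f, gr_congr fun x hx => (hf x hx).symm, fun x hx => ?_⟩
  rw [hf x hx]
  obtain ⟨y, hy, hQy⟩ := hc x hx (h x hx)
  obtain ⟨i, hi, rfl⟩ := he y hy
  exact (lst_spec (fun i => Q x (app e i)) ⟨i, ol.mem hi, hQy⟩).2.1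

theorem vHier_gr {a : M} (ha : Od a) : VHierE Mdl.E (gr a V) a := by
  refine ⟨ha, fun b hb => ⟨⟨V b, ?_, fun z => ?_⟩, ?_⟩⟩
  · rw [pairMemE_iff, mem_gr]; exact ⟨hb, rfl⟩
  · simp only [pairMemE_iff, mem_gr]
    rw [mem_V (ha.mem hb)]
    refine exists_congr fun c => and_congr_right fun hc => ⟨fun h => ⟨_, ⟨ha.tr hb hc, rfl⟩, h⟩, ?_⟩
    rintro ⟨u, ⟨-, rfl⟩, h⟩; exact h
  · simp only [pairMemE_iff, mem_gr]; rintro w w' ⟨-, rfl⟩ ⟨-, rfl⟩; rfl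

theorem vMemE_iff (x a : M) : VMemE Mdl.E x a ↔ Od a ∧ x ∊ V a := by
  constructor
  · rintro ⟨ha, f, hf, b, u, hb, hu, hx⟩
    refine ⟨ha, (mem_V ha _).2 ⟨b, hb, ?_⟩⟩
    have : ∀ b, Od b → b ∊ a → ∀ u, pair b u ∊ f → u = V b := by
      refine ord_ind (fun b => b ∊ a → ∀ u, pair b u ∊ f → u = V b) ?_
      intro b ob ih hb u hu
      obtain ⟨⟨w, hw, hw'⟩, huq⟩ := hf.2 b hb
      simp only [pairMemE_iff] at hw hw' huq
      have := huq u w hu hw; subst this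
      refine sext fun z => ?_
      rw [hw', mem_V ob]
      refine exists_congr fun c => and_congr_right fun hc => ?_
      have hca := ha.tr hb hc
      constructor
      · rintro ⟨u, hu, hz⟩; rwa [← ih c hc hca u hu]
      · intro hz
        obtain ⟨⟨w, hw, -⟩, -⟩ := hf.2 c hca
        rw [pairMemE_iff] at hw
        exact ⟨w, hw, by rwa [ih c hc hca w hw]⟩
    rw [pairMemE_iff] at hu
    rw [← this b (ha.mem hb) hb u hu]; exact hx
  · rintro ⟨ha, hx⟩
    obtain ⟨b, hb, hx⟩ := (mem_V ha _).1 hx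
    exact ⟨ha, _, vHier_gr ha, b, V b, hb, by rw [pairMemE_iff, mem_gr]; exact ⟨hb, rfl⟩, hx⟩

end S3
end Paper

set_option linter.all false
namespace Paper
section S4
variable {M : Type} [Mdl M] {C : M → Prop}

/-- closed points of a growth function -/
def Cl (g : M → M) (a : M) : Prop := Lim a ∧ ∀ c, c ∊ a → g c ∊ a

instance iP_Cl {g : (ℕ → M) → M → M} {t : (ℕ → M) → M}
    [hg : DfT C (fun w => g (fun i => w (i+1)) (w 0))] [ht : DfT C t] :
    Df C (fun v => Cl (g v) (t v)) := by
  have h1 : DfT C (fun w => t (fun i => w (i+1))) := ht.shift _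
  unfold Cl; infer_instance

theorem cl_unbounded (g : M → M) [hg : DfT Any (fun v => g (v 0))] (ho : ∀ c, Od c → Od (g c))
    {ξ : M} (hξ : Od ξ) : ∃ a, Cl g a ∧ ξ ∊ a := by
  have hg' : ∀ s : (ℕ → M) → M, [DfT Any s] → DfT Any (fun v => g (s v)) := fun s hs => hg.sub1 hs
  let h : M → M := fun b => succ (cup b (un (img (succ b) g)))
  have hh : ∀ s : (ℕ → M) → M, [DfT Any s] → DfT Any (fun v => h (s v)) := fun s hs => by
    change DfT Any (fun v => succ (cup (s v) (un (img (succ (s v)) g))))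
    infer_instance
  have oh0 : ∀ b, Od b → Od (cup b (un (img (succ b) g))) := fun b hb => by
    refine ord_un fun x hx => ?_
    simp at hx; rcases hx with rfl | rfl
    · exact hb
    · refine ord_un fun y hy => ?_
      rw [mem_img] at hy; obtain ⟨z, hz, rfl⟩ := hy
      exact ho _ (hb.succ.mem hz)
  have oh : ∀ b, Od b → Od (h b) := fun b hb => (oh0 b hb).succ
  have lh : ∀ b, Od b → b ∊ h b := fun b hb => (ord_lt_succ hb (oh0 b hb)).2 fun z hz => by simp [hz]
  have gh : ∀ b, Od b → ∀ c, c ∊ b → g c ∊ h b := fun b hb c hc =>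
    (ord_lt_succ (ho _ (hb.mem hc)) (oh0 b hb)).2 fun z hz => by
      simp only [mem_cup, mem_un, mem_img, mem_succ]; exact .inr ⟨_, ⟨c, .inl hc, rfl⟩, hz⟩
  let F : M → M := orec (fun n f => cup (succ ξ) (un (img n (fun m => h (app f m)))))
  have hF : ∀ s : (ℕ → M) → M, [DfT Any s] → DfT Any (fun v => F (s v)) := fun s _ => by
    change DfT Any (fun v => orec (fun n f => cup (succ ξ) (un (img n (fun m => h (app f m))))) (s v))
    infer_instance
  have e : ∀ n, Od n → F n = cup (succ ξ) (un (img n (fun m => h (F m)))) := by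
    intro n hn
    have h1 : F n = cup (succ ξ) (un (img n (fun m => h (app (gr n (fun y => F y)) m)))) := orec_eq hn
    rw [h1]
    congr 2
    refine sext fun z => ?_
    simp only [mem_img]
    exact exists_congr fun m => and_congr_right fun hm => by rw [app_gr hm]
  have oF : ∀ n, Od n → Od (F n) := ord_ind (fun n => Od (F n)) fun n hn ih => by
    rw [e n hn]
    refine ord_un fun x hx => ?_
    simp at hx; rcases hx with rfl | rfl
    · exact hξ.succ
    · refine ord_un fun y hy => ?_
      rw [mem_img] at hy; obtain ⟨z, hz, rfl⟩ := hy
      exact oh _ (ih z hz)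
  have sF : ∀ n, Od n → ∀ m, m ∊ n → h (F m) ⊑ F n := fun n hn m hm z hz => by
    rw [e n hn]; simp only [mem_cup, mem_un, mem_img]; exact .inr ⟨_, ⟨m, hm, rfl⟩, hz⟩
  let a := un (img omega F)
  have ma : ∀ z, z ∊ a ↔ ∃ n, n ∊ omega ∧ z ∊ F n := fun z => by
    simp only [a, mem_un, mem_img]
    constructor
    · rintro ⟨_, ⟨n, hn, rfl⟩, h⟩; exact ⟨n, hn, h⟩
    · rintro ⟨n, hn, h⟩; exact ⟨_, ⟨n, hn, rfl⟩, h⟩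
  have oa : Od a := ord_un fun y hy => by
    rw [mem_img] at hy; obtain ⟨z, hz, rfl⟩ := hy
    exact oF _ (omega_ord.mem hz)
  have st : ∀ n, n ∊ omega → h (F n) ⊑ a := fun n hn z hz =>
    (ma z).2 ⟨succ n, lim_succ omega_lim hn, sF _ (omega_ord.mem hn).succ n (by simp) z hz⟩
  have hξa : ξ ∊ a := (ma _).2 ⟨emp, lim_emp omega_lim, by rw [e _ ord_emp]; simp⟩
  refine ⟨a, ⟨⟨oa, ⟨ξ, hξa⟩, fun c hc => ?_⟩, fun c hc => ?_⟩, hξa⟩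
  · obtain ⟨n, hn, hc⟩ := (ma _).1 hc
    exact ⟨F n, st n hn _ (lh _ (oF _ (omega_ord.mem hn))), hc⟩
  · obtain ⟨n, hn, hc⟩ := (ma _).1 hc
    exact st n hn _ (gh _ (oF _ (omega_ord.mem hn)) c hc)

theorem cl_club (g : M → M) [hg : DfT Any (fun v => g (v 0))] (ho : ∀ c, Od c → Od (g c)) :
    ClubClassE Mdl.E (Cl g) := by
  refine ⟨fun x h => h.1.1, fun a ha => ?_, fun l hl hne h => ⟨⟨hl, hne, fun a ha => ?_⟩, fun c hc => ?_⟩⟩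
  · exact cl_unbounded g ho ha
  · obtain ⟨b, -, h1, h2⟩ := h a ha; exact ⟨b, h2, h1⟩
  · obtain ⟨b, hb, h1, h2⟩ := h c hc; exact hl.tr h2 (hb.2 c h1)

theorem cl_cup {g1 g2 : M → M} {a : M} (h1 : ∀ c, Od c → Od (g1 c)) (h2 : ∀ c, Od c → Od (g2 c))
    (h : Cl (fun c => cup (g1 c) (g2 c)) a) : Cl g1 a ∧ Cl g2 a := by
  refine ⟨⟨h.1, fun c hc => ?_⟩, ⟨h.1, fun c hc => ?_⟩⟩
  · exact ord_lt_of_le_lt (h1 c (h.1.1.mem hc)) h.1.1 (fun z hz => by simp [hz]) (h.2 c hc)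
  · exact ord_lt_of_le_lt (h2 c (h.1.1.mem hc)) h.1.1 (fun z hz => by simp [hz]) (h.2 c hc)

theorem ord_cup {a b : M} (ha : Od a) (hb : Od b) : Od (cup a b) := ord_un fun x hx => by
    simp at hx; rcases hx with rfl | rfl <;> assumption

/-! Coding of environments -/
noncomputable def sndn : ℕ → M → M
  | 0, e => e
  | i + 1, e => sndn i (snd e)

noncomputable def dec (e : M) (i : ℕ) : M := fst (sndn i e)

theorem dec_pair (a e : M) : dec (pair a e) = cs a (dec e) := by
  funext i; cases i with
  | zero => simp [dec, sndn, cs]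
  | succ i => simp [dec, sndn, cs]

instance iT_dec {t : (ℕ → M) → M} (i : ℕ) [ht : DfT C t] : DfT C (fun v => dec (t v) i) := by
  unfold dec
  induction i generalizing t with
  | zero => simp only [sndn]; infer_instance
  | succ i ih => simp only [sndn]; exact ih

theorem Df.ofSat (φ : Fm M) (h : φ.cn C) : Df C (fun v => sat φ v) := ⟨φ, h, fun _ => Iff.rfl⟩

theorem Df.satDec (φ : Fm M) (h : φ.cn C) {t : (ℕ → M) → M} (ht : DfT C t) :
    Df C (fun v => sat φ (dec (t v))) :=
  (Df.ofSat φ h).subst (fun i v => dec (t v) i) (fun i => inferInstance)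

theorem cn_any (φ : Fm M) : φ.cn Any := cn_mono (fun _ _ => trivial) φ (cn_cl φ)

theorem lim_upair {a x y : M} (ha : Lim a) (hx : x ∊ V a) (hy : y ∊ V a) : upair x y ∊ V a := by
  obtain ⟨b, hb, hx⟩ := (mem_V_lim ha _).1 hx
  obtain ⟨c, hc, hy⟩ := (mem_V_lim ha _).1 hy
  have ob := ha.1.mem hb
  have oc := ha.1.mem hc
  have : ∃ d, d ∊ a ∧ b ⊑ d ∧ c ⊑ d := by
    rcases ord_le_or_lt ob oc with h | h
    · exact ⟨c, hc, h, sub_refl _⟩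
    · exact ⟨b, hb, sub_refl _, ob.sub h⟩
  obtain ⟨d, hd, h1, h2⟩ := this
  have od := ha.1.mem hd
  refine (mem_V ha.1 _).2 ⟨d, hd, fun z hz => ?_⟩
  simp at hz; rcases hz with rfl | rfl
  · exact V_mono ob od h1 _ hx
  · exact V_mono oc od h2 _ hy

theorem lim_pair {a x y : M} (ha : Lim a) (hx : x ∊ V a) (hy : y ∊ V a) : pair x y ∊ V a :=
  lim_upair ha (lim_upair ha hx hx) (lim_upair ha hx hy)

theorem reflect (φ : Fm M) : ∃ g : M → M, DfT Any (fun v => g (v 0)) ∧ (∀ c, Od c → Od (g c)) ∧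
    ∀ a, Cl g a → ∀ e, e ∊ V a → (satR (fun x => x ∊ V a) φ (dec e) ↔ sat φ (dec e)) := by
  induction φ with
  | mem s t => exact ⟨fun c => c, inferInstance, fun c h => h, fun a _ e _ => Iff.rfl⟩
  | eq s t => exact ⟨fun c => c, inferInstance, fun c h => h, fun a _ e _ => Iff.rfl⟩
  | fal => exact ⟨fun c => c, inferInstance, fun c h => h, fun a _ e _ => Iff.rfl⟩
  | imp φ ψ h1 h2 =>
    obtain ⟨g1, d1, o1, h1⟩ := h1
    obtain ⟨g2, d2, o2, h2⟩ := h2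
    refine ⟨fun c => cup (g1 c) (g2 c), inferInstance, fun c hc => ord_cup (o1 c hc) (o2 c hc), ?_⟩
    intro a ha e he
    obtain ⟨c1, c2⟩ := cl_cup o1 o2 ha
    simp only [sat, satR] at h1 h2 ⊢
    rw [h1 a c1 e he, h2 a c2 e he]
  | all φ ih =>
    obtain ⟨g1, d1, o1, h1⟩ := ih
    have hs : ∀ t : (ℕ → M) → M, [DfT Any t] → Df Any (fun v => sat φ (dec (t v))) :=
      fun t ht => Df.satDec φ (cn_any φ) ht
    let g2 : M → M := fun c => lst (fun d => ∀ e, e ∊ V c → (∃ x, ¬ sat φ (dec (pair x e))) →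
      ∃ x, x ∊ V d ∧ ¬ sat φ (dec (pair x e)))
    have d2 : DfT Any (fun v => g2 (v 0)) := by
      change DfT Any (fun v => lst (fun d => ∀ e, e ∊ V (v 0) → (∃ x, ¬ sat φ (dec (pair x e))) →
      ∃ x, x ∊ V d ∧ ¬ sat φ (dec (pair x e))))
      infer_instance
    have o2 : ∀ c, Od c → Od (g2 c) := fun c _ => lst_ord _
    refine ⟨fun c => cup (g1 c) (g2 c), inferInstance, fun c hc => ord_cup (o1 c hc) (o2 c hc), ?_⟩
    intro a ha e he
    obtain ⟨c1, c2⟩ := cl_cup o1 o2 ha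
    simp only [sat, satR]
    constructor
    · intro h x _
      by_contra hx
      obtain ⟨c, hc, hec⟩ := (mem_V_lim ha.1 _).1 he
      have := collection (V c) (fun e x => ¬ sat φ (dec (pair x e)))
      have hl := lst_spec (fun d => ∀ e, e ∊ V c → (∃ x, ¬ sat φ (dec (pair x e))) →
      ∃ x, x ∊ V d ∧ ¬ sat φ (dec (pair x e))) this
      obtain ⟨x', hx', hn⟩ := hl.2.1 e hec ⟨x, by rw [dec_pair]; exact hx⟩
      have hxa : x' ∊ V a := V_mono hl.1 ha.1.1 (ha.1.1.sub (c2.2 c hc)) _ hx'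
      have := h x' hxa
      rw [← dec_pair, h1 a c1 _ (lim_pair ha.1 hxa he)] at this
      exact hn this
    · intro h x hx
      rw [← dec_pair, h1 a c1 _ (lim_pair ha.1 hx he), dec_pair]
      exact h x trivial

/-- translation of formulas -/
def toFm : ∀ {n : ℕ}, SetFormula n → (Fin n → ℕ) → Fm M
  | _, .mem i j, r => .mem (.inl (r i)) (.inl (r j))
  | _, .eq i j, r => .eq (.inl (r i)) (.inl (r j))
  | _, .fal, _ => .fal
  | _, .imp φ ψ, r => .imp (toFm φ r) (toFm ψ r)
  | _, .all φ, r => .all (toFm φ (Fin.snoc (fun i => r i + 1) 0))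

theorem satR_toFm (S : M → Prop) {n : ℕ} (φ : SetFormula n) : ∀ (r : Fin n → ℕ) (v : ℕ → M),
    satR S (toFm φ r) v ↔ RelR S φ (fun i => v (r i)) := by
  induction φ with
  | mem i j => intro r v; rfl
  | eq i j => intro r v; rfl
  | fal => intro r v; rfl
  | imp φ ψ h1 h2 => intro r v; simp only [toFm, satR, RelR, h1, h2]
  | all φ ih =>
    intro r v
    simp only [toFm, satR, RelR, ih]
    refine forall_congr' fun a => forall_congr' fun h => ?_
    rw [snoc_comp (fun i => cs a v i)]
    rfl

theorem lim_emp_V {a : M} (ha : Lim a) : (emp : M) ∊ V a :=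
  (mem_V ha.1 _).2 ⟨emp, lim_emp ha, fun z hz => (mem_emp _ hz).elim⟩

theorem reflect0 (φ : SetFormula 0) : ∃ g : M → M, DfT Any (fun v => g (v 0)) ∧ (∀ c, Od c → Od (g c)) ∧
    ∀ a, Cl g a → (RelR (fun x => x ∊ V a) φ ![] ↔ Realize (M := M) Mdl.E φ ![]) := by
  obtain ⟨g, h1, h2, h3⟩ := reflect (toFm (M := M) φ ![])
  refine ⟨g, h1, h2, fun a ha => ?_⟩
  have := h3 a ha emp (lim_emp_V ha.1)
  rw [satR_toFm, sat, satR_toFm, ← realize_any] at this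
  convert this
end S4
end Paper

set_option linter.all false
namespace Paper
section S5
variable {M : Type} [Mdl M] {C : M → Prop}

/-! ### Ordinal pairing -/
noncomputable def prod (a b : M) : M := un (img a (fun x => img b (fun y => pair x y)))

theorem mem_prod (a b x y : M) : pair x y ∊ prod a b ↔ x ∊ a ∧ y ∊ b := by
  simp only [prod, mem_un, mem_img]
  constructor
  · rintro ⟨_, ⟨x', hx, rfl⟩, h⟩
    obtain ⟨y', hy, h⟩ := (mem_img _ _ _).1 h
    obtain ⟨rfl, rfl⟩ := pair_inj.1 h; exact ⟨hx, hy⟩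
  · rintro ⟨hx, hy⟩; exact ⟨_, ⟨x, hx, rfl⟩, (mem_img _ _ _).2 ⟨y, hy, rfl⟩⟩

theorem mem_prod' (a b z : M) : z ∊ prod a b ↔ ∃ x y, x ∊ a ∧ y ∊ b ∧ z = pair x y := by
  constructor
  · intro h
    simp only [prod, mem_un, mem_img] at h
    obtain ⟨_, ⟨x', hx, rfl⟩, h⟩ := h
    obtain ⟨y', hy, h⟩ := (mem_img _ _ _).1 h
    exact ⟨x', y', hx, hy, h⟩
  · rintro ⟨x, y, hx, hy, rfl⟩; exact (mem_prod _ _ _ _).2 ⟨hx, hy⟩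

instance iT_prod {t s : (ℕ → M) → M} [ht : DfT C t] [hs : DfT C s] :
    DfT C (fun v => prod (t v) (s v)) := by
  refine DfT.sub2 (f := prod) ?_ ht hs
  unfold prod; infer_instance

def PL (c d a b : M) : Prop := cup c d ∊ cup a b ∨ (cup c d = cup a b ∧ (c ∊ a ∨ (c = a ∧ d ∊ b)))

instance iP_PL {t s u w : (ℕ → M) → M} [ht : DfT C t] [hs : DfT C s] [hu : DfT C u] [hw : DfT C w] :
    Df C (fun v => PL (t v) (s v) (u v) (w v)) := by unfold PL; infer_instance

noncomputable def ppr (x : M) : M :=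
  sep (prod (succ (cup (fst x) (snd x))) (succ (cup (fst x) (snd x))))
    (fun y => PL (fst y) (snd y) (fst x) (snd x))

instance iT_ppr {t : (ℕ → M) → M} [ht : DfT C t] : DfT C (fun v => ppr (t v)) := by
  refine DfT.sub1 (f := ppr) ?_ ht
  unfold ppr; infer_instance

theorem cup_le {a b c : M} (h1 : a ⊑ c) (h2 : b ⊑ c) : cup a b ⊑ c := fun z hz => by
  simp at hz; exact hz.elim (h1 z) (h2 z)
theorem le_cup_l (a b : M) : a ⊑ cup a b := fun z hz => by simp [hz]
theorem le_cup_r (a b : M) : b ⊑ cup a b := fun z hz => by simp [hz]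

theorem PL_tr {a b c d e f : M} (oa : Od a) (ob : Od b) (oc : Od c) (od : Od d) (oe : Od e) (of : Od f)
    (h : PL a b c d) (h' : PL c d e f) : PL a b e f := by
  have o3 := ord_cup oe of
  rcases h with h | ⟨h, h2⟩ <;> rcases h' with h' | ⟨h', h2'⟩
  · exact .inl (o3.tr h' h)
  · exact .inl (h' ▸ h)
  · exact .inl (h ▸ h')
  · refine .inr ⟨h.trans h', ?_⟩
    rcases h2 with h2 | ⟨rfl, h2⟩ <;> rcases h2' with h2' | ⟨rfl, h2'⟩
    · exact .inl (oe.tr h2' h2)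
    · exact .inl h2
    · exact .inl h2'
    · exact .inr ⟨rfl, of.tr h2' h2⟩

theorem PL_tri {a b c d : M} (oa : Od a) (ob : Od b) (oc : Od c) (od : Od d) :
    PL a b c d ∨ (a = c ∧ b = d) ∨ PL c d a b := by
  rcases ord_tri (ord_cup oa ob) (ord_cup oc od) with h | h | h
  · exact .inl (.inl h)
  · rcases ord_tri oa oc with h1 | h1 | h1
    · exact .inl (.inr ⟨h, .inl h1⟩)
    · rcases ord_tri ob od with h2 | h2 | h2
      · exact .inl (.inr ⟨h, .inr ⟨h1, h2⟩⟩)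
      · exact .inr (.inl ⟨h1, h2⟩)
      · exact .inr (.inr (.inr ⟨h.symm, .inr ⟨h1.symm, h2⟩⟩))
    · exact .inr (.inr (.inr ⟨h.symm, .inl h1⟩))
  · exact .inr (.inr (.inl h))

theorem mem_ppr {a b : M} (oa : Od a) (ob : Od b) (y : M) :
    y ∊ ppr (pair a b) ↔ ∃ c d, Od c ∧ Od d ∧ y = pair c d ∧ PL c d a b := by
  have om := ord_cup oa ob
  rw [ppr, mem_sep, mem_prod']
  simp only [fst_pair, snd_pair]
  constructor
  · rintro ⟨⟨c, d, hc, hd, rfl⟩, h⟩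
    simp only [fst_pair, snd_pair] at h
    exact ⟨c, d, om.succ.mem hc, om.succ.mem hd, rfl, h⟩
  · rintro ⟨c, d, oc, od, rfl, h⟩
    simp only [fst_pair, snd_pair]
    have hm : cup c d ⊑ cup a b := by
      rcases h with h | h
      · exact om.sub h
      · rw [h.1]; exact sub_refl _
    exact ⟨⟨c, d, (ord_lt_succ oc om).2 (sub_trans (le_cup_l _ _) hm),
      (ord_lt_succ od om).2 (sub_trans (le_cup_r _ _) hm), rfl⟩, h⟩

def OPr (x : M) : Prop := ∃ a b, Od a ∧ Od b ∧ x = pair a b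

theorem wfr_pair : WFR (M := M) OPr ppr where
  dom := by
    rintro x ⟨a, b, oa, ob, rfl⟩ y hy
    obtain ⟨c, d, oc, od, rfl, -⟩ := (mem_ppr oa ob y).1 hy
    exact ⟨c, d, oc, od, rfl⟩
  tr := by
    rintro x ⟨a, b, oa, ob, rfl⟩ y hy z hz
    obtain ⟨c, d, oc, od, rfl, h⟩ := (mem_ppr oa ob y).1 hy
    obtain ⟨e, f, oe, of, rfl, h'⟩ := (mem_ppr oc od z).1 hz
    exact (mem_ppr oa ob _).2 ⟨e, f, oe, of, rfl, PL_tr oe of oc od oa ob h' h⟩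
  ind := by
    intro P hP h
    have hP' : ∀ s : (ℕ → M) → M, [DfT Any s] → Df Any (fun w => P (s w)) := fun s hs => hP.sub1 hs
    have key : ∀ m, Od m → ∀ a, Od a → ∀ b, Od b → cup a b = m → P (pair a b) := by
      refine ord_ind (fun m => ∀ a, Od a → ∀ b, Od b → cup a b = m → P (pair a b)) ?_
      intro m om ihm
      refine ord_ind (fun a => ∀ b, Od b → cup a b = m → P (pair a b)) ?_
      intro a oa iha
      refine ord_ind (fun b => cup a b = m → P (pair a b)) ?_
      intro b ob ihb e
      refine h _ ⟨a, b, oa, ob, rfl⟩ fun y hy => ?_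
      obtain ⟨c, d, oc, od, rfl, h⟩ := (mem_ppr oa ob y).1 hy
      rcases h with h | ⟨h, h' | ⟨rfl, h'⟩⟩
      · exact ihm _ (e ▸ h) c oc d od rfl
      · exact iha c h' d od (h.trans e)
      · exact ihb d h' (h.trans e)
    rintro x ⟨a, b, oa, ob, rfl⟩
    exact key _ (ord_cup oa ob) a oa b ob rfl

noncomputable def pF (x : M) : M := recF ppr (fun x f => img (ppr x) (fun y => app f y)) x

instance iT_pF {t : (ℕ → M) → M} [ht : DfT C t] : DfT C (fun v => pF (t v)) := by
  unfold pF; infer_instance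

theorem pF_eq {x : M} (hx : OPr x) : pF x = img (ppr x) pF := by
  have h : pF x = img (ppr x) (fun y => app (gr (ppr x) (fun y => pF y)) y) := recF_eq wfr_pair hx
  rw [h]
  refine sext fun z => ?_
  simp only [mem_img]
  exact exists_congr fun m => and_congr_right fun hm => by rw [app_gr hm]

noncomputable def pr (a b : M) : M := pF (pair a b)
instance iT_pr {t s : (ℕ → M) → M} [ht : DfT C t] [hs : DfT C s] :
    DfT C (fun v => pr (t v) (s v)) := by unfold pr; infer_instance

theorem mem_pr {a b : M} (oa : Od a) (ob : Od b) (z : M) :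
    z ∊ pr a b ↔ ∃ c d, Od c ∧ Od d ∧ PL c d a b ∧ z = pr c d := by
  rw [pr, pF_eq ⟨a, b, oa, ob, rfl⟩, mem_img]
  constructor
  · rintro ⟨y, hy, rfl⟩
    obtain ⟨c, d, oc, od, rfl, h⟩ := (mem_ppr oa ob y).1 hy
    exact ⟨c, d, oc, od, h, rfl⟩
  · rintro ⟨c, d, oc, od, h, rfl⟩
    exact ⟨_, (mem_ppr oa ob _).2 ⟨c, d, oc, od, rfl, h⟩, rfl⟩

theorem pr_ord {a b : M} (oa : Od a) (ob : Od b) : Od (pr a b) := by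
  have : ∀ x : M, OPr x → Od (pF x) := by
    refine wfr_pair.ind (fun x => Od (pF x)) inferInstance ?_
    rintro x hx ih
    rw [pF_eq hx]
    refine ord_of_trans (fun z hz => ?_) (fun y hy z hz => ?_)
    · rw [mem_img] at hz; obtain ⟨y, hy, rfl⟩ := hz; exact ih y hy
    · rw [mem_img] at hy ⊢; obtain ⟨y, hy, rfl⟩ := hy
      rw [pF_eq (wfr_pair.dom _ hx _ hy), mem_img] at hz
      obtain ⟨z, hz, rfl⟩ := hz
      exact ⟨z, wfr_pair.tr _ hx _ hy _ hz, rfl⟩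
  exact this _ ⟨a, b, oa, ob, rfl⟩

theorem pr_lt {a b c d : M} (oa : Od a) (ob : Od b) (oc : Od c) (od : Od d) (h : PL a b c d) :
    pr a b ∊ pr c d := (mem_pr oc od _).2 ⟨a, b, oa, ob, h, rfl⟩

theorem pr_inj {a b c d : M} (oa : Od a) (ob : Od b) (oc : Od c) (od : Od d) (h : pr a b = pr c d) :
    a = c ∧ b = d := by
  rcases PL_tri oa ob oc od with h' | h' | h'
  · have := pr_lt oa ob oc od h'; rw [h] at this; exact (mem_irrefl _ this).elim
  · exact h'
  · have := pr_lt oc od oa ob h'; rw [h] at this; exact (mem_irrefl _ this).elim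

theorem cup_emp (a : M) : cup a emp = a := sext fun z => by simp

theorem le_pr {a b : M} (oa : Od a) (ob : Od b) : a ⊑ pr a b := by
  have h0 : ∀ a : M, Od a → a ⊑ pr a emp := by
    refine ord_ind (fun a : M => a ⊑ pr a emp) fun a oa ih c hc => ?_
    have oc := oa.mem hc
    exact ord_lt_of_le_lt oc (pr_ord oa ord_emp) (ih c hc)
      (pr_lt oc ord_emp oa ord_emp (.inl (by rwa [cup_emp, cup_emp])))
  refine sub_trans (h0 a oa) ?_
  by_cases hb : b = emp
  · rw [hb]; exact sub_refl _
  · refine (pr_ord oa ob).sub (pr_lt oa ord_emp oa ob ?_)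
    have hb' : emp ∊ b := by
      rcases ord_tri ord_emp ob with h | h | h
      · exact h
      · exact (hb h.symm).elim
      · exact (mem_emp _ h).elim
    rw [PL, cup_emp]
    rcases (ord_le_iff oa (ord_cup oa ob)).1 (le_cup_l a b) with h | h
    · exact .inl h
    · exact .inr ⟨h, .inr ⟨rfl, hb'⟩⟩

/-- growth function for closure under pairing -/
noncomputable def gp (c : M) : M := lst (fun d => ∀ a, a ∊ succ c → ∀ b, b ∊ succ c → pr a b ∊ d)
instance iT_gp {t : (ℕ → M) → M} [ht : DfT C t] : DfT C (fun v => gp (t v)) := by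
  refine DfT.sub1 (f := gp) ?_ ht
  unfold gp; infer_instance

theorem gp_spec {c a b : M} (oc : Od c) (ha : a ⊑ c) (oa : Od a) (hb : b ⊑ c) (ob : Od b) : pr a b ∊ gp c := by
  have : ∃ d, Od d ∧ ∀ a, a ∊ succ c → ∀ b, b ∊ succ c → pr a b ∊ d := by
    obtain ⟨d, od, h⟩ := ord_bound (prod (succ c) (succ c)) pF (fun x hx => by
      obtain ⟨x, y, hx', hy, rfl⟩ := (mem_prod' _ _ _).1 hx
      replace hx := hx'
      exact pr_ord (oc.succ.mem hx) (oc.succ.mem hy))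
    exact ⟨d, od, fun a ha b hb => h _ ((mem_prod _ _ _ _).2 ⟨ha, hb⟩)⟩
  exact (lst_spec _ this).2.1 a ((ord_lt_succ oa oc).2 ha) b ((ord_lt_succ ob oc).2 hb)

theorem gp_ord (c : M) : Od (gp c) := lst_ord _

theorem cl_pr {l a b : M} (hl : Cl gp l) (ha : a ∊ l) (hb : b ∊ l) : pr a b ∊ l := by
  have oa := hl.1.1.mem ha
  have ob := hl.1.1.mem hb
  rcases ord_le_or_lt oa ob with h | h
  · exact hl.1.1.tr (hl.2 b hb) (gp_spec ob h oa (sub_refl _) ob)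
  · exact hl.1.1.tr (hl.2 a ha) (gp_spec oa (sub_refl _) oa (oa.sub h) ob)

noncomputable def u0 (i : M) : M := lst (fun a => ∃ b, Od b ∧ i = pr a b)
noncomputable def u1 (i : M) : M := lst (fun b => ∃ a, Od a ∧ i = pr a b)
instance iT_u0 {t : (ℕ → M) → M} [ht : DfT C t] : DfT C (fun v => u0 (t v)) := by
  refine DfT.sub1 (f := u0) ?_ ht
  unfold u0; infer_instance
instance iT_u1 {t : (ℕ → M) → M} [ht : DfT C t] : DfT C (fun v => u1 (t v)) := by
  refine DfT.sub1 (f := u1) ?_ ht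
  unfold u1; infer_instance
theorem u0_pr {a b : M} (oa : Od a) (ob : Od b) : u0 (pr a b) = a := by
  obtain ⟨h1, ⟨b', ob', h2⟩, -⟩ := lst_spec (fun a' => ∃ b', Od b' ∧ pr a b = pr a' b') ⟨a, oa, b, ob, rfl⟩
  exact (pr_inj oa ob h1 ob' h2).1.symm
theorem u1_pr {a b : M} (oa : Od a) (ob : Od b) : u1 (pr a b) = b := by
  obtain ⟨h1, ⟨b', ob', h2⟩, -⟩ := lst_spec (fun b' => ∃ a', Od a' ∧ pr a b = pr a' b') ⟨b, ob, a, oa, rfl⟩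
  exact (pr_inj oa ob ob' h1 h2).2.symm

/-! ### Operations -/
def Spec : ℕ → M → M → M → Prop
  | 0, a, b, z => z ∊ a ∧ ¬ z ∊ b
  | 1, a, b, z => z ∊ a ∧ ∀ x, x ∊ a → pair x z ∊ b
  | 2, a, b, z => z ∊ a ∧ snd z ∊ b
  | 3, a, b, z => z ∊ a ∧ pair (fst z) (snd (snd z)) ∊ b
  | 4, a, b, z => z ∊ a ∧ fst z ∊ fst (snd z)
  | 5, a, b, z => z ∊ a ∧ fst (snd z) ∊ fst z
  | 6, a, b, z => z ∊ a ∧ fst z = fst (snd z)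
  | 7, a, b, z => z ∊ pair a b
  | _, a, b, z => ∃ x, z ∊ x ∧ pair x a ∊ b

theorem df_Spec (n : ℕ) : Df C (fun v => Spec n (v 0) (v 1) (v 2) : (ℕ → M) → Prop) := by
  match n with
  | 0 | 1 | 2 | 3 | 4 | 5 | 6 | 7 => simp only [Spec]; infer_instance
  | n + 8 => simp only [Spec]; infer_instance

instance iP_Spec {t s u : (ℕ → M) → M} [ht : DfT C t] [hs : DfT C s] [hu : DfT C u] (n : ℕ) :
    Df C (fun v => Spec n (t v) (s v) (u v)) := (df_Spec n).sub3 ht hs hu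

theorem isSet_Spec (n : ℕ) (a b : M) : IsSet (Spec n a b) := by
  match n with
  | 0 | 1 | 2 | 3 | 4 | 5 | 6 => exact isSet_sep _ _
  | 7 => exact ⟨pair a b, fun z => Iff.rfl⟩
  | n + 8 =>
    refine isSet_of_bound (un (un (un b))) _ ?_
    rintro z ⟨x, hz, hx⟩
    simp only [mem_un]
    exact ⟨x, ⟨upair x x, ⟨pair x a, hx, by simp [pair]⟩, by simp⟩, hz⟩

noncomputable def op (n : ℕ) (a b : M) : M := mk (Spec n a b)
theorem mem_op (n : ℕ) (a b z : M) : z ∊ op n a b ↔ Spec n a b z := mem_mk (isSet_Spec n a b) z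

instance iT_op {t s : (ℕ → M) → M} [ht : DfT C t] [hs : DfT C s] (n : ℕ) :
    DfT C (fun v => op n (t v) (s v)) :=
  DfT.sub2 (f := op n) (DfT.ofMk (P := fun v z => Spec n (v 0) (v 1) z) (fun _ => isSet_Spec _ _ _)) ht hs

def OpC (n : ℕ) (T : M) : Prop := ∀ a, a ∊ T → ∀ b, b ∊ T → op n a b ∊ T

def ClT (T : M) : Prop := OpC 0 T ∧ OpC 1 T ∧ OpC 2 T ∧ OpC 3 T ∧ OpC 4 T ∧ OpC 5 T ∧ OpC 6 T ∧ OpC 7 T ∧ OpC 8 T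

instance iP_OpC {t : (ℕ → M) → M} (n : ℕ) [ht : DfT C t] : Df C (fun v => OpC n (t v)) := by
  refine Df.sub1 (P := OpC n) ?_ ht
  unfold OpC; infer_instance
instance iP_ClT {t : (ℕ → M) → M} [ht : DfT C t] : Df C (fun v => ClT (t v)) := by
  unfold ClT; infer_instance

theorem clT_iff (T : M) : ClT T ↔ ∀ n, n < 9 → OpC n T := by
  constructor
  · rintro ⟨h0, h1, h2, h3, h4, h5, h6, h7, h8⟩ n hn
    interval_cases n <;> assumption
  · intro h; exact ⟨h 0 (by simp), h 1 (by simp), h 2 (by simp), h 3 (by simp), h 4 (by simp), h 5 (by simp), h 6 (by simp), h 7 (by simp), h 8 (by simp)⟩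

def InD (r S : M) : Prop := ∃ θ, Od θ ∧ ∀ T, r ∊ T → (∀ a, a ∊ θ → V a ∊ T) → ClT T → S ∊ T

instance iP_InD {t s : (ℕ → M) → M} [ht : DfT C t] [hs : DfT C s] : Df C (fun v => InD (t v) (s v)) := by
  refine Df.sub2 (P := InD) ?_ ht hs
  unfold InD; infer_instance

theorem inD_self (r : M) : InD r r := ⟨emp, ord_emp, fun T h _ _ => h⟩
theorem inD_V (r : M) {a : M} (ha : Od a) : InD r (V a) := ⟨succ a, ha.succ, fun T _ h _ => h a (by simp)⟩
theorem inD_op {r a b : M} (n : ℕ) (hn : n < 9) (ha : InD r a) (hb : InD r b) : InD r (op n a b) := by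
  obtain ⟨s, os, hs⟩ := ha
  obtain ⟨t, ot, ht⟩ := hb
  exact ⟨cup s t, ord_cup os ot, fun T h1 h2 h3 => (clT_iff T).1 h3 n hn _
    (hs T h1 (fun a ha => h2 a (by simp [ha])) h3) _ (ht T h1 (fun a ha => h2 a (by simp [ha])) h3)⟩
theorem inD_pair {r a b : M} (ha : InD r a) (hb : InD r b) : InD r (pair a b) := by
  have : pair a b = op 7 a b := sext fun z => by rw [mem_op]; rfl
  rw [this]; exact inD_op 7 (by simp) ha hb
theorem inD_diff {r a b c : M} (ha : InD r a) (hb : InD r b) (h : ∀ z, z ∊ c ↔ z ∊ a ∧ ¬ z ∊ b) : InD r c := by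
  have : c = op 0 a b := sext fun z => by rw [mem_op, h]; rfl
  rw [this]; exact inD_op 0 (by simp) ha hb
theorem inD_emp (r : M) : InD r emp := inD_diff (inD_self r) (inD_self r) (by simp)

/-! ### Enumeration -/
noncomputable def num : ℕ → M
  | 0 => emp
  | n + 1 => succ (num n)
instance iT_num (n : ℕ) : DfT C (fun _ => (num n : M)) := by
  induction n with
  | zero => simp only [num]; infer_instance
  | succ n ih => simp only [num]; infer_instance
theorem num_lt {m n : ℕ} (h : m < n) : (num m : M) ∊ num n := by
  induction n with
  | zero => omega
  | succ n ih =>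
    simp only [num, mem_succ]
    rcases Nat.lt_succ_iff_lt_or_eq.1 h with h | rfl
    · exact .inl (ih h)
    · exact .inr rfl
theorem num_inj {m n : ℕ} (h : (num m : M) = num n) : m = n := by
  rcases lt_trichotomy m n with h' | h' | h'
  · have := num_lt (M := M) h'; rw [h] at this; exact (mem_irrefl _ this).elim
  · exact h'
  · have := num_lt (M := M) h'; rw [h] at this; exact (mem_irrefl _ this).elim
theorem num_omega (n : ℕ) : (num n : M) ∊ omega := by
  induction n with
  | zero => exact lim_emp omega_lim
  | succ n ih => exact lim_succ omega_lim ih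
theorem num_ord (n : ℕ) : Od (num n : M) := omega_ord.mem (num_omega n)

open Classical in
noncomputable def Hop : ℕ → M → M → M → M
  | 0, _, _, _ => emp
  | n + 1, k, a, b => if k = num n then op n a b else Hop n k a b

instance iT_Hop (n : ℕ) {t s u : (ℕ → M) → M} [ht : DfT C t] [hs : DfT C s] [hu : DfT C u] :
    DfT C (fun v => Hop n (t v) (s v) (u v)) := by
  induction n with
  | zero => simp only [Hop]; infer_instance
  | succ n ih => simp only [Hop]; infer_instance

theorem Hop_num (m n : ℕ) (h : m < n) (a b : M) : Hop n (num m) a b = op m a b := by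
  induction n with
  | zero => omega
  | succ n ih =>
    simp only [Hop]
    split_ifs with h'
    · rw [num_inj h']
    · exact ih (by rcases Nat.lt_succ_iff_lt_or_eq.1 h with h | rfl; exact h; exact (h' rfl).elim)

open Classical in
noncomputable def dstep (r i f : M) : M :=
  if u0 (u1 i) = num 9 then V (u0 (u1 (u1 i))) else
  if u0 (u1 i) = num 10 then r else
    Hop 9 (u0 (u1 i)) (app f (u0 (u1 (u1 i)))) (app f (u1 (u1 (u1 i))))

instance iT_dstep {t s u : (ℕ → M) → M} [ht : DfT C t] [hs : DfT C s] [hu : DfT C u] :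
    DfT C (fun v => dstep (t v) (s v) (u v)) := by unfold dstep; infer_instance

noncomputable def enu (r i : M) : M := orec (fun i f => dstep r i f) i
instance iT_enu {t s : (ℕ → M) → M} [ht : DfT C t] [hs : DfT C s] :
    DfT C (fun v => enu (t v) (s v)) := by
  refine DfT.sub2 (f := enu) ?_ ht hs
  unfold enu; infer_instance

theorem enu_spec {r S : M} (h : InD r S) : ∃ i, Od i ∧ enu r i = S := by
  obtain ⟨θ, oθ, h⟩ := h
  obtain ⟨l, hl, hθl⟩ := cl_unbounded gp (fun c _ => gp_ord c) (ord_cup oθ omega_ord)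
  have hω : ∀ n, (num n : M) ∊ l := fun n =>
    hl.1.1.tr hθl (by simp [num_omega])
  have code : ∀ n : ℕ, ∀ j k, j ∊ l → k ∊ l → ∃ i, i ∊ l ∧ j ∊ i ∧ k ∊ i ∧ u0 (u1 i) = num n ∧
      u0 (u1 (u1 i)) = j ∧ u1 (u1 (u1 i)) = k := by
    intro n j k hj hk
    have oj := hl.1.1.mem hj
    have ok := hl.1.1.mem hk
    have h1 := cl_pr hl hj hk
    have h2 := cl_pr hl (hω n) h1
    have o1 := hl.1.1.mem h1
    have o2 := hl.1.1.mem h2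
    have hm : cup j k ∊ l := by
      rcases ord_le_or_lt oj ok with h | h
      · have : cup j k = k := sub_antisymm (cup_le h (sub_refl _)) (le_cup_r _ _)
        rwa [this]
      · have : cup j k = j := sub_antisymm (cup_le (sub_refl _) (oj.sub h)) (le_cup_l _ _)
        rwa [this]
    have om := hl.1.1.mem hm
    have h3 := cl_pr hl (lim_succ hl.1 hm) h2
    refine ⟨_, h3, ?_, ?_, ?_, ?_, ?_⟩
    · exact le_pr om.succ o2 _ ((ord_lt_succ oj om).2 (le_cup_l _ _))
    · exact le_pr om.succ o2 _ ((ord_lt_succ ok om).2 (le_cup_r _ _))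
    · rw [u1_pr om.succ o2, u0_pr (num_ord n) o1]
    · rw [u1_pr om.succ o2, u1_pr (num_ord n) o1, u0_pr oj ok]
    · rw [u1_pr om.succ o2, u1_pr (num_ord n) o1, u1_pr oj ok]
  have e : ∀ i, Od i → enu r i = dstep r i (gr i (fun y => enu r y)) := fun i oi => orec_eq oi
  have hS := h (img l (fun i => enu r i)) ?_ ?_ ?_
  · obtain ⟨i, hi, h⟩ := (mem_img _ _ _).1 hS; exact ⟨i, hl.1.1.mem hi, h.symm⟩
  · obtain ⟨i, hi, h1, h2, h3, h4, h5⟩ := code 10 _ _ (hω 0) (hω 0)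
    refine (mem_img _ _ _).2 ⟨i, hi, ?_⟩
    rw [e i (hl.1.1.mem hi), dstep, h3, if_neg (fun h => by simpa using num_inj h), if_pos rfl]
  · intro a ha
    have hal : a ∊ l := hl.1.1.tr hθl (by simp [ha])
    obtain ⟨i, hi, h1, h2, h3, h4, h5⟩ := code 9 _ _ hal (hω 0)
    refine (mem_img _ _ _).2 ⟨i, hi, ?_⟩
    rw [e i (hl.1.1.mem hi), dstep, h3, h4, if_pos rfl]
  · rw [clT_iff]
    intro n hn a ha b hb
    obtain ⟨j, hj, rfl⟩ := (mem_img _ _ _).1 ha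
    obtain ⟨k, hk, rfl⟩ := (mem_img _ _ _).1 hb
    obtain ⟨i, hi, h1, h2, h3, h4, h5⟩ := code n _ _ hj hk
    refine (mem_img _ _ _).2 ⟨i, hi, ?_⟩
    rw [e i (hl.1.1.mem hi), dstep, h3, h4, h5, if_neg (fun h => by have := num_inj h; omega),
      if_neg (fun h => by have := num_inj h; omega), Hop_num _ _ hn, app_gr h1, app_gr h2]

end S5
end Paper

set_option linter.all false
namespace Paper
section S6
variable {M : Type} [Mdl M] {C : M → Prop}

theorem Df.satR {w : (ℕ → M) → M} (hw : DfT C w) (φ : Fm M) (hc : φ.cn C) : ∀ (t : ℕ → (ℕ → M) → M),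
    (∀ i, DfT C (t i)) → Df C (fun v => satR (fun x => x ∊ w v) φ (fun i => t i v)) := by
  have he : ∀ (t : ℕ → (ℕ → M) → M), (∀ i, DfT C (t i)) → ∀ s, trm C s → DfT C (fun v => ev (fun i => t i v) s) := by
    rintro t ht (i | c) h
    · exact ht i
    · have : InC C c := ⟨h⟩
      exact DfT.const c
  induction φ generalizing w with
  | mem i j => intro t ht; have := he t ht i hc.1; have := he t ht j hc.2; exact Df.mem
  | eq i j => intro t ht; have := he t ht i hc.1; have := he t ht j hc.2; exact Df.eq
  | fal => intro t ht; exact Df.fal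
  | imp φ ψ h1 h2 => intro t ht; have := h1 hw hc.1 t ht; have := h2 hw hc.2 t ht; exact Df.imp
  | all φ ih =>
    intro t ht
    have hw' : DfT C (fun v => w (fun i => v (i+1))) := hw.shift _
    have h1 : Df C (fun v => v 0 ∊ w (fun i => v (i+1))) := inferInstance
    have h2 := ih hw' hc (fun | 0 => fun v => v 0 | i + 1 => fun v => t i (fun j => v (j+1))) (by
      rintro (_ | i)
      · exact DfT.var 0
      · exact (ht i).shift _)
    refine @Df.all _ _ _ (fun v a => a ∊ w v → Paper.satR (fun x => x ∊ w v) φ (cs a (fun i => t i v))) ?_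
    refine @Df.imp _ _ _ _ _ h1 (h2.congr fun v => ?_)
    have : (fun i => (match i with | 0 => fun v => v 0 | i + 1 => fun v => t i (fun j => v (j+1)) : (ℕ → M) → M) v)
      = cs (v 0) (fun i => t i (fun j => v (j+1))) := by
      funext i; cases i <;> rfl
    rw [← this]

theorem cn_cl' {φ : Fm M} (h : φ.cn C) : ∀ c ∈ φ.cl, C c := by
  have ht : ∀ s, trm C s → ∀ c, s = .inr c → C c := by rintro _ h c rfl; exact h
  induction φ with
  | mem s t => 
    intro c hc
    rcases s with i | a <;> rcases t with j | b <;> simp [Fm.cl, Fm.cn, trm] at hc h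
    · subst hc; exact h
    · subst hc; exact h
    · rcases hc with rfl | rfl; exact h.1; exact h.2
  | eq s t =>
    intro c hc
    rcases s with i | a <;> rcases t with j | b <;> simp [Fm.cl, Fm.cn, trm] at hc h
    · subst hc; exact h
    · subst hc; exact h
    · rcases hc with rfl | rfl; exact h.1; exact h.2
  | fal => intro c hc; simp [Fm.cl] at hc
  | imp φ ψ h1 h2 =>
    intro c hc; simp only [Fm.cl, List.mem_append] at hc
    exact hc.elim (h1 h.1 c) (h2 h.2 c)
  | all φ ih => exact ih h

def abt (ρ : ℕ → ℕ) (σ : M → ℕ) : ℕ ⊕ M → ℕ ⊕ M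
  | .inl i => .inl (ρ i)
  | .inr c => .inl (σ c)

def Fm.abs : (ℕ → ℕ) → (M → ℕ) → Fm M → Fm M
  | ρ, σ, .mem s t => .mem (abt ρ σ s) (abt ρ σ t)
  | ρ, σ, .eq s t => .eq (abt ρ σ s) (abt ρ σ t)
  | _, _, .fal => .fal
  | ρ, σ, .imp φ ψ => .imp (φ.abs ρ σ) (ψ.abs ρ σ)
  | ρ, σ, .all φ => .all (φ.abs (fun | 0 => 0 | i + 1 => ρ i + 1) (fun c => σ c + 1))

theorem cn_abs (φ : Fm M) : ∀ ρ σ, (φ.abs ρ σ).cn (fun _ => False) := by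
  induction φ with
  | mem s t => intro ρ σ; rcases s with i | a <;> rcases t with j | b <;> exact ⟨trivial, trivial⟩
  | eq s t => intro ρ σ; rcases s with i | a <;> rcases t with j | b <;> exact ⟨trivial, trivial⟩
  | fal => intro ρ σ; trivial
  | imp φ ψ h1 h2 => intro ρ σ; exact ⟨h1 _ _, h2 _ _⟩
  | all φ ih => intro ρ σ; exact ih _ _

theorem sat_abs (φ : Fm M) : ∀ (ρ : ℕ → ℕ) (σ : M → ℕ) (v : ℕ → M), (∀ c ∈ φ.cl, v (σ c) = c) →
    (sat (φ.abs ρ σ) v ↔ sat φ (fun i => v (ρ i))) := by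
  induction φ with
  | mem s t =>
    intro ρ σ v h
    rcases s with i | a <;> rcases t with j | b <;> simp [Fm.cl] at h <;>
      simp [sat, satR, Fm.abs, ev, abt, h]
  | eq s t =>
    intro ρ σ v h
    rcases s with i | a <;> rcases t with j | b <;> simp [Fm.cl] at h <;>
      simp [sat, satR, Fm.abs, ev, abt, h]
  | fal => intro ρ σ v h; rfl
  | imp φ ψ h1 h2 =>
    intro ρ σ v h
    simp only [Fm.cl, List.mem_append] at h
    simp only [sat, satR, Fm.abs] at h1 h2 ⊢
    rw [h1 _ _ _ (fun c hc => h c (.inl hc)), h2 _ _ _ (fun c hc => h c (.inr hc))]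
  | all φ ih =>
    intro ρ σ v h
    simp only [sat, satR, Fm.abs] at ih ⊢
    refine forall_congr' fun a => imp_congr_right fun _ => ?_
    refine (ih (fun | 0 => 0 | i + 1 => ρ i + 1) (fun c => σ c + 1) (cs a v) (fun c hc => h c hc)).trans ?_
    have : (fun i => cs a v (match i with | 0 => 0 | i + 1 => ρ i + 1)) = cs a (fun i => v (ρ i)) := by
      funext i; cases i <;> rfl
    rw [← this]

noncomputable def lcode : List M → M
  | [] => emp
  | c :: l => pair c (lcode l)

theorem dec_lcode (l : List M) (i : ℕ) (h : i < l.length) : dec (lcode l) i = l[i] := by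
  induction l generalizing i with
  | nil => simp at h
  | cons c l ih =>
    rw [lcode, dec_pair]
    cases i with
    | zero => rfl
    | succ i => simp only [cs, List.getElem_cons_succ]; exact ih i (by simpa using h)

theorem inD_lcode {r : M} (l : List M) (h : ∀ c ∈ l, InD r c) : InD r (lcode l) := by
  induction l with
  | nil => exact inD_emp r
  | cons c l ih =>
    simp at h
    exact inD_pair h.1 (ih h.2)

theorem lim_fst {a x : M} (ha : Lim a) (hx : x ∊ V a) : fst x ∊ V a := by
  by_cases h : ∃ y z, x = pair y z
  · obtain ⟨y, z, rfl⟩ := h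
    rw [fst_pair]
    exact V_trans ha.1 (V_trans ha.1 hx (show upair y y ∊ _ by simp [pair])) (by simp)
  · have : fst x = emp := by
      rw [← emptyE_iff]; intro u hu
      rw [fst, mem_mk (isSet_fst _)] at hu
      obtain ⟨y, z, e, -⟩ := hu; exact h ⟨y, z, e⟩
    rw [this]; exact lim_emp_V ha

theorem lim_snd {a x : M} (ha : Lim a) (hx : x ∊ V a) : snd x ∊ V a := by
  by_cases h : ∃ y z, x = pair y z
  · obtain ⟨y, z, rfl⟩ := h
    rw [snd_pair]
    exact V_trans ha.1 (V_trans ha.1 hx (show upair y z ∊ _ by simp [pair])) (by simp)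
  · have : snd x = emp := by
      rw [← emptyE_iff]; intro u hu
      rw [snd, mem_mk (isSet_snd _)] at hu
      obtain ⟨y, z, e, -⟩ := hu; exact h ⟨y, z, e⟩
    rw [this]; exact lim_emp_V ha

theorem inD_of {r a b c : M} (n : ℕ) (hn : n < 9) (ha : InD r a) (hb : InD r b)
    (h : ∀ z, z ∊ c ↔ Spec n a b z) : InD r c := by
  have : c = op n a b := sext fun z => by rw [mem_op, h]
  rw [this]; exact inD_op n hn ha hb

theorem inD_rel {r θ : M} (hθ : Lim θ) (R : M → M → Prop) [hR : Df Any (fun v => R (v 0) (v 1))]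
    (h00 : InD r (sep (V θ) (fun e => R (dec e 0) (dec e 0))))
    (h01 : InD r (sep (V θ) (fun e => R (dec e 0) (dec e 1))))
    (h10 : InD r (sep (V θ) (fun e => R (dec e 1) (dec e 0)))) :
    ∀ i j, InD r (sep (V θ) (fun e => R (dec e i) (dec e j))) := by
  have hR' : ∀ s t : (ℕ → M) → M, [DfT Any s] → [DfT Any t] → Df Any (fun w => R (s w) (t w)) :=
    fun s t hs ht => hR.sub2 hs ht
  have hV := inD_V r hθ.1
  have hp : ∀ z, z ∊ V θ → pair (fst z) (snd (snd z)) ∊ V θ := fun z hz =>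
    lim_pair hθ (lim_fst hθ hz) (lim_snd hθ (lim_snd hθ hz))
  have d0 : ∀ z : M, dec (pair (fst z) (snd (snd z))) 0 = dec z 0 := fun z => by rw [dec_pair]; rfl
  have dj : ∀ (z : M) j, dec (pair (fst z) (snd (snd z))) (j+1) = dec z (j+2) := fun z j => by rw [dec_pair]; rfl
  intro i
  induction i with
  | zero =>
    intro j
    match j with
    | 0 => exact h00
    | j + 1 =>
      induction j with
      | zero => exact h01
      | succ j ih =>
        refine inD_of 3 (by simp) hV ih fun z => ?_
        simp only [Spec, mem_sep, d0, dj]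
        exact and_congr_right fun hz => ⟨fun h => ⟨hp z hz, h⟩, fun h => h.2⟩
  | succ i ih =>
    intro j
    match j with
    | j + 1 =>
      refine inD_of 2 (by simp) hV (ih j) fun z => ?_
      simp only [Spec, mem_sep]
      exact and_congr_right fun hz => ⟨fun h => ⟨lim_snd hθ hz, h⟩, fun h => h.2⟩
    | 0 =>
      clear ih
      induction i with
      | zero => exact h10
      | succ j ih =>
        refine inD_of 3 (by simp) hV ih fun z => ?_
        simp only [Spec, mem_sep, d0, dj]
        exact and_congr_right fun hz => ⟨fun h => ⟨hp z hz, h⟩, fun h => h.2⟩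

theorem df_satdec (U : M) (φ : Fm M) : Df Any (fun v => satR (fun x => x ∊ U) φ (dec (v 0))) :=
  Df.satR (w := fun _ => U) inferInstance φ (cn_any φ) (fun i v => dec (v 0) i) (fun i => inferInstance)

theorem inD_sat {r θ : M} (hθ : Lim θ) (φ : Fm M) (hc : φ.cn (fun _ => False)) :
    InD r (sep (V θ) (fun e => satR (fun x => x ∊ V θ) φ (dec e))) := by
  have hV := inD_V r hθ.1
  have hS : ∀ φ : Fm M, Df Any (fun v => satR (fun x => x ∊ V θ) φ (dec (v 0))) := df_satdec _
  induction φ with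
  | mem s t =>
    rcases s with i | a <;> rcases t with j | b <;> simp [Fm.cn, trm] at hc
    refine inD_rel hθ (fun x y => x ∊ y) ?_ ?_ ?_ i j
    · refine inD_diff hV hV fun z => ?_
      simp only [mem_sep]
      have := mem_irrefl (dec z 0)
      tauto
    · refine inD_of 4 (by simp) hV hV fun z => ?_
      simp only [Spec, mem_sep]; rfl
    · refine inD_of 5 (by simp) hV hV fun z => ?_
      simp only [Spec, mem_sep]; rfl
  | eq s t =>
    rcases s with i | a <;> rcases t with j | b <;> simp [Fm.cn, trm] at hc
    refine inD_rel hθ (fun x y => x = y) ?_ ?_ ?_ i j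
    · have : sep (V θ) (fun e => dec e 0 = dec e 0) = V θ := sext fun z => by rw [mem_sep]; tauto
      rw [this]; exact hV
    · refine inD_of 6 (by simp) hV hV fun z => ?_
      simp only [Spec, mem_sep]; rfl
    · refine inD_of 6 (by simp) hV hV fun z => ?_
      simp only [Spec, mem_sep]
      exact and_congr_right fun _ => eq_comm
  | fal =>
    refine inD_diff hV hV fun z => ?_
    have := hS .fal
    rw [mem_sep]
    simp [satR]
  | imp φ ψ h1 h2 =>
    have h1 := h1 hc.1
    have h2 := h2 hc.2
    have i1 := hS φ
    have i2 := hS ψ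
    have i3 := hS (.imp φ ψ)
    have : InD r (op 0 (sep (V θ) (fun e => satR (fun x => x ∊ V θ) φ (dec e)))
      (sep (V θ) (fun e => satR (fun x => x ∊ V θ) ψ (dec e)))) := inD_op 0 (by simp) h1 h2
    refine inD_diff hV this fun z => ?_
    rw [mem_op]; simp only [Spec, mem_sep, satR]
    tauto
  | all φ ih =>
    have ih := ih hc
    have i1 := hS φ
    have i3 := hS (.all φ)
    refine inD_of 1 (by simp) hV ih fun z => ?_
    rw [mem_sep]
    simp only [Spec, mem_sep, satR, dec_pair]
    exact and_congr_right fun hz => forall_congr' fun x => forall_congr' fun hx =>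
      ⟨fun h => ⟨lim_pair hθ hx hz, h⟩, fun h => h.2⟩

/-- sets definable from elements of `𝒟_r` are in `𝒟_r` -/
theorem inD_def {r : M} (P : M → Prop) (h : Df (InD r) (fun v => P (v 0))) {x : M} (hx : P x)
    (hu : ∀ y, P y → y = x) : InD r x := by
  classical
  obtain ⟨φ, hc, hφ⟩ := h
  have hcl := cn_cl' hc
  let q := lcode φ.cl
  have hq : InD r q := inD_lcode _ hcl
  let σ : M → ℕ := fun c => φ.cl.idxOf c + 1
  let ψ := φ.abs (fun _ => 0) σ
  have hψ : ∀ y, sat ψ (dec (pair y q)) ↔ P y := by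
    intro y
    have := sat_abs φ (fun _ => 0) σ (dec (pair y q)) (by
      intro c hc
      rw [dec_pair]
      simp only [σ, cs, q]
      have h := List.idxOf_lt_length_iff.2 hc
      rw [dec_lcode _ _ h]; simp)
    rw [this, hφ, dec_pair]; rfl
  obtain ⟨g, dg, og, hg⟩ := reflect ψ
  obtain ⟨a, oa, ha⟩ := exists_V (pair x q)
  obtain ⟨θ, hθ, haθ⟩ := cl_unbounded g og oa
  have hU : pair x q ∊ V θ := V_mono oa hθ.1.1 (hθ.1.1.sub haθ) _ ha
  have hX := inD_sat (r := r) hθ.1 ψ (cn_abs _ _ _)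
  have := df_satdec (V θ) ψ
  refine inD_of 8 (by simp) hq hX fun z => ?_
  simp only [Spec, mem_sep]
  constructor
  · intro hz
    exact ⟨x, hz, hU, (hg θ hθ _ hU).2 ((hψ x).2 hx)⟩
  · rintro ⟨y, hz, hy, h⟩
    rw [hg θ hθ _ hy, hψ] at h
    rw [← hu y h]; exact hz

theorem inD_ord {r a : M} (ha : Od a) : InD r a := by
  have : InC (InD r) (V a) := ⟨inD_V r ha⟩
  refine inD_def (fun x => ∀ z, z ∊ x ↔ z ∊ V a ∧ Od z) inferInstance (x := a) ?_ ?_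
  · intro z
    exact ⟨fun h => ⟨ord_sub_V a ha z h, ha.mem h⟩, fun h => ord_mem_V a ha z h.2 h.1⟩
  · intro y hy
    exact sext fun z => (hy z).trans ⟨fun h => ord_mem_V a ha z h.2 h.1, fun h => ⟨ord_sub_V a ha z h, ha.mem h⟩⟩

/-- definable terms -/
theorem inD_term {r : M} (f : M) (h : DfT (InD r) (fun _ => f)) : InD r f :=
  inD_def (fun x => x = f) h.out rfl (fun y h => h)

theorem inD_mk {r : M} (P : M → Prop) (h : Df (InD r) (fun v => P (v 0))) (hs : IsSet P) : InD r (mk P) := by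
  have : Df (InD r) (fun w : ℕ → M => P (w 0)) := h
  exact inD_term _ (DfT.ofMk (P := fun _ z => P z) (fun _ => hs))

end S6
end Paper

set_option linter.all false
namespace Paper
section S7
variable {M : Type} [Mdl M] {C : M → Prop}

/-! ### Keyed coding -/
noncomputable def dbl (a : M) : M := orec (fun a g => un (img a (fun b => succ (succ (app g b))))) a
instance iT_dbl {t : (ℕ → M) → M} [ht : DfT C t] : DfT C (fun v => dbl (t v)) := by
  refine DfT.sub1 (f := dbl) ?_ ht
  unfold dbl; infer_instance

theorem mem_dbl {a : M} (ha : Od a) (z : M) : z ∊ dbl a ↔ ∃ b, b ∊ a ∧ z ∊ succ (succ (dbl b)) := by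
  have e : dbl a = un (img a (fun b => succ (succ (app (gr a dbl) b)))) := orec_eq ha
  rw [e]
  simp only [mem_un, mem_img]
  constructor
  · rintro ⟨y, ⟨b, hb, rfl⟩, h⟩
    rw [app_gr hb] at h
    exact ⟨b, hb, h⟩
  · rintro ⟨b, hb, h⟩
    exact ⟨_, ⟨b, hb, rfl⟩, by rw [app_gr hb]; exact h⟩

theorem ord_dbl : ∀ a : M, Od a → Od (dbl a) := by
  refine ord_ind _ fun a ha ih => ?_
  refine ord_of_trans ?_ ?_
  · intro x hx
    obtain ⟨b, hb, h⟩ := (mem_dbl ha _).1 hx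
    exact (ih b hb).succ.succ.mem h
  · intro x hx z hz
    obtain ⟨b, hb, h⟩ := (mem_dbl ha _).1 hx
    exact (mem_dbl ha _).2 ⟨b, hb, (ih b hb).succ.succ.tr h hz⟩

theorem dbl_lt {a b : M} (ha : Od a) (h : b ∊ a) : succ (dbl b) ∊ dbl a :=
  (mem_dbl ha _).2 ⟨b, h, by simp⟩

theorem dbl_lt' {a b : M} (ha : Od a) (h : b ∊ a) : dbl b ∊ dbl a :=
  (mem_dbl ha _).2 ⟨b, h, by simp⟩

theorem dbl_inj {a b : M} (ha : Od a) (hb : Od b) (h : dbl a = dbl b) : a = b := by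
  rcases ord_tri ha hb with h' | h' | h'
  · have := dbl_lt' hb h'; rw [h] at this; exact (mem_irrefl _ this).elim
  · exact h'
  · have := dbl_lt' ha h'; rw [h] at this; exact (mem_irrefl _ this).elim

theorem dbl_ne_succ {a b : M} (ha : Od a) (hb : Od b) (h : dbl a = succ (dbl b)) : False := by
  rcases ord_tri ha hb with h' | h' | h'
  · have h1 := dbl_lt' hb h'
    have h2 : dbl b ∊ dbl a := by rw [h]; simp
    exact mem_asymm h1 h2
  · have h2 : dbl b ∊ dbl a := by rw [h]; simp
    rw [h'] at h2; exact mem_irrefl _ h2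
  · have := dbl_lt ha h'; rw [h] at this; exact mem_irrefl _ this

theorem dbl_lim : ∀ a : M, Od a → ∀ l, Lim l → a ∊ l → dbl a ∊ l := by
  refine ord_ind _ fun a ha ih l hl hal => ?_
  rcases ord_zero_succ_lim ha with rfl | ⟨b, ob, rfl⟩ | h
  · have : dbl (emp : M) = emp := sext fun z => by rw [mem_dbl ord_emp]; simp
    rw [this]; exact hal
  · have hb : b ∊ l := hl.1.tr hal (by simp)
    have : dbl (succ b) ⊑ succ (succ (dbl b)) := by
      intro z hz
      obtain ⟨c, hc, h⟩ := (mem_dbl ha _).1 hz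
      rcases (mem_succ _ _).1 hc with hc | rfl
      · have h1 := dbl_lt' ob hc
        have oc := ob.mem hc
        have h2 : succ (succ (dbl c)) ⊑ succ (succ (dbl b)) := by
          refine (ord_succ_le (ord_dbl b ob).succ.succ).2 ?_
          rw [mem_succ]; left; rw [mem_succ]; left; exact dbl_lt ob hc
        exact h2 _ h
      · exact h
    exact ord_lt_of_le_lt (ord_dbl _ ha) hl.1 this (lim_succ hl (lim_succ hl (ih b (by simp) l hl hb)))
  · have : dbl a ⊑ a := by
      intro z hz
      obtain ⟨c, hc, h'⟩ := (mem_dbl ha _).1 hz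
      exact h.1.tr (lim_succ h (lim_succ h (ih c hc a h hc))) h'
    exact ord_lt_of_le_lt (ord_dbl _ ha) hl.1 this hal

open Classical in
noncomputable def cd (a k B : M) : M :=
  if Lim a then cup (upair emp (dbl (succ k))) (img B (fun x => succ (dbl x))) else upair (un a) (un a)

instance iT_cd {t s u : (ℕ → M) → M} [ht : DfT C t] [hs : DfT C s] [hu : DfT C u] :
    DfT C (fun v => cd (t v) (s v) (u v)) := by
  refine DfT.sub3 (f := cd) ?_ ht hs hu
  unfold cd; infer_instance

theorem mem_cd_lim {a k B : M} (h : Lim a) (z : M) :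
    z ∊ cd a k B ↔ (z = emp ∨ z = dbl (succ k)) ∨ ∃ x, x ∊ B ∧ z = succ (dbl x) := by
  rw [cd, if_pos h, mem_cup, mem_upair, mem_img]

theorem mem_cd_nlim {a k B : M} (h : ¬ Lim a) (z : M) : z ∊ cd a k B ↔ z = un a := by
  rw [cd, if_neg h, mem_upair, or_self]

theorem un_succ {a : M} (ha : Od a) : un (succ a) = a := sext fun z => by
  simp only [mem_un, mem_succ]
  constructor
  · rintro ⟨y, hy | rfl, h⟩
    · exact ha.tr hy h
    · exact h
  · intro h; exact ⟨a, .inr rfl, h⟩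

theorem cd_sub {a k B w : M} (ha : Od a) (hw : w ∊ a) (hk : Lim a → k ∊ a) (hB : B ⊑ a) : cd a k B ⊑ a := by
  intro z hz
  by_cases h : Lim a
  · rcases (mem_cd_lim h z).1 hz with (rfl | rfl) | ⟨x, hx, rfl⟩
    · exact lim_emp h
    · have := lim_succ h (hk h)
      exact dbl_lim _ (ha.mem this) a h this
    · exact lim_succ h (dbl_lim _ (ha.mem (hB _ hx)) a h (hB _ hx))
  · rw [mem_cd_nlim h] at hz
    rcases ord_zero_succ_lim ha with rfl | ⟨b, ob, rfl⟩ | h'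
    · exact (mem_emp _ hw).elim
    · rw [hz, un_succ ob]; simp
    · exact (h h').elim

theorem cd_core {w ξ a b k k' B B' : M} (oa : Od a) (ob : Od b) (hw : w ∊ ξ) (hξ : ξ ∊ a) (hab : a ∊ b)
    (hk : Lim a → k ∊ a) (ok : Od k) (ok' : Od k') (hB : B ⊑ a) (hB' : B' ⊑ b) (e : cap (cd b k' B') a = cd a k B) :
    Lim a ∧ Lim b ∧ k = k' ∧ cap B' a = B := by
  have hsub := cd_sub (k := k) oa hξ hk hB
  have hb : Lim b := by
    by_contra h
    rcases ord_zero_succ_lim ob with rfl | ⟨c, oc, rfl⟩ | h'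
    · exact mem_emp _ hab
    · have h1 : ∃ z, z ∊ cd a k B := by
        by_cases ha : Lim a
        · exact ⟨emp, (mem_cd_lim ha _).2 (.inl (.inl rfl))⟩
        · exact ⟨un a, (mem_cd_nlim ha _).2 rfl⟩
      obtain ⟨z, hz⟩ := h1
      have hza := hsub z hz
      rw [← e, mem_cap, mem_cd_nlim h, un_succ oc] at hz
      rw [hz.1] at hza
      rcases (mem_succ _ _).1 hab with h2 | rfl
      · exact mem_asymm h2 hza
      · exact mem_irrefl _ hza
    · exact h h'
  have h0 : (emp : M) ∊ cd a k B := by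
    rw [← e, mem_cap, mem_cd_lim hb]
    refine ⟨.inl (.inl rfl), ?_⟩
    exact ord_lt_of_le_lt ord_emp oa (fun z hz => (mem_emp _ hz).elim) hξ
  have ha : Lim a := by
    by_contra h
    rw [mem_cd_nlim h] at h0
    have : w ∊ un a := by rw [mem_un]; exact ⟨ξ, hξ, hw⟩
    rw [← h0] at this; exact mem_emp _ this
  have o1 := ok.succ
  have o2 := ok'.succ
  refine ⟨ha, hb, ?_, ?_⟩
  · have h1 : dbl (succ k) ∊ cd a k B := (mem_cd_lim ha _).2 (.inl (.inr rfl))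
    rw [← e, mem_cap, mem_cd_lim hb] at h1
    rcases h1.1 with (h | h) | ⟨x, hx, h⟩
    · have := dbl_lt' o1 (by simp : k ∊ succ k)
      rw [h] at this; exact (mem_emp _ this).elim
    · exact succ_inj (dbl_inj o1 o2 h)
    · exact (dbl_ne_succ o1 (ob.mem (hB' _ hx)) h).elim
  · refine sext fun z => ?_
    rw [mem_cap]
    constructor
    · rintro ⟨h1, h2⟩
      have h3 : succ (dbl z) ∊ cap (cd b k' B') a := by
        rw [mem_cap, mem_cd_lim hb]
        exact ⟨.inr ⟨z, h1, rfl⟩, lim_succ ha (dbl_lim _ (oa.mem h2) a ha h2)⟩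
      rw [e, mem_cd_lim ha] at h3
      rcases h3 with (h | h) | ⟨x, hx, h⟩
      · have : dbl z ∊ succ (dbl z) := by simp
        rw [h] at this; exact (mem_emp _ this).elim
      · exact (dbl_ne_succ o1 (oa.mem h2) h.symm).elim
      · rw [dbl_inj (oa.mem h2) (oa.mem (hB _ hx)) (succ_inj h)]; exact hx
    · intro hz
      have oz := oa.mem (hB _ hz)
      have h3 : succ (dbl z) ∊ cd a k B := (mem_cd_lim ha _).2 (.inr ⟨z, hz, rfl⟩)
      rw [← e, mem_cap, mem_cd_lim hb] at h3
      refine ⟨?_, hB _ hz⟩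
      rcases h3.1 with (h | h) | ⟨x, hx, h⟩
      · have : dbl z ∊ succ (dbl z) := by simp
        rw [h] at this; exact (mem_emp _ this).elim
      · exact (dbl_ne_succ o2 oz h.symm).elim
      · rw [dbl_inj oz (ob.mem (hB' _ hx)) (succ_inj h)]; exact hx

/-! ### Keys from clubs -/
open Classical in
noncomputable def kc (P : M → Prop) (a : M) : M := if P a then emp else succ (un (sep a P))
noncomputable def nx (P : M → Prop) (a : M) : M := lst (fun x => P x ∧ a ∊ x)

section club

theorem P_inst (P : M → Prop) [hP : Df Any (fun v => P (v 0))] : ∀ s : (ℕ → M) → M, [DfT Any s] → Df Any (fun v => P (s v)) := fun s hs => hP.sub1 hs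

theorem df_kc (P : M → Prop) [hP : Df Any (fun v => P (v 0))] {t : (ℕ → M) → M} [ht : DfT Any t] : DfT Any (fun v => kc P (t v)) := by
  have := P_inst P
  refine DfT.sub1 (f := kc P) ?_ ht
  unfold kc; infer_instance

theorem df_nx (P : M → Prop) [hP : Df Any (fun v => P (v 0))] {t : (ℕ → M) → M} [ht : DfT Any t] : DfT Any (fun v => nx P (t v)) := by
  have := P_inst P
  refine DfT.sub1 (f := nx P) ?_ ht
  unfold nx; infer_instance

theorem kc_ord (P : M → Prop) [hP : Df Any (fun v => P (v 0))] {a : M} (ha : Od a) : Od (kc P a) := by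
  unfold kc; split_ifs
  · exact ord_emp
  · exact (ord_un fun x hx => ha.mem ((mem_sep _ _ _).1 hx).1).succ

theorem kc_lt (P : M → Prop) [hP : Df Any (fun v => P (v 0))] {a : M} (ha : Lim a) (hcl : (∀ x, x ∊ a → ∃ y, P y ∧ x ∊ y ∧ y ∊ a) → P a) : kc P a ∊ a := by
  unfold kc; split_ifs with h
  · exact lim_emp ha
  · refine lim_succ ha ?_
    have o1 : Od (un (sep a P)) := ord_un fun x hx => ha.1.mem ((mem_sep _ _ _).1 hx).1
    by_contra hn
    refine h (hcl fun x hx => ?_)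
    have := (ord_not_lt ha.1 o1).1 hn x hx
    obtain ⟨y, hy, hxy⟩ := (mem_un _ _).1 this
    rw [mem_sep] at hy
    exact ⟨y, hy.2, hxy, hy.1⟩

theorem kc_eq (P : M → Prop) [hP : Df Any (fun v => P (v 0))] {a b : M} (oa : Od a) (ob : Od b) (hab : a ∊ b) (h : kc P a = kc P b) :
    (P a ∧ P b) ∨ (¬ P a ∧ ¬ P b ∧ ∀ x, Od x → ((P x ∧ a ∊ x) ↔ (P x ∧ b ∊ x))) := by
  unfold kc at h
  have hs : ∀ a : M, succ a ≠ emp := fun a e => mem_emp a (by rw [← e]; simp)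
  split_ifs at h with h1 h2 h2
  · exact .inl ⟨h1, h2⟩
  · exact (hs _ h.symm).elim
  · exact (hs _ h).elim
  · refine .inr ⟨h1, h2, fun x ox => ⟨fun hx => ⟨hx.1, ?_⟩, fun hx => ⟨hx.1, ox.tr hx.2 hab⟩⟩⟩
    rcases ord_tri ob ox with h3 | rfl | h3
    · exact h3
    · exact (h2 hx.1).elim
    · have h4 : a ∊ un (sep b P) := by rw [mem_un]; exact ⟨x, by rw [mem_sep]; exact ⟨h3, hx.1⟩, hx.2⟩
      rw [← succ_inj h, mem_un] at h4
      obtain ⟨y, hy, hay⟩ := h4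
      rw [mem_sep] at hy
      exact (mem_asymm hy.1 hay).elim

theorem nx_eq (P : M → Prop) [hP : Df Any (fun v => P (v 0))] {a b : M} (h : ∀ x, Od x → ((P x ∧ a ∊ x) ↔ (P x ∧ b ∊ x))) : nx P a = nx P b := by
  have := P_inst P
  refine (eq_lst (fun x => P x ∧ b ∊ x) _).2 ?_
  have h1 := (eq_lst (fun x => P x ∧ a ∊ x) _).1 (rfl : nx P a = _)
  rcases h1 with ⟨o, h1, h2⟩ | ⟨h1, h2⟩
  · exact .inl ⟨o, (h _ o).1 h1, fun z hz hz' => h2 z hz ((h _ (o.mem hz)).2 hz')⟩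
  · exact .inr ⟨fun ⟨x, ox, hx⟩ => h1 ⟨x, ox, (h x ox).2 hx⟩, h2⟩

theorem nx_spec (P : M → Prop) [hP : Df Any (fun v => P (v 0))] {a x : M} (ox : Od x) (hx : P x) (h : a ∊ x) : Od (nx P a) ∧ P (nx P a) ∧ a ∊ nx P a ∧ nx P a ⊑ x := by
  have := P_inst P
  have := lst_spec (fun x => P x ∧ a ∊ x) ⟨x, ox, hx, h⟩
  exact ⟨this.1, this.2.1.1, this.2.1.2, lst_le (fun x => P x ∧ a ∊ x) ox ⟨hx, h⟩⟩
end club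

end S7
end Paper

set_option linter.all false
namespace Paper
section S8
variable {M : Type} [Mdl M] {C : M → Prop}

def Bad (ξ κ S : M) : Prop :=
  (∀ a, a ∊ κ → (∃ A, pair a A ∊ S) ∧ ∀ A, pair a A ∊ S → A ⊑ a) ∧
    ∀ a b A, ξ ∊ a → a ∊ b → b ∊ κ → pair b A ∊ S → ¬ pair a (cap A a) ∊ S
instance iP_Bad {t s u : (ℕ → M) → M} [ht : DfT C t] [hs : DfT C s] [hu : DfT C u] :
    Df C (fun v => Bad (t v) (s v) (u v)) := by
  refine Df.sub3 (P := Bad) ?_ ht hs hu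
  unfold Bad; infer_instance

variable (M) in
def Psi : Prop := ∀ r ξ : M, Od ξ → ∃ κ, Od κ ∧ ξ ∊ κ ∧ ∀ S, InD r S → ¬ Bad ξ κ S

theorem df_real2 {k : ℕ} (φ : SetFormula (k + 2)) (p : Fin k → M) (hp : ∀ i, InC C (p i))
    {t s : (ℕ → M) → M} [ht : DfT C t] [hs : DfT C s] :
    Df C (fun v => Realize Mdl.E φ (Fin.cons (t v) (Fin.cons (s v) p))) := by
  let T : Fin (k + 2) → (ℕ → M) → M := Fin.cons t (Fin.cons s (fun i _ => p i))
  have hT : ∀ i, DfT C (T i) := by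
    intro i
    refine Fin.cases ?_ (fun i => ?_) i
    · exact ht
    · refine Fin.cases ?_ (fun i => ?_) i
      · exact hs
      · have := hp i
        exact (inferInstance : DfT C (fun _ => p i))
  refine (Df.realize φ T hT).congr fun v => ?_
  have : (fun i => T i v) = Fin.cons (t v) (Fin.cons (s v) p) := by
    funext i
    refine Fin.cases ?_ (fun i => ?_) i
    · rfl
    · refine Fin.cases ?_ (fun i => ?_) i <;> rfl
  rw [this]

theorem df_real1 {k : ℕ} (φ : SetFormula (k + 1)) (p : Fin k → M) (hp : ∀ i, InC C (p i))
    {t : (ℕ → M) → M} [ht : DfT C t] :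
    Df C (fun v => Realize Mdl.E φ (Fin.cons (t v) p)) := by
  let T : Fin (k + 1) → (ℕ → M) → M := Fin.cons t (fun i _ => p i)
  have hT : ∀ i, DfT C (T i) := by
    intro i
    refine Fin.cases ?_ (fun i => ?_) i
    · exact ht
    · have := hp i
      exact (inferInstance : DfT C (fun _ => p i))
  refine (Df.realize φ T hT).congr fun v => ?_
  have : (fun i => T i v) = Fin.cons (t v) p := by
    funext i
    refine Fin.cases ?_ (fun i => ?_) i <;> rfl
  rw [this]

theorem inD_fin {k : ℕ} (p : Fin k → M) : ∃ r, ∀ i, InD r (p i) := by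
  refine ⟨lcode (List.ofFn p), fun i => ?_⟩
  set r := lcode (List.ofFn p) with hr
  have h0 : InC (InD r) r := ⟨inD_self r⟩
  have h1 : InD r (dec r i) := inD_term _ inferInstance
  rw [hr, dec_lcode _ _ (by simp)] at h1
  simpa using h1

theorem psi_faint (h : Psi M) : OrdFaintDefE (M := M) Mdl.E := by
  intro k φ p hE ξ oξ
  obtain ⟨r, hr⟩ := inD_fin p
  obtain ⟨κ, oκ, hξ, hS⟩ := h r ξ oξ
  by_contra hn
  have hp : ∀ i, InC (InD r) (p i) := fun i => ⟨hr i⟩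
  have i1 := fun (t s : (ℕ → M) → M) [ht : DfT (InD r) t] [hs : DfT (InD r) s] => df_real2 (C := InD r) φ p hp (t := t) (s := s)
  have i1' := fun (t s : (ℕ → M) → M) [ht : DfT Any t] [hs : DfT Any s] => df_real2 (C := Any) φ p (fun i => inferInstance) (t := t) (s := s)
  have i2 : InC (InD r) κ := ⟨inD_ord oκ⟩
  let Q : M → Prop := fun z => ∃ a A, a ∊ κ ∧ z = pair a A ∧ Realize Mdl.E φ (Fin.cons a (Fin.cons A p))
  have hQd : Df Any (fun v => Q (v 0)) :=
    inferInstanceAs (Df Any (fun v : ℕ → M => ∃ a A, a ∊ κ ∧ v 0 = pair a A ∧ Realize Mdl.E φ (Fin.cons a (Fin.cons A p))))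
  have hQd' : Df (InD r) (fun v => Q (v 0)) :=
    inferInstanceAs (Df (InD r) (fun v : ℕ → M => ∃ a A, a ∊ κ ∧ v 0 = pair a A ∧ Realize Mdl.E φ (Fin.cons a (Fin.cons A p))))
  have hQ : IsSet Q := by
    refine isSet_of_bound (prod κ (pow κ)) Q fun z hz => ?_
    obtain ⟨a, A, ha, rfl, hA⟩ := hz
    rw [mem_prod, mem_pow]
    exact ⟨ha, sub_trans ((hE a (oκ.mem ha)).2 A hA) (oκ.sub ha)⟩
  have hD : InD r (mk Q) := inD_mk Q inferInstance hQ
  have hm : ∀ a A, pair a A ∊ mk Q ↔ a ∊ κ ∧ Realize Mdl.E φ (Fin.cons a (Fin.cons A p)) := by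
    intro a A
    rw [mem_mk hQ]
    constructor
    · rintro ⟨a', A', h1, h2, h3⟩
      obtain ⟨rfl, rfl⟩ := pair_inj.1 h2
      exact ⟨h1, h3⟩
    · rintro ⟨h1, h2⟩; exact ⟨a, A, h1, rfl, h2⟩
  refine hS _ hD ⟨fun a ha => ?_, fun a b A h1 h2 h3 h4 h5 => hn ?_⟩
  · obtain ⟨⟨A, hA⟩, h2⟩ := hE a (oκ.mem ha)
    exact ⟨⟨A, (hm _ _).2 ⟨ha, hA⟩⟩, fun A hA => h2 A ((hm _ _).1 hA).2⟩
  · rw [hm] at h4 h5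
    exact ⟨a, b, A, cap A a, oκ.mem h5.1, oκ.mem h4.1, h1, h2, h4.2, (interE_iff _ _ _).2 rfl, h5.2⟩

theorem faint_apply (hf : OrdFaintDefE (M := M) Mdl.E) (F : M → M → Prop) (hF : Df Any (fun v => F (v 0) (v 1))) :
    FaintForE Mdl.E F := by
  obtain ⟨k, φ, p, h⟩ := tr2 F hF
  have := hf k φ p
  have e : (fun α A => Realize Mdl.E φ (Fin.cons α (Fin.cons A p))) = F := by
    funext a A; exact propext (h a A)
  rwa [e] at this

theorem subtle_apply (hf : OrdSubtleDefE (M := M) Mdl.E) (F : M → M → Prop) (hF : Df Any (fun v => F (v 0) (v 1)))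
    (P : M → Prop) (hP : Df Any (fun v => P (v 0))) : SubtleForE Mdl.E F P := by
  obtain ⟨k, φ, p, h⟩ := tr2 F hF
  obtain ⟨k', ψ, q, h'⟩ := tr1 P hP
  have := hf k k' φ p ψ q
  have e : (fun α A => Realize Mdl.E φ (Fin.cons α (Fin.cons A p))) = F := by
    funext a A; exact propext (h a A)
  have e' : (fun α => Realize Mdl.E ψ (Fin.cons α q)) = P := by
    funext a; exact propext (h' a)
  rwa [e, e'] at this

theorem faint_subtle (hf : OrdFaintDefE (M := M) Mdl.E) (hn : ¬ Psi M) : OrdSubtleDefE (M := M) Mdl.E := by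
  intro k k' φ p ψ q hE hC
  unfold Psi at hn
  push Not at hn
  obtain ⟨r, ξ, oξ, hr⟩ := hn
  by_contra hno
  have i1 := fun (t s : (ℕ → M) → M) [ht : DfT Any t] [hs : DfT Any s] => df_real2 (C := Any) φ p (fun i => inferInstance) (t := t) (s := s)
  have i2 := fun (t : (ℕ → M) → M) [ht : DfT Any t] => df_real1 (C := Any) ψ q (fun i => inferInstance) (t := t)
  let P : M → Prop := fun x => Realize Mdl.E ψ (Fin.cons x q)
  let F : M → M → Prop := fun a A => Realize Mdl.E φ (Fin.cons a (Fin.cons A p))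
  have iP : ∀ (t : (ℕ → M) → M) [DfT Any t], Df Any (fun v => P (t v)) := fun t ht => i2 t
  have iF : ∀ (t s : (ℕ → M) → M) [DfT Any t] [DfT Any s], Df Any (fun v => F (t v) (s v)) := fun t s ht hs => i1 t s
  have hP0 : Df Any (fun v => P (v 0)) := iP _
  have iK := fun (t : (ℕ → M) → M) [ht : DfT Any t] => df_kc P (t := t)
  have iN := fun (t : (ℕ → M) → M) [ht : DfT Any t] => df_nx P (t := t)
  change ∀ α, Od α → (∃ A, F α A) ∧ ∀ A, F α A → A ⊑ α at hE
  change ClubClassE Mdl.E P at hC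
  have hno : ∀ a b A, P a → P b → a ∊ b → F b A → ¬ F a (cap A a) := fun a b A h1 h2 h3 h4 h5 =>
    hno ⟨a, b, A, _, h1, h2, h3, h4, (interE_iff _ _ _).2 rfl, h5⟩
  let W : M → M := fun κ => enu r (lst (fun i => Bad ξ κ (enu r i)))
  have hW : ∀ κ, Od κ → ξ ∊ κ → Bad ξ κ (W κ) := by
    intro κ oκ hκ
    obtain ⟨S, hS, hB⟩ := hr κ oκ hκ
    obtain ⟨i, oi, rfl⟩ := enu_spec hS
    exact (lst_spec (fun i => Bad ξ κ (enu r i)) ⟨i, oi, hB⟩).2.1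
  let T : M → M → Prop := fun a B => (P a ∧ F a B) ∨ (¬ P a ∧ pair a B ∊ W (nx P a))
  have hnx : ∀ a, Od a → Od (nx P a) ∧ a ∊ nx P a := by
    intro a oa
    obtain ⟨x, hx, hax⟩ := hC.2.1 a oa
    have := nx_spec P (hC.1 x hx) hx hax
    exact ⟨this.1, this.2.2.1⟩
  have hT : ∀ a, Od a → ξ ∊ a → (∃ B, T a B) ∧ ∀ B, T a B → B ⊑ a := by
    intro a oa ha
    by_cases h : P a
    · obtain ⟨⟨A, hA⟩, h2⟩ := hE a oa
      exact ⟨⟨A, .inl ⟨h, hA⟩⟩, fun B hB => h2 B (hB.resolve_right fun h' => h'.1 h).2⟩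
    · obtain ⟨o1, h1⟩ := hnx a oa
      obtain ⟨⟨A, hA⟩, h2⟩ := (hW _ o1 (o1.tr h1 ha)).1 a h1
      exact ⟨⟨A, .inr ⟨h, hA⟩⟩, fun B hB => h2 B (hB.resolve_left fun h' => h h'.1).2⟩
  let G : M → M → Prop := fun a A => (succ ξ ∊ a ∧ ∃ B, T a B ∧ A = cd a (kc P a) B) ∨ (¬ succ ξ ∊ a ∧ A = emp)
  have hG : Df Any (fun v => G (v 0) (v 1)) := by
    have iW : ∀ (t : (ℕ → M) → M) [DfT Any t], DfT Any (fun v => W (t v)) := fun t ht =>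
      DfT.sub1 (f := W) (inferInstanceAs (DfT Any (fun v : ℕ → M => enu r (lst (fun i => Bad ξ (v 0) (enu r i)))))) ht
    have iT : ∀ (t s : (ℕ → M) → M) [DfT Any t] [DfT Any s], Df Any (fun v => T (t v) (s v)) := by
      intro t s ht hs; exact Df.or (P := fun v => P (t v) ∧ F (t v) (s v))
    exact Df.or (P := fun v => succ ξ ∊ v 0 ∧ ∃ B, T (v 0) B ∧ v 1 = cd (v 0) (kc P (v 0)) B)
  have hk : ∀ a, Lim a → kc P a ∊ a := fun a ha => kc_lt P ha (hC.2.2 a ha.1 ha.2.1)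
  have key := faint_apply hf G hG ?_ (succ ξ) oξ.succ
  · obtain ⟨a, b, A, B, oa, ob, h1, h2, hb, he, ha⟩ := key
    rw [interE_iff] at he
    rcases ha with ⟨_, Ba, hTa, rfl⟩ | ⟨h, _⟩
    swap; · exact h h1
    rcases hb with ⟨_, Bb, hTb, rfl⟩ | ⟨h, _⟩
    swap; · exact h (ob.tr h2 h1)
    have hξa : ξ ∊ a := oa.tr h1 (by simp)
    have hξb : ξ ∊ b := ob.tr h2 hξa
    obtain ⟨la, lb, ek, eB⟩ := cd_core oa ob (by simp : ξ ∊ succ ξ) h1 h2 (hk a) (kc_ord P oa) (kc_ord P ob)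
      ((hT a oa hξa).2 _ hTa) ((hT b ob hξb).2 _ hTb) he.symm
    rcases kc_eq P oa ob h2 ek with ⟨p1, p2⟩ | ⟨p1, p2, p3⟩
    · have f1 := (hTa.resolve_right fun h' => h'.1 p1).2
      have f2 := (hTb.resolve_right fun h' => h'.1 p2).2
      exact hno a b Bb p1 p2 h2 f2 (eB ▸ f1)
    · have f1 := (hTa.resolve_left fun h' => p1 h'.1).2
      have f2 := (hTb.resolve_left fun h' => p2 h'.1).2
      rw [nx_eq P p3, ← eB] at f1
      obtain ⟨o1, h3⟩ := hnx b ob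
      exact (hW _ o1 (o1.tr h3 hξb)).2 a b Bb hξa h2 h3 f2 f1
  · intro a oa
    by_cases h : succ ξ ∊ a
    · have hξa : ξ ∊ a := oa.tr h (by simp)
      obtain ⟨⟨B, hB⟩, h2⟩ := hT a oa hξa
      refine ⟨⟨_, .inl ⟨h, B, hB, rfl⟩⟩, ?_⟩
      rintro A (⟨_, B, hB, rfl⟩ | ⟨h', _⟩)
      · exact cd_sub oa h (hk a) (h2 B hB)
      · exact (h' h).elim
    · refine ⟨⟨emp, .inr ⟨h, rfl⟩⟩, ?_⟩
      rintro A (⟨h', _⟩ | ⟨_, rfl⟩)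
      · exact (h h').elim
      · intro z hz; exact (mem_emp _ hz).elim

end S8
end Paper

set_option linter.all false
namespace Paper
section S9
variable {M : Type} [Mdl M] {C : M → Prop}

def BadF (ξ δ f : M) : Prop :=
  (∀ a, a ∊ δ → app f a ⊑ a) ∧ ∀ a b, ξ ∊ a → a ∊ b → b ∊ δ → cap (app f b) a ≠ app f a
instance iP_BadF {t s u : (ℕ → M) → M} [ht : DfT C t] [hs : DfT C s] [hu : DfT C u] :
    Df C (fun v => BadF (t v) (s v) (u v)) := by
  refine Df.sub3 (P := BadF) ?_ ht hs hu
  unfold BadF; infer_instance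

theorem emp_sub (a : M) : emp ⊑ a := fun z hz => (mem_emp _ hz).elim

theorem glueF {w ξ δ : M} (oδ : Od δ) (hw : w ∊ ξ) (K t : M → M) [hK : DfT Any (fun v => K (v 0))]
    [ht : DfT Any (fun v => t (v 0))]
    (h1 : ∀ a, a ∊ δ → ξ ∊ a → Od (K a) ∧ (Lim a → K a ∊ a) ∧ t a ⊑ a)
    (h2 : ∀ a b, ξ ∊ a → a ∊ b → b ∊ δ → Lim a → Lim b → K a = K b → cap (t b) a ≠ t a) :
    ∃ f, BadF ξ δ f := by
  classical
  have iK : ∀ (s : (ℕ → M) → M) [DfT Any s], DfT Any (fun v => K (s v)) := fun s hs => hK.sub1 hs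
  have iT : ∀ (s : (ℕ → M) → M) [DfT Any s], DfT Any (fun v => t (s v)) := fun s hs => ht.sub1 hs
  let F : M → M := fun a => if ξ ∊ a then cd a (K a) (t a) else emp
  have iF : DfT Any (fun v => F (v 0)) :=
    inferInstanceAs (DfT Any (fun v : ℕ → M => if ξ ∊ v 0 then cd (v 0) (K (v 0)) (t (v 0)) else emp))
  refine ⟨gr δ F, fun a ha => ?_, fun a b ha hab hb => ?_⟩
  · rw [app_gr ha]
    by_cases h : ξ ∊ a
    · simp only [F, if_pos h]
      obtain ⟨_, h3, h4⟩ := h1 a ha h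
      exact cd_sub (oδ.mem ha) h h3 h4
    · simp only [F, if_neg h]; exact emp_sub a
  · have haδ : a ∊ δ := oδ.tr hb hab
    have oa := oδ.mem haδ
    have ob := oδ.mem hb
    have hb' : ξ ∊ b := ob.tr hab ha
    rw [app_gr haδ, app_gr hb]
    simp only [F, if_pos ha, if_pos hb']
    intro e
    obtain ⟨p1, p2, p3⟩ := h1 a haδ ha
    obtain ⟨q1, q2, q3⟩ := h1 b hb hb'
    obtain ⟨la, lb, ek, eB⟩ := cd_core oa ob hw ha hab p2 p1 q1 p3 q3 e
    exact h2 a b ha hab hb la lb ek eB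

theorem matet {ξ : M} (oξ : Od ξ) (hω : (omega : M) ⊑ ξ) (hns : ∀ κ, ξ ∊ κ → ¬ SubtleE Mdl.E κ) :
    ∀ δ : M, Od δ → ∃ f, BadF ξ δ f := by
  classical
  have hw : (emp : M) ∊ ξ := hω _ (lim_emp omega_lim)
  refine ord_ind (fun δ : M => ∃ f, BadF ξ δ f) fun δ oδ ih => ?_
  obtain ⟨W, hW, hW'⟩ := choice δ (fun γ f => BadF ξ γ f) ih
  rcases ord_le_or_lt oδ oξ with hle | hlt
  · refine ⟨emp, fun a ha z hz => ?_, fun a b h1 h2 h3 => ?_⟩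
    · have : app (emp : M) a = emp := sext fun z => by
        rw [app, mem_mk (isSet_app _ _)]; simp
      rw [this] at hz; exact (mem_emp _ hz).elim
    · exact (mem_asymm (oξ.tr (hle _ h3) h2) h1).elim
  rcases ord_zero_succ_lim oδ with rfl | ⟨d, od, rfl⟩ | hlim
  · exact (mem_emp _ hlt).elim
  · -- successor
    have hd : d ∊ succ d := by simp
    refine glueF oδ hw (fun a => if a = d then succ emp else emp)
      (fun a => if a = d then emp else app (app W d) a) ?_ ?_
    · intro a ha hξ
      by_cases e : a = d
      · simp only [if_pos e]
        exact ⟨ord_emp.succ, fun l => lim_succ l (lim_emp l), emp_sub _⟩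
      · simp only [if_neg e]
        refine ⟨ord_emp, fun l => lim_emp l, (hW' d hd).1 a ?_⟩
        exact ((mem_succ _ _).1 ha).resolve_right e
    · intro a b hξ hab hb la lb ek
      have hs' : ∀ a : M, succ a ≠ emp := fun a e => mem_emp a (by rw [← e]; simp)
      have hs : (succ emp : M) ≠ emp := hs' _
      have hbd : b = d ∨ b ∊ d := ((mem_succ _ _).1 hb).symm
      have ha : a ∊ d := by
        rcases hbd with rfl | h
        · exact hab
        · exact od.tr h hab
      have ha' : a ≠ d := by rintro rfl; exact mem_irrefl _ ha
      by_cases e : b = d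
      · rw [if_pos e, if_neg ha'] at ek
        exact (hs ek.symm).elim
      · rw [if_neg e, if_neg ha']
        exact (hW' d hd).2 a b hξ hab (hbd.resolve_left e)
  · by_cases hcard : CardE Mdl.E δ
    · -- cardinal
      have hinf : InfCardE Mdl.E δ := ⟨hcard, oδ, omega, (omegaE_iff _).2 rfl,
        .inl (ord_lt_of_le_lt omega_ord oδ hω hlt)⟩
      have := hns δ hlt
      unfold SubtleE at this
      push Not at this
      obtain ⟨f, hf, c, hc, hno⟩ := this hinf
      have hf' : ∀ a, a ∊ δ → pair a (app f a) ∊ f ∧ app f a ⊑ a := by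
        intro a ha
        obtain ⟨⟨A, hA, hs⟩, hu⟩ := hf a ha
        have : app f a = A := app_eq ((pairMemE_iff _ _ _).1 hA)
          (fun y hy => hu _ _ ((pairMemE_iff _ _ _).2 hy) hA)
        rw [this]
        exact ⟨(pairMemE_iff _ _ _).1 hA, hs⟩
      have iK := fun (t : (ℕ → M) → M) [ht : DfT Any t] => df_kc (fun x : M => x ∊ c) (t := t)
      have iN := fun (t : (ℕ → M) → M) [ht : DfT Any t] => df_nx (fun x : M => x ∊ c) (t := t)
      have hnx : ∀ a, a ∊ δ → a ∊ nx (fun x : M => x ∊ c) a ∧ nx (fun x : M => x ∊ c) a ∊ δ := by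
        intro a ha
        obtain ⟨x, hx, hax⟩ := hc.2.1 a ha
        have hxδ := hc.1 x hx
        obtain ⟨h1, h2, h3, h4⟩ := nx_spec (fun x : M => x ∊ c) (oδ.mem hxδ) hx hax
        exact ⟨h3, ord_lt_of_le_lt h1 oδ h4 hxδ⟩
      refine glueF oδ hw (kc (fun x => x ∊ c))
        (fun a => if a ∊ c then app f a else app (app W (nx (fun x => x ∊ c) a)) a) ?_ ?_
      · intro a ha hξ
        refine ⟨kc_ord _ (oδ.mem ha), fun l => kc_lt _ l fun h => hc.2.2 a ha ⟨ξ, hξ⟩ h, ?_⟩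
        by_cases h : a ∊ c
        · simp only [if_pos h]; exact (hf' a ha).2
        · simp only [if_neg h]
          obtain ⟨h1, h2⟩ := hnx a ha
          exact (hW' _ h2).1 a h1
      · intro a b hξ hab hb la lb ek
        have ha := oδ.tr hb hab
        rcases kc_eq (fun x : M => x ∊ c) la.1 lb.1 hab ek with ⟨p1, p2⟩ | ⟨p1, p2, p3⟩
        · rw [if_pos p1, if_pos p2]
          intro e
          exact hno a b p1 p2 hab _ _ ((pairMemE_iff _ _ _).2 (hf' a ha).1)
            ((pairMemE_iff _ _ _).2 (hf' b hb).1) ((interE_iff _ _ _).2 e.symm)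
        · rw [if_neg p1, if_neg p2, nx_eq (fun x : M => x ∊ c) p3]
          obtain ⟨h1, h2⟩ := hnx b hb
          exact (hW' _ h2).2 a b hξ hab h1
    · -- not a cardinal
      have : ∃ γ, γ ∊ δ ∧ ∃ f, BijE Mdl.E f γ δ := by
        by_contra h; push Not at h
        exact hcard ⟨oδ, fun α hα ⟨f, hf⟩ => h α hα f hf⟩
      obtain ⟨γ, hγ, g, hg, _⟩ := this
      have oγ := oδ.mem hγ
      have hgv : ∀ x y, x ∊ γ → pair x y ∊ g → app g x = y := fun x y hx h => app_eq h fun y' h' =>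
        (hg.1.2 x hx).2 _ _ ((pairMemE_iff _ _ _).2 h') ((pairMemE_iff _ _ _).2 h)
      have hgδ : ∀ x, x ∊ γ → app g x ∊ δ := by
        intro x hx
        obtain ⟨y, hy⟩ := (hg.1.2 x hx).1
        rw [pairMemE_iff] at hy
        rw [hgv x y hx hy]
        obtain ⟨x', y', hx', hy', e⟩ := hg.1.1 _ hy
        rw [oPairE_iff, pair_inj] at e
        rw [e.2]; exact hy'
      let I : M → M := fun a => lst (fun j => j ∊ γ ∧ a ⊑ app g j)
      have iI : ∀ (t : (ℕ → M) → M) [DfT Any t], DfT Any (fun v => I (t v)) := fun t ht =>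
        DfT.sub1 (f := I) (inferInstanceAs (DfT Any (fun v : ℕ → M => lst (fun j => j ∊ γ ∧ v 0 ⊑ app g j)))) ht
      have hI : ∀ a, a ∊ δ → I a ∊ γ ∧ a ⊑ app g (I a) := by
        intro a ha
        obtain ⟨x, hx, hxa⟩ := hg.2 a ha
        rw [pairMemE_iff] at hxa
        have := hgv x a hx hxa
        exact (lst_spec (fun j => j ∊ γ ∧ a ⊑ app g j) ⟨x, oγ.mem hx, hx, by rw [this]; exact sub_refl _⟩).2.1
      have hs : ∀ a : M, succ a ≠ emp := fun a e => mem_emp a (by rw [← e]; simp)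
      refine glueF oδ hw (fun a => if a ⊑ γ then emp else succ (I a))
        (fun a => if a ⊑ γ then app (app W (succ γ)) a else app (app W (succ (app g (I a)))) a) ?_ ?_
      · intro a ha hξ
        have oa := oδ.mem ha
        by_cases h : a ⊑ γ
        · simp only [if_pos h]
          exact ⟨ord_emp, fun l => lim_emp l, (hW' _ (lim_succ hlim hγ)).1 a ((ord_lt_succ oa oγ).2 h)⟩
        · simp only [if_neg h]
          obtain ⟨h1, h2⟩ := hI a ha
          refine ⟨(oγ.mem h1).succ, fun l => lim_succ l ?_, ?_⟩
          · exact oa.tr ((ord_le_or_lt oa oγ).resolve_left h) h1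
          · have h3 := hgδ _ h1
            exact (hW' _ (lim_succ hlim h3)).1 a ((ord_lt_succ oa (oδ.mem h3)).2 h2)
      · intro a b hξ hab hb la lb ek
        have ha := oδ.tr hb hab
        have oa := la.1
        have ob := lb.1
        by_cases h : a ⊑ γ <;> by_cases h' : b ⊑ γ
        · rw [if_pos h, if_pos h']
          exact (hW' _ (lim_succ hlim hγ)).2 a b hξ hab ((ord_lt_succ ob oγ).2 h')
        · rw [if_pos h, if_neg h'] at ek; exact (hs _ ek.symm).elim
        · rw [if_neg h, if_pos h'] at ek; exact (hs _ ek).elim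
        · rw [if_neg h, if_neg h'] at ek
          rw [if_neg h, if_neg h', succ_inj ek]
          obtain ⟨h1, h2⟩ := hI b hb
          have h3 := hgδ _ h1
          exact (hW' _ (lim_succ hlim h3)).2 a b hξ hab ((ord_lt_succ ob (oδ.mem h3)).2 h2)

theorem bad_of_badF {ξ δ f : M} (oδ : Od δ) (h : BadF ξ δ f) : Bad ξ δ (gr δ (fun a => app f a)) := by
  refine ⟨fun a ha => ⟨⟨app f a, (mem_gr _ _ _ _).2 ⟨ha, rfl⟩⟩, fun A hA => ?_⟩, fun a b A h1 h2 h3 h4 h5 => ?_⟩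
  · rw [((mem_gr _ _ _ _).1 hA).2]; exact h.1 a ha
  · have e1 := ((mem_gr _ _ _ _).1 h4).2
    have e2 := ((mem_gr _ _ _ _).1 h5).2
    rw [e1] at e2
    exact h.2 a b h1 h2 h3 e2

end S9
end Paper

set_option linter.all false
namespace Paper
section S10
variable {M : Type} [Mdl M] {C : M → Prop}

abbrev ES (S : M → Prop) : {x : M // S x} → {x : M // S x} → Prop := fun a b => a.1 ∊ b.1

structure Inner (S : M → Prop) : Prop where
  tr : ∀ x, S x → ∀ y, y ∊ x → S y
  om : S omega
  upr : ∀ a b, S a → S b → S (upair a b)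
  uni : ∀ a, S a → S (un a)
  pw : ∀ a, S a → ∃ p, S p ∧ ∀ z, S z → (z ∊ p ↔ z ⊑ a)
  sp : ∀ (k : ℕ) (φ : SetFormula (k + 1)) (p : Fin k → M), (∀ i, S (p i)) → ∀ a, S a →
    ∃ s, S s ∧ ∀ z, S z → (z ∊ s ↔ z ∊ a ∧ RelR S φ (Fin.cons z p))
  rp : ∀ (k : ℕ) (φ : SetFormula (k + 2)) (p : Fin k → M), (∀ i, S (p i)) → ∀ a, S a →
    (∀ x, x ∊ a → ∀ y y', S y → S y' → RelR S φ (Fin.cons x (Fin.cons y p)) →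
      RelR S φ (Fin.cons x (Fin.cons y' p)) → y = y') →
    ∃ b, S b ∧ ∀ y, S y → (y ∊ b ↔ ∃ x, x ∊ a ∧ RelR S φ (Fin.cons x (Fin.cons y p)))
  ch : ∀ a, S a → (∀ x, x ∊ a → ∃ z, z ∊ x) →
    (∀ x y, x ∊ a → y ∊ a → x ≠ y → ¬ ∃ z, z ∊ x ∧ z ∊ y) →
    ∃ c, S c ∧ ∀ x, x ∊ a → ∃ z, z ∊ c ∧ z ∊ x ∧ ∀ z', z' ∊ c → z' ∊ x → z' = z

section abs

theorem abs_sub {S : M → Prop} (tr : ∀ x, S x → ∀ y, y ∊ x → S y) (a b : {x // S x}) : SubE (ES S) a b ↔ a.1 ⊑ b.1 :=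
  ⟨fun h z hz => h ⟨z, tr _ a.2 z hz⟩ hz, fun h z hz => h z.1 hz⟩

theorem abs_trans {S : M → Prop} (tr : ∀ x, S x → ∀ y, y ∊ x → S y) (a : {x // S x}) : TransE (ES S) a ↔ TransE Mdl.E a.1 :=
  ⟨fun h y hy z hz => h ⟨y, tr _ a.2 y hy⟩ hy ⟨z, tr _ (tr _ a.2 y hy) z hz⟩ hz,
    fun h y hy z hz => h y.1 hy z.1 hz⟩

theorem abs_ord {S : M → Prop} (tr : ∀ x, S x → ∀ y, y ∊ x → S y) (a : {x // S x}) : OrdE (ES S) a ↔ Od a.1 := by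
  unfold OrdE
  rw [abs_trans tr]
  refine and_congr_right fun _ => ⟨fun h y hy => (abs_trans tr ⟨y, tr _ a.2 y hy⟩).1 (h _ hy),
    fun h y hy => (abs_trans tr y).2 (h _ hy)⟩

theorem abs_inter {S : M → Prop} (tr : ∀ x, S x → ∀ y, y ∊ x → S y) (b a c : {x // S x}) : InterSpecE (ES S) b a c ↔ InterSpecE Mdl.E b.1 a.1 c.1 :=
  ⟨fun h z => ⟨fun hz => (h ⟨z, tr _ b.2 z hz⟩).1 hz, fun hz => (h ⟨z, tr _ a.2 z hz.1⟩).2 hz⟩,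
    fun h z => h z.1⟩

theorem abs_upair {S : M → Prop} (tr : ∀ x, S x → ∀ y, y ∊ x → S y) (p a b : {x // S x}) : UPairE (ES S) p a b ↔ UPairE Mdl.E p.1 a.1 b.1 := by
  constructor
  · intro h z
    constructor
    · intro hz
      exact ((h ⟨z, tr _ p.2 z hz⟩).1 hz).imp (fun e => congrArg Subtype.val e) (fun e => congrArg Subtype.val e)
    · rintro (rfl | rfl)
      · exact (h a).2 (.inl rfl)
      · exact (h b).2 (.inr rfl)
  · intro h z
    exact (h z.1).trans (or_congr ⟨fun e => Subtype.ext e, fun e => congrArg _ e⟩ ⟨fun e => Subtype.ext e, fun e => congrArg _ e⟩)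

theorem abs_opair {S : M → Prop} (tr : ∀ x, S x → ∀ y, y ∊ x → S y) (p a b : {x // S x}) : OPairE (ES S) p a b ↔ OPairE Mdl.E p.1 a.1 b.1 := by
  constructor
  · rintro ⟨s, t, h1, h2, h3⟩
    exact ⟨s.1, t.1, (abs_upair tr _ _ _).1 h1, (abs_upair tr _ _ _).1 h2, (abs_upair tr _ _ _).1 h3⟩
  · rintro ⟨s, t, h1, h2, h3⟩
    have hs : S s := tr _ p.2 s ((h3 s).2 (.inl rfl))
    have ht : S t := tr _ p.2 t ((h3 t).2 (.inr rfl))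
    exact ⟨⟨s, hs⟩, ⟨t, ht⟩, (abs_upair tr _ _ _).2 h1, (abs_upair tr _ _ _).2 h2, (abs_upair tr _ _ _).2 h3⟩

theorem abs_pairMem {S : M → Prop} (tr : ∀ x, S x → ∀ y, y ∊ x → S y) (f a b : {x // S x}) : PairMemE (ES S) f a b ↔ PairMemE Mdl.E f.1 a.1 b.1 := by
  constructor
  · rintro ⟨p, h1, h2⟩
    exact ⟨p.1, h1, (abs_opair tr _ _ _).1 h2⟩
  · rintro ⟨p, h1, h2⟩
    exact ⟨⟨p, tr _ f.2 p h1⟩, h1, (abs_opair tr ⟨p, tr _ f.2 p h1⟩ _ _).2 h2⟩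

theorem tr_pair {S : M → Prop} (tr : ∀ x, S x → ∀ y, y ∊ x → S y) {f x y : M} (hf : S f) (h : pair x y ∊ f) : S x ∧ S y := by
  have h1 := tr _ hf _ h
  have h2 : S (upair x y) := tr _ h1 _ (by simp [pair])
  exact ⟨tr _ h2 _ (by simp), tr _ h2 _ (by simp)⟩

theorem abs_limit {S : M → Prop} (tr : ∀ x, S x → ∀ y, y ∊ x → S y) (a : {x // S x}) : LimitE (ES S) a ↔ Lim a.1 := by
  unfold LimitE
  rw [abs_ord tr]
  refine and_congr_right fun oa => and_congr ?_ ?_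
  · exact ⟨fun ⟨w, h⟩ => ⟨w.1, h⟩, fun ⟨w, h⟩ => ⟨⟨w, tr _ a.2 w h⟩, h⟩⟩
  · exact ⟨fun h x hx => (h ⟨x, tr _ a.2 x hx⟩ hx).elim fun b hb => ⟨b.1, hb⟩,
      fun h x hx => (h x.1 hx).elim fun b hb => ⟨⟨b, tr _ a.2 b hb.1⟩, hb⟩⟩

theorem abs_omega {S : M → Prop} (tr : ∀ x, S x → ∀ y, y ∊ x → S y) (a : {x // S x}) : OmegaSpecE (ES S) a ↔ a.1 = omega := by
  rw [← omegaE_iff]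
  unfold OmegaSpecE
  rw [abs_limit tr]
  refine and_congr_right fun _ => ⟨fun h x hx hl => h ⟨x, tr _ a.2 x hx⟩ hx ((abs_limit tr _).2 hl),
    fun h x hx hl => h x.1 hx ((abs_limit tr _).1 hl)⟩
end abs

theorem comp_cons {S : M → Prop} {k : ℕ} (z : {x // S x}) (p : Fin k → {x // S x}) :
    (fun i => ((Fin.cons z p : Fin (k+1) → {x // S x}) i).1) = Fin.cons z.1 (fun i => (p i).1) := by
  funext i; refine Fin.cases ?_ (fun i => ?_) i <;> rfl

theorem real_c1 {S : M → Prop} {k : ℕ} (φ : SetFormula (k+1)) (z : {x // S x}) (p : Fin k → {x // S x}) :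
    Realize (ES S) φ (Fin.cons z p) ↔ RelR S φ (Fin.cons z.1 (fun i => (p i).1)) := by
  refine (realize_sub S φ _).trans ?_
  rw [comp_cons]

theorem real_c2 {S : M → Prop} {k : ℕ} (φ : SetFormula (k+2)) (z y : {x // S x}) (p : Fin k → {x // S x}) :
    Realize (ES S) φ (Fin.cons z (Fin.cons y p)) ↔ RelR S φ (Fin.cons z.1 (Fin.cons y.1 (fun i => (p i).1))) := by
  refine (realize_sub S φ _).trans ?_
  rw [comp_cons, comp_cons]

theorem Inner.zfc {S : M → Prop} (h : Inner S) : IsZFCE (ES S) := by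
  have tr := h.tr
  refine ⟨⟨⟨omega, h.om⟩⟩, ⟨?_, ?_, ?_, ?_, ?_, ?_, ?_⟩, ?_, ?_⟩
  · intro x y e
    refine Subtype.ext (sext fun z => ⟨fun hz => (e ⟨z, tr _ x.2 z hz⟩).1 hz, fun hz => (e ⟨z, tr _ y.2 z hz⟩).2 hz⟩)
  · intro a b
    exact ⟨⟨_, h.upr _ _ a.2 b.2⟩, (abs_upair tr _ _ _).2 ((upairE_iff _ _ _).2 rfl)⟩
  · intro a
    refine ⟨⟨_, h.uni _ a.2⟩, fun z => ?_⟩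
    change z.1 ∊ un a.1 ↔ _
    rw [mem_un]
    exact ⟨fun ⟨y, hy, hz⟩ => ⟨⟨y, tr _ a.2 y hy⟩, hy, hz⟩, fun ⟨y, hy, hz⟩ => ⟨y.1, hy, hz⟩⟩
  · refine ⟨⟨omega, h.om⟩, ⟨⟨emp, tr _ h.om _ (lim_emp omega_lim)⟩, lim_emp omega_lim, fun z hz => mem_emp _ hz⟩, ?_⟩
    intro y hy
    have hs := lim_succ omega_lim hy
    refine ⟨⟨succ y.1, tr _ h.om _ hs⟩, hs, fun z => ?_⟩
    exact (mem_succ _ _).trans (or_congr_right ⟨fun e => Subtype.ext e, fun e => congrArg _ e⟩)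
  · rintro a ⟨z, hz⟩
    obtain ⟨m, hm, hm'⟩ := found hz
    exact ⟨⟨m, tr _ a.2 m hm⟩, hm, fun z hz => hm' z.1 hz⟩
  · intro k φ p a
    obtain ⟨s, hs, h'⟩ := h.sp k φ (fun i => (p i).1) (fun i => (p i).2) a.1 a.2
    refine ⟨⟨s, hs⟩, fun z => ?_⟩
    rw [real_c1]
    exact h' z.1 z.2
  · intro k φ p a hf
    obtain ⟨s, hs, h'⟩ := h.rp k φ (fun i => (p i).1) (fun i => (p i).2) a.1 a.2 (by
      intro x hx y y' hy hy' h1 h2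
      have := hf ⟨x, tr _ a.2 x hx⟩ hx ⟨y, hy⟩ ⟨y', hy'⟩ ((real_c2 _ _ _ _).2 h1) ((real_c2 _ _ _ _).2 h2)
      exact congrArg Subtype.val this)
    refine ⟨⟨s, hs⟩, fun y => (h' y.1 y.2).trans ?_⟩
    constructor
    · rintro ⟨x, hx, h1⟩
      exact ⟨⟨x, tr _ a.2 x hx⟩, hx, (real_c2 _ _ _ _).2 h1⟩
    · rintro ⟨x, hx, h1⟩
      exact ⟨x.1, hx, (real_c2 _ _ _ _).1 h1⟩
  · intro a
    obtain ⟨p, hp, h'⟩ := h.pw a.1 a.2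
    refine ⟨⟨p, hp⟩, fun z => ?_⟩
    rw [abs_sub tr]; exact h' z.1 z.2
  · intro a h1 h2
    obtain ⟨c, hc, h'⟩ := h.ch a.1 a.2
      (fun x hx => (h1 ⟨x, tr _ a.2 x hx⟩ hx).elim fun z hz => ⟨z.1, hz⟩)
      (fun x y hx hy hne ⟨z, hz1, hz2⟩ => h2 ⟨x, tr _ a.2 x hx⟩ ⟨y, tr _ a.2 y hy⟩ hx hy
        (fun e => hne (congrArg Subtype.val e)) ⟨⟨z, tr _ (tr _ a.2 x hx) z hz1⟩, hz1, hz2⟩)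
    refine ⟨⟨c, hc⟩, fun x hx => ?_⟩
    obtain ⟨z, hz, hzx, hu⟩ := h' x.1 hx
    exact ⟨⟨z, tr _ hc z hz⟩, hz, hzx, fun z' h1 h2 => Subtype.ext (hu z'.1 h1 h2)⟩

/-! ### HOD -/
def HD (r x : M) : Prop := ∃ t, TransE Mdl.E t ∧ x ∊ t ∧ ∀ y, y ∊ t → InD r y
instance iP_HD {t s : (ℕ → M) → M} [ht : DfT C t] [hs : DfT C s] : Df C (fun v => HD (t v) (s v)) := by
  refine Df.sub2 (P := HD) ?_ ht hs
  unfold HD; infer_instance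

theorem HD.inD {r x : M} (h : HD r x) : InD r x := let ⟨t, _, h1, h2⟩ := h; h2 x h1
theorem HD.tr {r x : M} (h : HD r x) (y : M) (hy : y ∊ x) : HD r y :=
  let ⟨t, h0, h1, h2⟩ := h; ⟨t, h0, h0 x h1 y hy, h2⟩

theorem HD.of {r x : M} (h : InD r x) (hx : ∀ y, y ∊ x → HD r y) : HD r x := by
  obtain ⟨T, hT, hxT⟩ := exists_trans x
  refine ⟨cup (sep T (fun y => HD r y)) (upair x x), ?_, by simp, ?_⟩
  · intro y hy z hz
    simp only [mem_cup, mem_sep, mem_upair, or_self] at hy ⊢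
    left
    rcases hy with hy | rfl
    · exact ⟨hT y hy.1 z hz, hy.2.tr z hz⟩
    · exact ⟨hxT z hz, hx z hz⟩
  · intro y hy
    simp only [mem_cup, mem_sep, mem_upair, or_self] at hy
    rcases hy with hy | rfl
    · exact hy.2.inD
    · exact h

theorem hd_ord {r a : M} (ha : Od a) : HD r a :=
  ⟨succ a, ha.succ.1, by simp, fun y hy => inD_ord (ha.succ.mem hy)⟩

theorem df_relHD1 {r : M} [InC C r] {k : ℕ} (φ : SetFormula (k + 1)) (p : Fin k → M) (hp : ∀ i, InC C (p i))
    {t : (ℕ → M) → M} [ht : DfT C t] :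
    Df C (fun v => RelR (HD r) φ (Fin.cons (t v) p)) := by
  let T : Fin (k + 1) → (ℕ → M) → M := Fin.cons t (fun i _ => p i)
  have hT : ∀ i, DfT C (T i) := by
    intro i
    refine Fin.cases ?_ (fun i => ?_) i
    · exact ht
    · have := hp i
      exact (inferInstance : DfT C (fun _ => p i))
  refine (Df.relR (S := fun r x => HD r x) (w := fun _ => r) inferInstance inferInstance φ T hT).congr fun v => ?_
  have : (fun i => T i v) = Fin.cons (t v) p := by
    funext i
    refine Fin.cases ?_ (fun i => ?_) i <;> rfl
  rw [this]

theorem df_relHD2 {r : M} [InC C r] {k : ℕ} (φ : SetFormula (k + 2)) (p : Fin k → M) (hp : ∀ i, InC C (p i))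
    {t s : (ℕ → M) → M} [ht : DfT C t] [hs : DfT C s] :
    Df C (fun v => RelR (HD r) φ (Fin.cons (t v) (Fin.cons (s v) p))) := by
  let T : Fin (k + 2) → (ℕ → M) → M := Fin.cons t (Fin.cons s (fun i _ => p i))
  have hT : ∀ i, DfT C (T i) := by
    intro i
    refine Fin.cases ?_ (fun i => ?_) i
    · exact ht
    · refine Fin.cases ?_ (fun i => ?_) i
      · exact hs
      · have := hp i
        exact (inferInstance : DfT C (fun _ => p i))
  refine (Df.relR (S := fun r x => HD r x) (w := fun _ => r) inferInstance inferInstance φ T hT).congr fun v => ?_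
  have : (fun i => T i v) = Fin.cons (t v) (Fin.cons (s v) p) := by
    funext i
    refine Fin.cases ?_ (fun i => ?_) i
    · rfl
    · refine Fin.cases ?_ (fun i => ?_) i <;> rfl
  rw [this]

theorem hd_mk {r : M} (P : M → Prop) (h : Df (InD r) (fun v => P (v 0))) (hs : IsSet P) (hP : ∀ z, P z → HD r z) :
    HD r (mk P) := HD.of (inD_mk P h hs) fun y hy => hP y ((mem_mk hs y).1 hy)

theorem hd_inner (r : M) : Inner (HD r) where
  tr := fun x hx => hx.tr
  om := hd_ord omega_ord
  upr := fun a b ha hb => by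
    have i1 : InC (InD r) a := ⟨ha.inD⟩
    have i2 : InC (InD r) b := ⟨hb.inD⟩
    refine HD.of (inD_term _ inferInstance) fun y hy => ?_
    rcases (mem_upair _ _ _).1 hy with rfl | rfl <;> assumption
  uni := fun a ha => by
    have i1 : InC (InD r) a := ⟨ha.inD⟩
    refine HD.of (inD_term _ inferInstance) fun y hy => ?_
    obtain ⟨z, hz, hy⟩ := (mem_un _ _).1 hy
    exact (ha.tr z hz).tr y hy
  pw := fun a ha => by
    have i1 : InC (InD r) a := ⟨ha.inD⟩
    have i0 : InC (InD r) r := ⟨inD_self r⟩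
    have hs : IsSet (fun z => z ⊑ a ∧ HD r z) := isSet_of_bound (pow a) _ fun z hz => by simpa using hz.1
    refine ⟨_, hd_mk (fun z => z ⊑ a ∧ HD r z) inferInstance hs fun z hz => hz.2, fun z hz => ?_⟩
    rw [mem_mk hs]; exact and_iff_left hz
  sp := fun k φ p hp a ha => by
    have i1 : InC (InD r) a := ⟨ha.inD⟩
    have i0 : InC (InD r) r := ⟨inD_self r⟩
    have i2 := fun (t : (ℕ → M) → M) [ht : DfT (InD r) t] => df_relHD1 (C := InD r) (r := r) φ p (fun i => ⟨(hp i).inD⟩) (t := t)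
    have i3 := fun (t : (ℕ → M) → M) [ht : DfT Any t] => df_relHD1 (C := Any) (r := r) φ p (fun i => inferInstance) (t := t)
    have hs : IsSet (fun z => z ∊ a ∧ RelR (HD r) φ (Fin.cons z p)) := isSet_sep a _
    refine ⟨_, hd_mk (fun z => z ∊ a ∧ RelR (HD r) φ (Fin.cons z p)) inferInstance hs fun z hz => ha.tr z hz.1, fun z hz => ?_⟩
    rw [mem_mk hs]
  rp := fun k φ p hp a ha hf => by
    have i1 : InC (InD r) a := ⟨ha.inD⟩
    have i0 : InC (InD r) r := ⟨inD_self r⟩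
    have i2 := fun (t s : (ℕ → M) → M) [ht : DfT (InD r) t] [hs : DfT (InD r) s] => df_relHD2 (C := InD r) (r := r) φ p (fun i => ⟨(hp i).inD⟩) (t := t) (s := s)
    have i3 := fun (t s : (ℕ → M) → M) [ht : DfT Any t] [hs : DfT Any s] => df_relHD2 (C := Any) (r := r) φ p (fun i => inferInstance) (t := t) (s := s)
    obtain ⟨d, od, hd⟩ := collection a (fun x y => HD r y ∧ RelR (HD r) φ (Fin.cons x (Fin.cons y p)))
    have hs : IsSet (fun y => HD r y ∧ ∃ x, x ∊ a ∧ RelR (HD r) φ (Fin.cons x (Fin.cons y p))) := by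
      refine isSet_of_bound (V d) _ fun y hy => ?_
      obtain ⟨hy, x, hx, h⟩ := hy
      obtain ⟨y', h1, h2, h3⟩ := hd x hx ⟨y, hy, h⟩
      rw [hf x hx y y' hy h2 h h3]; exact h1
    refine ⟨_, hd_mk _ inferInstance hs fun z hz => hz.1, fun z hz => ?_⟩
    rw [mem_mk hs]; exact and_iff_right hz
  ch := fun a ha h1 h2 => by
    have i1 : InC (InD r) a := ⟨ha.inD⟩
    have i0 : InC (InD r) r := ⟨inD_self r⟩
    let F : M → M := fun x => enu r (lst (fun i => enu r i ∊ x))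
    have iF : DfT (InD r) (fun v => F (v 0)) :=
      inferInstanceAs (DfT (InD r) (fun v : ℕ → M => enu r (lst (fun i => enu r i ∊ v 0))))
    have iF' : DfT Any (fun v => F (v 0)) := iF.any
    have hF : ∀ x, x ∊ a → F x ∊ x := by
      intro x hx
      obtain ⟨z, hz⟩ := h1 x hx
      obtain ⟨i, oi, e⟩ := enu_spec ((ha.tr x hx).tr z hz).inD
      exact (lst_spec (fun i => enu r i ∊ x) ⟨i, oi, by rw [e]; exact hz⟩).2.1
    refine ⟨img a F, HD.of (inD_term _ ?_) ?_, ?_⟩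
    · exact inferInstanceAs (DfT (InD r) (fun _ : ℕ → M => img a (fun x => enu r (lst (fun i => enu r i ∊ x)))))
    · intro y hy
      obtain ⟨x, hx, rfl⟩ := (mem_img _ _ _).1 hy
      exact (ha.tr x hx).tr _ (hF x hx)
    · intro x hx
      refine ⟨F x, (mem_img _ _ _).2 ⟨x, hx, rfl⟩, hF x hx, fun z' hz' hzx => ?_⟩
      obtain ⟨x', hx', rfl⟩ := (mem_img _ _ _).1 hz'
      by_cases e : x' = x
      · rw [e]
      · exact (h2 x' x hx' hx e ⟨_, hF x' hx', hzx⟩).elim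

theorem hd_subtle (r : M) (hs : OrdSubtleDefE (M := M) Mdl.E) : OrdSubtleDefE (ES (HD r)) := by
  have tr := (hd_inner r).tr
  intro k k' φ p ψ q hE hC
  have i2 := fun (t : (ℕ → M) → M) [ht : DfT Any t] => df_relHD1 (C := Any) (r := r) ψ (fun i => (q i).1) (fun i => inferInstance) (t := t)
  have i3 := fun (t s : (ℕ → M) → M) [ht : DfT Any t] [hs : DfT Any s] => df_relHD2 (C := Any) (r := r) φ (fun i => (p i).1) (fun i => inferInstance) (t := t) (s := s)
  have := subtle_apply hs (fun a A => HD r a ∧ HD r A ∧ RelR (HD r) φ (Fin.cons a (Fin.cons A fun i => (p i).1))) inferInstance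
    (fun x => HD r x ∧ RelR (HD r) ψ (Fin.cons x fun i => (q i).1)) inferInstance ?_ ?_
  · obtain ⟨a, b, A, B, ⟨ha, ha'⟩, ⟨hb, hb'⟩, hab, ⟨_, hA, hA'⟩, he, ⟨_, hB, hB'⟩⟩ := this
    exact ⟨⟨a, ha⟩, ⟨b, hb⟩, ⟨A, hA⟩, ⟨B, hB⟩, (real_c1 _ _ _).2 ha', (real_c1 _ _ _).2 hb', hab,
      (real_c2 _ _ _ _).2 hA', (abs_inter tr _ _ _).2 he, (real_c2 _ _ _ _).2 hB'⟩
  · intro a oa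
    have ha : HD r a := hd_ord oa
    obtain ⟨⟨A, hA⟩, h2⟩ := hE ⟨a, ha⟩ ((abs_ord tr _).2 oa)
    refine ⟨⟨A.1, ha, A.2, (real_c2 _ _ _ _).1 hA⟩, ?_⟩
    rintro A ⟨_, hA, h⟩
    exact (abs_sub tr _ _).1 (h2 ⟨A, hA⟩ ((real_c2 _ _ _ _).2 h))
  · obtain ⟨h1, h2, h3⟩ := hC
    refine ⟨?_, ?_, ?_⟩
    · rintro x ⟨hx, h⟩
      exact (abs_ord tr ⟨x, hx⟩).1 (h1 _ ((real_c1 _ _ _).2 h))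
    · intro a oa
      obtain ⟨b, hb, hab⟩ := h2 ⟨a, hd_ord oa⟩ ((abs_ord tr _).2 oa)
      exact ⟨b.1, ⟨b.2, (real_c1 _ _ _).1 hb⟩, hab⟩
    · rintro l ol ⟨w, hw⟩ h
      have hl : HD r l := hd_ord ol
      refine ⟨hl, (real_c1 _ ⟨l, hl⟩ _).1 (h3 ⟨l, hl⟩ ((abs_ord tr _).2 ol) ⟨⟨w, hl.tr w hw⟩, hw⟩ ?_)⟩
      intro a ha
      obtain ⟨b, ⟨hb, hb'⟩, h4, h5⟩ := h a.1 ha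
      exact ⟨⟨b, hb⟩, (real_c1 _ _ _).2 hb', h4, h5⟩

def BadE {M : Type} (E : M → M → Prop) (ξ κ S : M) : Prop :=
  (∀ a, E a κ → (∃ A, PairMemE E S a A) ∧ ∀ A, PairMemE E S a A → SubE E A a) ∧
    ∀ a b A B, E ξ a → E a b → E b κ → PairMemE E S b A → InterSpecE E B A a → ¬ PairMemE E S a B

theorem badE_iff (ξ κ S : M) : BadE Mdl.E ξ κ S ↔ Bad ξ κ S := by
  unfold BadE Bad
  simp only [pairMemE_iff, interE_iff]
  refine and_congr_right fun _ => ⟨fun h a b A h1 h2 h3 h4 => h a b A _ h1 h2 h3 h4 rfl, ?_⟩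
  rintro h a b A B h1 h2 h3 h4 rfl
  exact h a b A h1 h2 h3 h4

theorem abs_bad {S : M → Prop} (tr : ∀ x, S x → ∀ y, y ∊ x → S y) (ξ κ f : {x // S x})
    (h : BadE (ES S) ξ κ f) : BadE Mdl.E ξ.1 κ.1 f.1 := by
  have hp : ∀ x y, PairMemE Mdl.E f.1 x y → S y := fun x y h => (tr_pair tr f.2 ((pairMemE_iff _ _ _).1 h)).2
  refine ⟨fun a ha => ?_, fun a b A B h1 h2 h3 h4 h5 h6 => ?_⟩
  · have hS := tr _ κ.2 a ha
    obtain ⟨⟨A, hA⟩, h2⟩ := h.1 ⟨a, hS⟩ ha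
    refine ⟨⟨A.1, (abs_pairMem tr _ _ _).1 hA⟩, fun A hA => ?_⟩
    exact (abs_sub tr _ _).1 (h2 ⟨A, hp _ _ hA⟩ ((abs_pairMem tr _ _ _).2 hA))
  · have sb := tr _ κ.2 b h3
    have sa := tr _ sb a h2
    exact h.2 ⟨a, sa⟩ ⟨b, sb⟩ ⟨A, hp _ _ h4⟩ ⟨B, hp _ _ h6⟩ h1 h2 h3 ((abs_pairMem tr _ _ _).2 h4)
      ((abs_inter tr _ _ _).2 h5) ((abs_pairMem tr _ _ _).2 h6)

theorem hd_pcs (r : M) (h : Psi M) : ProperClassSubtleE (ES (HD r)) := by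
  have tr := (hd_inner r).tr
  letI : Mdl {x // HD r x} := ⟨ES (HD r), (hd_inner r).zfc⟩
  intro ξ oξ
  by_contra hn
  push Not at hn
  let ξ' : {x // HD r x} := cup ξ omega
  have o' : OrdE (ES (HD r)) ξ' := ord_cup oξ omega_ord
  have hb := matet (ξ := ξ') o' (le_cup_r _ _) (fun κ hκ hs => hn κ hs ?_)
  · obtain ⟨κ, oκ, hκ, hS⟩ := h r ξ'.1 ((abs_ord tr _).1 o')
    obtain ⟨f, hf⟩ := hb ⟨κ, hd_ord oκ⟩ ((abs_ord tr _).2 oκ)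
    have h1 := (badE_iff _ _ _).2 (bad_of_badF ((abs_ord tr ⟨κ, hd_ord oκ⟩).2 oκ) hf)
    have h2 := abs_bad tr _ _ _ h1
    exact hS _ (Subtype.property (gr (⟨κ, hd_ord oκ⟩ : {x // HD r x}) (fun a => app f a))).inD ((badE_iff _ _ _).1 h2)
  · exact ord_lt_of_le_lt (M := {x // HD r x}) (a := ξ) (b := ξ') (c := κ) oξ hs.1.1.1 (le_cup_l _ _) hκ

end S10
end Paper

set_option linter.all false
namespace Paper
section S11
variable {M : Type} [Mdl M] {C : M → Prop}

def Univ (W : M) : Prop :=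
  (∀ x, x ∊ W → ∀ y, y ∊ x → y ∊ W) ∧ omega ∊ W ∧ (∀ a b, a ∊ W → b ∊ W → upair a b ∊ W) ∧
  (∀ a, a ∊ W → un a ∊ W) ∧ (∀ a, a ∊ W → pow a ∊ W) ∧
  ∀ a b f, a ∊ W → b ⊑ W → (∀ y, y ∊ b → ∃ x, x ∊ a ∧ pair x y ∊ f) →
    (∀ x y y', pair x y ∊ f → pair x y' ∊ f → y = y') → b ∊ W
instance iP_Univ {t : (ℕ → M) → M} [ht : DfT C t] : Df C (fun v => Univ (t v)) := by
  refine Df.sub1 (P := Univ) ?_ ht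
  unfold Univ; infer_instance

theorem Univ.sub {W : M} (h : Univ W) {a b : M} (ha : a ∊ W) (hb : b ⊑ a) : b ∊ W :=
  h.1 _ (h.2.2.2.2.1 a ha) b (by simpa using hb)

theorem df_relW1 {W : M} {k : ℕ} (φ : SetFormula (k + 1)) (p : Fin k → M) 
    {t : (ℕ → M) → M} [ht : DfT Any t] :
    Df Any (fun v => RelR (fun x => x ∊ W) φ (Fin.cons (t v) p)) := by
  let T : Fin (k + 1) → (ℕ → M) → M := Fin.cons t (fun i _ => p i)
  have hT : ∀ i, DfT Any (T i) := by
    intro i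
    refine Fin.cases ?_ (fun i => ?_) i
    · exact ht
    · exact (inferInstance : DfT Any (fun _ => p i))
  refine (Df.relR (S := fun r x => x ∊ r) (w := fun _ => W) inferInstance inferInstance φ T hT).congr fun v => ?_
  have : (fun i => T i v) = Fin.cons (t v) p := by
    funext i
    refine Fin.cases ?_ (fun i => ?_) i <;> rfl
  rw [this]

theorem df_relW2 {W : M} {k : ℕ} (φ : SetFormula (k + 2)) (p : Fin k → M)
    {t s : (ℕ → M) → M} [ht : DfT Any t] [hs : DfT Any s] :
    Df Any (fun v => RelR (fun x => x ∊ W) φ (Fin.cons (t v) (Fin.cons (s v) p))) := by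
  let T : Fin (k + 2) → (ℕ → M) → M := Fin.cons t (Fin.cons s (fun i _ => p i))
  have hT : ∀ i, DfT Any (T i) := by
    intro i
    refine Fin.cases ?_ (fun i => ?_) i
    · exact ht
    · refine Fin.cases ?_ (fun i => ?_) i
      · exact hs
      · exact (inferInstance : DfT Any (fun _ => p i))
  refine (Df.relR (S := fun r x => x ∊ r) (w := fun _ => W) inferInstance inferInstance φ T hT).congr fun v => ?_
  have : (fun i => T i v) = Fin.cons (t v) (Fin.cons (s v) p) := by
    funext i
    refine Fin.cases ?_ (fun i => ?_) i
    · rfl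
    · refine Fin.cases ?_ (fun i => ?_) i <;> rfl
  rw [this]

theorem Univ.inner {W : M} (h : Univ W) : Inner (fun x => x ∊ W) where
  tr := h.1
  om := h.2.1
  upr := h.2.2.1
  uni := h.2.2.2.1
  pw := fun a ha => ⟨pow a, h.2.2.2.2.1 a ha, fun z hz => by simp⟩
  sp := fun k φ p hp a ha => by
    have i3 := fun (t : (ℕ → M) → M) [ht : DfT Any t] => df_relW1 (W := W) φ p (t := t)
    refine ⟨sep a (fun z => RelR (fun x => x ∊ W) φ (Fin.cons z p)), h.sub ha fun z hz => ?_, fun z hz => ?_⟩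
    · exact ((mem_sep _ _ _).1 hz).1
    · exact mem_sep _ _ _
  rp := fun k φ p hp a ha hf => by
    have i3 := fun (t s : (ℕ → M) → M) [ht : DfT Any t] [hs : DfT Any s] => df_relW2 (W := W) φ p (t := t) (s := s)
    refine ⟨sep W (fun y => ∃ x, x ∊ a ∧ RelR (fun x => x ∊ W) φ (Fin.cons x (Fin.cons y p))), ?_, fun y hy => ?_⟩
    · refine h.2.2.2.2.2 a _ (sep (prod a W) (fun z => RelR (fun x => x ∊ W) φ (Fin.cons (fst z) (Fin.cons (snd z) p)))) ha
        (fun z hz => ((mem_sep _ _ _).1 hz).1) (fun y hy => ?_) (fun x y y' h1 h2 => ?_)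
      · obtain ⟨hy, x, hx, hr⟩ := (mem_sep _ _ _).1 hy
        exact ⟨x, hx, (mem_sep _ _ _).2 ⟨(mem_prod _ _ _ _).2 ⟨hx, hy⟩, by simpa using hr⟩⟩
      · have h1 := (mem_sep _ _ _).1 h1
        have h2 := (mem_sep _ _ _).1 h2
        rw [mem_prod] at h1 h2
        simp only [fst_pair, snd_pair] at h1 h2
        exact hf x h1.1.1 y y' h1.1.2 h2.1.2 h1.2 h2.2
    · rw [mem_sep]; exact and_iff_right hy
  ch := fun a ha h1 h2 => by
    obtain ⟨c, hc⟩ := (Mdl.ax (M := M)).2.2.2 a h1 h2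
    refine ⟨cap c (un a), h.sub (h.2.2.2.1 a ha) fun z hz => by simp at hz; simpa using hz.2, fun x hx => ?_⟩
    obtain ⟨z, hz, hzx, hu⟩ := hc x hx
    refine ⟨z, ?_, hzx, fun z' hz' hzx' => hu z' ?_ hzx'⟩
    · simp only [mem_cap, mem_un]; exact ⟨hz, x, hx, hzx⟩
    · simp only [mem_cap] at hz'; exact hz'.1

/-! absoluteness of universes -/
theorem relR_abs {S : M → Prop} [i : Mdl {x // S x}] (hi : i.E = ES S) (W : {x // S x})
    (tr : ∀ x, S x → ∀ y, y ∊ x → S y) {n : ℕ} (φ : SetFormula n) :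
    ∀ u : Fin n → {x // S x}, RelR (fun x => x ∊ W) φ u ↔ RelR (fun x => x ∊ W.1) φ (fun i => (u i).1) := by
  induction φ with
  | mem i j => intro u; simp only [RelR]; rw [hi]
  | eq i j => intro u; simp only [RelR]; exact Subtype.ext_iff
  | fal => intro u; exact Iff.rfl
  | imp φ ψ h1 h2 => intro u; simp only [RelR, h1, h2]
  | all φ ih =>
    intro u
    simp only [RelR, ih, Subtype.forall]
    refine ⟨fun h a ha => ?_, fun h a hS ha => ?_⟩
    · have := h a (tr _ W.2 a ha) (by rw [hi]; exact ha)
      rwa [snoc_comp] at this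
    · have := h a (by rw [hi] at ha; exact ha)
      rwa [snoc_comp]

theorem univ_abs {U : M} (hU : Univ U) (W : {x // x ∊ U})
    (h : @Univ _ ⟨ES (fun x => x ∊ U), hU.inner.zfc⟩ W) : Univ W.1 := by
  letI : Mdl {x // x ∊ U} := ⟨ES (fun x => x ∊ U), hU.inner.zfc⟩
  have tr := hU.1
  have trW : ∀ x, x ∊ W.1 → x ∊ U := fun x hx => tr _ W.2 x hx
  have eup : ∀ a b : {x // x ∊ U}, (upair a b).1 = upair a.1 b.1 := fun a b =>
    (upairE_iff _ _ _).1 ((abs_upair tr _ _ _).1 ((upairE_iff (M := {x // x ∊ U}) _ _ _).2 rfl))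
  have epr : ∀ a b : {x // x ∊ U}, (pair a b).1 = pair a.1 b.1 := fun a b => by
    unfold Paper.pair; simp only [eup]
  have eun : ∀ a : {x // x ∊ U}, (un a).1 = un a.1 := fun a => sext fun z => by
    constructor
    · intro hz
      obtain ⟨y, h1, h2⟩ := (mem_un (M := {x // x ∊ U}) a ⟨z, tr _ (un a).2 z hz⟩).1 hz
      exact (mem_un _ _).2 ⟨y.1, h1, h2⟩
    · intro hz
      obtain ⟨y, h1, h2⟩ := (mem_un _ _).1 hz
      have hy := tr _ a.2 y h1
      exact (mem_un (M := {x // x ∊ U}) a ⟨z, tr _ hy z h2⟩).2 ⟨⟨y, hy⟩, h1, h2⟩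
  have epw : ∀ a : {x // x ∊ U}, (pow a).1 = pow a.1 := fun a => sext fun z => by
    constructor
    · intro hz
      have := (mem_pow (M := {x // x ∊ U}) a ⟨z, tr _ (pow a).2 z hz⟩).1 hz
      exact (mem_pow _ _).2 ((abs_sub tr _ _).1 this)
    · intro hz
      have hz := (mem_pow _ _).1 hz
      exact (mem_pow (M := {x // x ∊ U}) a ⟨z, hU.sub a.2 hz⟩).2 ((abs_sub tr _ _).2 hz)
  have eom : (omega : {x // x ∊ U}).1 = omega := (abs_omega tr _).1 ((omegaE_iff (M := {x // x ∊ U}) _).2 rfl)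
  obtain ⟨h1, h2, h3, h4, h5, h6⟩ := h
  refine ⟨fun x hx y hy => h1 ⟨x, trW x hx⟩ hx ⟨y, tr _ (trW x hx) y hy⟩ hy, ?_, fun a b ha hb => ?_, fun a ha => ?_,
    fun a ha => ?_, fun a b f ha hb hs hf => ?_⟩
  · rw [← eom]; exact h2
  · have := h3 ⟨a, trW a ha⟩ ⟨b, trW b hb⟩ ha hb
    have e := eup ⟨a, trW a ha⟩ ⟨b, trW b hb⟩
    rw [← e]; exact this
  · have := h4 ⟨a, trW a ha⟩ ha
    have e := eun ⟨a, trW a ha⟩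
    rw [← e]; exact this
  · have := h5 ⟨a, trW a ha⟩ ha
    have e := epw ⟨a, trW a ha⟩
    rw [← e]; exact this
  · have bU : b ∊ U := hU.sub W.2 hb
    have aU := trW a ha
    have pU : ∀ x y, x ∊ U → y ∊ U → pair x y ∊ U := fun x y hx hy => by
      unfold Paper.pair
      exact hU.2.2.1 _ _ (hU.2.2.1 _ _ hx hx) (hU.2.2.1 _ _ hx hy)
    have cU : cup a b ∊ U := by
      unfold Paper.cup; exact hU.2.2.2.1 _ (hU.2.2.1 _ _ aU bU)
    let g := cap f (prod a b)
    have gU : g ∊ U := by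
      refine hU.sub (hU.2.2.2.2.1 _ (hU.2.2.2.2.1 _ cU)) fun z hz => ?_
      simp only [g, mem_cap] at hz
      obtain ⟨x, y, hx, hy, rfl⟩ := (mem_prod' _ _ _).1 hz.2
      simp only [mem_pow, Paper.pair]
      intro w hw
      rw [mem_pow]
      intro q hq
      rw [mem_cup]
      rcases (mem_upair _ _ _).1 hw with rfl | rfl
      · rcases (mem_upair _ _ _).1 hq with rfl | rfl <;> exact .inl hx
      · rcases (mem_upair _ _ _).1 hq with rfl | rfl
        · exact .inl hx
        · exact .inr hy
    refine h6 ⟨a, aU⟩ ⟨b, bU⟩ ⟨g, gU⟩ ha (fun z hz => hb z.1 hz) (fun y hy => ?_) (fun x y y' hxy hxy' => ?_)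
    · obtain ⟨x, hx, hp⟩ := hs y.1 hy
      refine ⟨⟨x, tr _ aU x hx⟩, hx, ?_⟩
      change (pair _ _ : {x // x ∊ U}).1 ∊ g
      rw [epr]
      simp only [g, mem_cap, mem_prod]
      exact ⟨hp, hx, hy⟩
    · change (pair _ _ : {x // x ∊ U}).1 ∊ g at hxy hxy'
      rw [epr] at hxy hxy'
      simp only [g, mem_cap, mem_prod] at hxy hxy'
      exact Subtype.ext (hf _ _ _ hxy.1 hxy'.1)

/-! infinite cardinals are limits, PCS implies faint -/
open Classical in
theorem card_lim {κ : M} (h : InfCardE Mdl.E κ) : Lim κ := by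
  obtain ⟨⟨oκ, hc⟩, _, w, hw, hle⟩ := h
  rw [omegaE_iff] at hw; subst hw
  rcases ord_zero_succ_lim oκ with e | ⟨l, ol, e⟩ | hl
  · exfalso
    subst e
    rcases hle with hle | hle
    · exact mem_emp _ hle
    · have := lim_emp (M := M) omega_lim
      rw [hle] at this; exact mem_emp _ this
  · exfalso
    subst e
    have hω : omega ⊑ l := by
      rcases hle with hle | hle
      · rcases (mem_succ _ _).1 hle with h | h
        · exact ol.sub h
        · rw [h]; exact sub_refl _
      · have hh := omega_lim (M := M)
        rw [hle] at hh
        exact (not_lim_succ _ hh).elim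
    let F : M → M := fun x => if x = emp then l else if x ∊ omega then un x else x
    have iF : DfT Any (fun v => F (v 0)) :=
      inferInstanceAs (DfT Any (fun v : ℕ → M => if v 0 = emp then l else if v 0 ∊ omega then un (v 0) else v 0))
    have F0 : F emp = l := if_pos rfl
    have Fs : ∀ n, n ∊ omega → F (succ n) = n := fun n hn => by
      have h1 : succ n ≠ emp := fun e => mem_emp n (by rw [← e]; simp)
      simp only [F, if_neg h1, if_pos (lim_succ omega_lim hn)]
      exact un_succ (omega_ord.mem hn)
    have Fx : ∀ x, ¬ x ∊ omega → F x = x := fun x hx => by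
      have h1 : x ≠ emp := fun e => hx (by rw [e]; exact lim_emp omega_lim)
      simp only [F, if_neg h1, if_neg hx]
    have cases : ∀ x : M, x = emp ∨ (∃ n, n ∊ omega ∧ x = succ n) ∨ ¬ x ∊ omega := fun x => by
      by_cases hx : x ∊ omega
      · rcases omega_cases hx with h | ⟨n, h1, h2⟩
        · exact .inl h
        · exact .inr (.inl ⟨n, by assumption, by assumption⟩)
      · exact .inr (.inr hx)
    have Fr : ∀ x, x ∊ l → F x ∊ succ l := fun x hx => by
      rw [mem_succ]
      rcases cases x with rfl | ⟨n, hn, rfl⟩ | hx'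
      · right; exact F0
      · left; rw [Fs n hn]; exact hω n hn
      · left; rw [Fx x hx']; exact hx
    have pm : ∀ x y, PairMemE Mdl.E (gr l F) x y ↔ x ∊ l ∧ y = F x := fun x y => by
      rw [pairMemE_iff, mem_gr]
    have hfun : IsFuncE Mdl.E (gr l F) l (succ l) := by
      refine ⟨fun p hp => ?_, fun x hx => ⟨⟨F x, (pm _ _).2 ⟨hx, rfl⟩⟩, fun y y' h1 h2 => ?_⟩⟩
      · obtain ⟨x, hx, rfl⟩ := (mem_img _ _ _).1 hp
        exact ⟨x, F x, hx, Fr x hx, (oPairE_iff _ _ _).2 rfl⟩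
      · rw [pm] at h1 h2; rw [h1.2, h2.2]
    refine hc l (by simp) ⟨gr l F, ⟨hfun, fun y hy => ?_⟩, ⟨hfun, fun x x' y hx hx' h1 h2 => ?_⟩⟩
    · simp only [pm]
      rcases (mem_succ _ _).1 hy with hy | rfl
      · by_cases hyo : y ∊ omega
        · exact ⟨succ y, hω _ (lim_succ omega_lim hyo), hω _ (lim_succ omega_lim hyo), (Fs y hyo).symm⟩
        · exact ⟨y, hy, hy, (Fx y hyo).symm⟩
      · exact ⟨emp, hω _ (lim_emp omega_lim), hω _ (lim_emp omega_lim), F0.symm⟩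
    · rw [pm] at h1 h2
      have e : F x = F x' := by rw [← h1.2, ← h2.2]
      clear h1 h2
      have nl : ∀ n, n ∊ omega → n ≠ l := fun n hn e => mem_irrefl l (hω l (e ▸ hn))
      rcases cases x with rfl | ⟨n, hn, rfl⟩ | hx1 <;> rcases cases x' with rfl | ⟨n', hn', rfl⟩ | hx2
      · rfl
      · rw [F0, Fs _ hn'] at e; exact (nl _ hn' e.symm).elim
      · rw [F0, Fx _ hx2] at e; rw [← e] at hx'; exact (mem_irrefl _ hx').elim
      · rw [F0, Fs _ hn] at e; exact (nl _ hn e).elim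
      · rw [Fs _ hn, Fs _ hn'] at e; rw [e]
      · rw [Fs _ hn, Fx _ hx2] at e; rw [e] at hn; exact (hx2 hn).elim
      · rw [F0, Fx _ hx1] at e; rw [e] at hx; exact (mem_irrefl _ hx).elim
      · rw [Fx _ hx1, Fs _ hn'] at e; rw [← e] at hn'; exact (hx1 hn').elim
      · rwa [Fx _ hx1, Fx _ hx2] at e
  · exact hl

theorem pcs_faint (h : ProperClassSubtleE (M := M) Mdl.E) : OrdFaintDefE (M := M) Mdl.E := by
  intro k φ p hE ξ oξ
  obtain ⟨κ, ⟨hcard, hs⟩, hκ⟩ := h ξ oξ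
  have hl := card_lim hcard
  have i1 := fun (t s : (ℕ → M) → M) [ht : DfT Any t] [hs : DfT Any s] => df_real2 (C := Any) φ p (fun i => inferInstance) (t := t) (s := s)
  obtain ⟨f, hf, hf'⟩ := choice κ (fun a A => Realize Mdl.E φ (Fin.cons a (Fin.cons A p)))
    fun a ha => (hE a (hl.1.mem ha)).1
  have pm : ∀ x y, PairMemE Mdl.E f x y ↔ x ∊ κ ∧ y = app f x := fun x y => by
    rw [pairMemE_iff]
    conv_lhs => rw [hf]
    rw [mem_gr]
  have hcl : ClubInE Mdl.E (sep κ (fun b => ξ ∊ b)) κ := by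
    refine ⟨fun z hz => ((mem_sep _ _ _).1 hz).1, fun a ha => ?_, fun l hlk ⟨w, hw⟩ h => ?_⟩
    · have hx : cup ξ a ∊ κ := by
        rcases ord_le_or_lt oξ (hl.1.mem ha) with h | h
        · have : cup ξ a = a := sub_antisymm (cup_le h (sub_refl _)) (le_cup_r _ _)
          rwa [this]
        · have : cup ξ a = ξ := sub_antisymm (cup_le (sub_refl _) (oξ.sub h)) (le_cup_l _ _)
          rwa [this]
      have oc := hl.1.mem hx
      refine ⟨succ (cup ξ a), (mem_sep _ _ _).2 ⟨lim_succ hl hx, ?_⟩, ?_⟩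
      · exact (ord_lt_succ oξ oc).2 (le_cup_l _ _)
      · exact (ord_lt_succ (hl.1.mem ha) oc).2 (le_cup_r _ _)
    · obtain ⟨b, hb, h1, h2⟩ := h w hw
      exact (mem_sep _ _ _).2 ⟨hlk, (hl.1.mem hlk).tr h2 ((mem_sep _ _ _).1 hb).2⟩
  obtain ⟨a, b, ha, hb, hab, A, B, hA, hB, hAB⟩ := hs f (fun a ha => ⟨⟨app f a, (pm _ _).2 ⟨ha, rfl⟩,
      (hE a (hl.1.mem ha)).2 _ (hf' a ha)⟩, fun A A' h1 h2 => by rw [pm] at h1 h2; rw [h1.2, h2.2]⟩) _ hcl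
  rw [pm] at hA hB
  obtain ⟨ha', e⟩ := hA
  obtain ⟨hb', e'⟩ := hB
  subst e e'
  exact ⟨a, b, _, _, hl.1.mem ha', hl.1.mem hb', ((mem_sep _ _ _).1 ha).2, hab, hf' b hb', hAB, hf' a ha'⟩

end S11
end Paper

set_option linter.all false
namespace Paper
section S12
variable {M : Type} [Mdl M] {C : M → Prop}

def Onto (d x : M) : Prop := ∃ h, ∀ y, y ∊ x → ∃ i, i ∊ d ∧ app h i = y
instance iP_Onto {t s : (ℕ → M) → M} [ht : DfT C t] [hs : DfT C s] : Df C (fun v => Onto (t v) (s v)) := by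
  refine Df.sub2 (P := Onto) ?_ ht hs
  unfold Onto; infer_instance
noncomputable def gw (c : M) : M := lst (fun d => Onto d (V c))
instance iT_gw {t : (ℕ → M) → M} [ht : DfT C t] : DfT C (fun v => gw (t v)) := by
  refine DfT.sub1 (f := gw) ?_ ht
  unfold gw; infer_instance
theorem gw_ord (c : M) : Od (gw c) := lst_ord _
theorem gw_spec (c : M) : Onto (gw c) (V c) := by
  obtain ⟨l, h, ol, hl⟩ := wo (V c)
  exact (lst_spec (fun d => Onto d (V c)) ⟨l, ol, h, hl⟩).2.1

/-- cofinal codes -/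
def Cof (α A : M) : Prop := ∃ δ, δ ∊ α ∧ pr emp δ ∊ A ∧ (∀ d, Od d → pr emp d ∊ A → d = δ) ∧
  (∀ i, i ∊ δ → ∃ j, j ∊ α ∧ pr (succ i) j ∊ A ∧ ∀ j', Od j' → pr (succ i) j' ∊ A → j' = j) ∧
  ∀ γ, γ ∊ α → ∃ i j, i ∊ δ ∧ pr (succ i) j ∊ A ∧ j ∊ α ∧ ¬ j ⊑ γ
instance iP_Cof {t s : (ℕ → M) → M} [ht : DfT C t] [hs : DfT C s] : Df C (fun v => Cof (t v) (s v)) := by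
  refine Df.sub2 (P := Cof) ?_ ht hs
  unfold Cof; infer_instance

theorem cof_clash {α β A : M} (oβ : Od β) (hab : α ∊ β) (h1 : Cof β A) (h2 : Cof α (cap A α)) : False := by
  have oα := oβ.mem hab
  obtain ⟨δ, hδ, h0, hu, hf, hc⟩ := h1
  obtain ⟨δ', hδ', h0', -, hf', -⟩ := h2
  have e : δ' = δ := hu δ' (oα.mem hδ') ((mem_cap _ _ _).1 h0').1
  subst e
  obtain ⟨i, j, hi, hp, hj, hn⟩ := hc α hab
  obtain ⟨j0, hj0, hp0, hu0⟩ := hf i hi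
  obtain ⟨j1, hj1, hp1, -⟩ := hf' i hi
  have e1 := hu0 j (oβ.mem hj) hp
  have e2 := hu0 j1 (oα.mem hj1) ((mem_cap _ _ _).1 hp1).1
  rw [e1, ← e2] at hn
  exact hn (oα.sub hj1)

theorem cof_ex {α δ : M} (hl : Cl gp α) (hδ : δ ∊ α) (F : M → M) [hF : DfT Any (fun v => F (v 0))]
    (hr : ∀ i, i ∊ δ → F i ∊ α) (hc : ∀ γ, γ ∊ α → ∃ i, i ∊ δ ∧ ¬ F i ⊑ γ) : ∃ A, A ⊑ α ∧ Cof α A := by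
  have iF : ∀ (t : (ℕ → M) → M) [DfT Any t], DfT Any (fun v => F (t v)) := fun t ht => DfT.sub1 (f := F) hF ht
  have oα := hl.1.1
  have oδ := oα.mem hδ
  have hmem : ∀ z, z ∊ cup (upair (pr emp δ) (pr emp δ)) (img δ (fun i => pr (succ i) (F i))) ↔
      z = pr emp δ ∨ ∃ i, i ∊ δ ∧ z = pr (succ i) (F i) := fun z => by
    rw [mem_cup, mem_upair, mem_img, or_self]
  have os : ∀ i, i ∊ δ → Od (succ i) := fun i hi => (oδ.mem hi).succ
  have ne : ∀ i : M, succ i ≠ emp := fun i e => mem_emp i (by rw [← e]; simp)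
  have sl : ∀ i, i ∊ δ → succ i ∊ α := fun i hi => lim_succ hl.1 (oα.tr hδ hi)
  refine ⟨cup (upair (pr emp δ) (pr emp δ)) (img δ (fun i => pr (succ i) (F i))), fun z hz => ?_, δ, hδ, ?_, ?_, ?_, ?_⟩
  · rcases (hmem z).1 hz with rfl | ⟨i, hi, rfl⟩
    · exact cl_pr hl (lim_emp hl.1) hδ
    · exact cl_pr hl (sl i hi) (hr i hi)
  · exact (hmem _).2 (.inl rfl)
  · intro d od hd
    rcases (hmem _).1 hd with e | ⟨i, hi, e⟩
    · exact (pr_inj ord_emp od ord_emp oδ e).2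
    · exact (ne i (pr_inj ord_emp od (os i hi) (oα.mem (hr i hi)) e).1.symm).elim
  · intro i hi
    refine ⟨F i, hr i hi, (hmem _).2 (.inr ⟨i, hi, rfl⟩), fun j' oj hj => ?_⟩
    rcases (hmem _).1 hj with e | ⟨i', hi', e⟩
    · exact (ne i (pr_inj (os i hi) oj ord_emp oδ e).1).elim
    · have := pr_inj (os i hi) oj (os i' hi') (oα.mem (hr i' hi')) e
      rw [this.2, succ_inj this.1]
  · intro γ hγ
    obtain ⟨i, hi, hn⟩ := hc γ hγ
    exact ⟨i, F i, hi, (hmem _).2 (.inr ⟨i, hi, rfl⟩), hr i hi, hn⟩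

theorem sing {α : M} (hp : Cl gp α) (hw : Cl gw α) (hom : omega ∊ α) (hn : ¬ Univ (V α)) : ∃ A, A ⊑ α ∧ Cof α A := by
  have hl := hp.1
  have oα := hl.1
  by_contra hA
  apply hn
  refine ⟨fun x hx y hy => V_trans oα hx hy, ord_sub_V α oα _ hom, fun a b ha hb => lim_upair hl ha hb, fun a ha => ?_,
    fun a ha => ?_, fun a b f ha hb hs hf => ?_⟩
  · obtain ⟨γ, hγ, h⟩ := (mem_V oα a).1 ha
    refine (mem_V oα _).2 ⟨γ, hγ, fun z hz => ?_⟩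
    obtain ⟨y, hy, hz⟩ := (mem_un _ _).1 hz
    exact V_trans (oα.mem hγ) (h y hy) hz
  · obtain ⟨γ, hγ, h⟩ := (mem_V oα a).1 ha
    refine (mem_V oα _).2 ⟨succ γ, lim_succ hl hγ, fun z hz => ?_⟩
    rw [mem_V_succ (oα.mem hγ)]
    exact sub_trans ((mem_pow _ _).1 hz) h
  · by_contra hbn
    apply hA
    obtain ⟨γ, hγ, h⟩ := (mem_V oα a).1 ha
    obtain ⟨e, he⟩ := gw_spec γ
    let F : M → M := fun i => lst (fun ρ => ∀ y, y ∊ b → pair (app e i) y ∊ f → y ∊ V ρ)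
    have iF : DfT Any (fun v => F (v 0)) :=
      inferInstanceAs (DfT Any (fun v : ℕ → M => lst (fun ρ => ∀ y, y ∊ b → pair (app e (v 0)) y ∊ f → y ∊ V ρ)))
    have hF : ∀ i, ∃ ρ, ρ ∊ α ∧ ∀ y, y ∊ b → pair (app e i) y ∊ f → y ∊ V ρ := fun i => by
      by_cases hy : ∃ y, y ∊ b ∧ pair (app e i) y ∊ f
      · obtain ⟨y, hyb, hyf⟩ := hy
        obtain ⟨ρ, hρ, hy⟩ := (mem_V_lim hl y).1 (hb y hyb)
        refine ⟨ρ, hρ, fun y' _ h' => ?_⟩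
        rwa [hf _ _ _ h' hyf]
      · exact ⟨emp, lim_emp hl, fun y h1 h2 => (hy ⟨y, h1, h2⟩).elim⟩
    have hF2 : ∀ i, Od (F i) ∧ ∀ y, y ∊ b → pair (app e i) y ∊ f → y ∊ V (F i) := fun i => by
      obtain ⟨ρ, hρ, h⟩ := hF i
      have := lst_spec (fun ρ => ∀ y, y ∊ b → pair (app e i) y ∊ f → y ∊ V ρ) ⟨ρ, oα.mem hρ, h⟩
      exact ⟨this.1, this.2.1⟩
    refine cof_ex hp (hw.2 γ hγ) F (fun i _ => ?_) (fun c hc => ?_)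
    · obtain ⟨ρ, hρ, h⟩ := hF i
      exact ord_lt_of_le_lt (hF2 i).1 oα (lst_le (fun ρ => ∀ y, y ∊ b → pair (app e i) y ∊ f → y ∊ V ρ) (oα.mem hρ) h) hρ
    · by_contra hcon
      push Not at hcon
      apply hbn
      refine (mem_V oα _).2 ⟨c, hc, fun y hy => ?_⟩
      obtain ⟨x, hx, hxy⟩ := hs y hy
      obtain ⟨i, hi, rfl⟩ := he x (h x hx)
      exact V_mono (hF2 i).1 (oα.mem hc) (hcon i hi) y ((hF2 i).2 y hy hxy)

theorem univ_ex (hs : OrdSubtleDefE (M := M) Mdl.E) (θ : SetFormula 0) (hθ : Realize (M := M) Mdl.E θ ![]) :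
    ∃ W : M, Univ W ∧ RelR (fun x => x ∊ W) θ ![] := by
  obtain ⟨g, hg, og, hr⟩ := reflect0 (M := M) θ
  have ig : ∀ (t : (ℕ → M) → M) [DfT Any t], DfT Any (fun v => g (t v)) := fun t ht => DfT.sub1 (f := g) hg ht
  let G : M → M := fun c => cup (g c) (cup (gp c) (cup (gw c) omega))
  have iG : DfT Any (fun v => G (v 0)) :=
    inferInstanceAs (DfT Any (fun v : ℕ → M => cup (g (v 0)) (cup (gp (v 0)) (cup (gw (v 0)) omega))))
  have iG' : ∀ (t : (ℕ → M) → M) [DfT Any t], DfT Any (fun v => G (t v)) := fun t ht => DfT.sub1 (f := G) iG ht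
  have o3 : ∀ c : M, Od c → Od (cup (gw c) omega) := fun c _ => ord_cup (gw_ord c) omega_ord
  have o2 : ∀ c : M, Od c → Od (cup (gp c) (cup (gw c) omega)) := fun c oc => ord_cup (gp_ord c) (o3 c oc)
  have oG : ∀ c, Od c → Od (G c) := fun c oc => ord_cup (og c oc) (o2 c oc)
  by_contra hcon
  push Not at hcon
  have key : ∀ α, Cl G α → ∃ A, A ⊑ α ∧ Cof α A := fun α h => by
    have c1 := cl_cup og o2 h
    have c2 := cl_cup (fun c _ => gp_ord c) o3 c1.2
    have c3 := cl_cup (fun c _ => gw_ord c) (fun c _ => omega_ord) c2.2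
    refine sing c2.1 c3.1 (c3.2.2 emp (lim_emp h.1)) fun hU => hcon _ hU ((hr α c1.1).2 hθ)
  have := subtle_apply hs (fun a A => A ⊑ a ∧ (Cof a A ∨ ¬ ∃ B, B ⊑ a ∧ Cof a B)) inferInstance
    (Cl G) (by unfold Cl; infer_instance) (fun a oa => ⟨?_, fun A hA => hA.1⟩) (cl_club G oG)
  · obtain ⟨a, b, A, B, ha, hb, hab, ⟨hA, hA'⟩, he, ⟨hB, hB'⟩⟩ := this
    rw [interE_iff] at he
    subst he
    exact cof_clash hb.1.1 hab (hA'.resolve_right fun h => h (key b hb)) (hB'.resolve_right fun h => h (key a ha))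
  · by_cases h : ∃ B, B ⊑ a ∧ Cof a B
    · obtain ⟨B, h1, h2⟩ := h; exact ⟨B, h1, .inl h2⟩
    · exact ⟨emp, emp_sub a, .inr h⟩

theorem no_theta (φ ps : SetFormula 0) (hps : ∀ (N : Type) (E : N → N → Prop), Realize E ps ![] ↔ ProperClassSubtleE E)
    (ha : SubtleProves φ) (hb : FaintPlusProvesSubtle φ) (hp : ProperClassSubtleE (M := M) Mdl.E)
    (hs : OrdSubtleDefE (M := M) Mdl.E) : False := by
  have hand : ∀ (N : Type) (E : N → N → Prop), Realize E (φ.and ps) ![] ↔ Realize E φ ![] ∧ ProperClassSubtleE E := by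
    intro N E
    rw [← hps]
    simp [SetFormula.and, SetFormula.not, Realize]
  have h0 : Realize (M := M) Mdl.E (φ.and ps) ![] := (hand _ _).2 ⟨ha M _ Mdl.ax hs, hp⟩
  obtain ⟨W0, hW0⟩ := univ_ex hs _ h0
  have idf : Df Any (fun v : ℕ → M => Univ (v 0) ∧ RelR (fun x => x ∊ v 0) (φ.and ps) ![]) := by
    have : Df Any (fun v : ℕ → M => RelR (fun x => x ∊ v 0) (φ.and ps) ![]) := by
      refine (Df.relR (C := Any) (S := fun r x : M => x ∊ r) (w := fun v => v 0) inferInstance inferInstance (φ.and ps)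
        (fun i => i.elim0) (fun i => i.elim0)).congr fun v => ?_
      rw [show (fun i : Fin 0 => (i.elim0 : (ℕ → M) → M) v) = ![] from funext fun i => i.elim0]
    infer_instance
  obtain ⟨W, ⟨hU, hR⟩, hmin⟩ := class_found (fun W : M => Univ W ∧ RelR (fun x => x ∊ W) (φ.and ps) ![]) hW0
  letI : Mdl {x // x ∊ W} := ⟨ES (fun x => x ∊ W), hU.inner.zfc⟩
  have e0 : ∀ u : Fin 0 → {x // x ∊ W}, (fun i => (u i).1) = ![] := fun u => funext fun i => i.elim0
  have hR' : Realize (ES (fun x => x ∊ W)) (φ.and ps) ![] := by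
    rw [realize_sub, e0]; exact hR
  obtain ⟨h1, h2⟩ := (hand _ _).1 hR'
  have hf := pcs_faint (M := {x // x ∊ W}) h2
  have hs' : OrdSubtleDefE (M := {x // x ∊ W}) Mdl.E := hb _ _ hU.inner.zfc hf h1
  obtain ⟨W', hU', hr'⟩ := univ_ex (M := {x // x ∊ W}) hs' _ hR'
  refine hmin W'.1 W'.2 ⟨univ_abs hU W' hU', ?_⟩
  have := (relR_abs (S := fun x => x ∊ W) rfl W' hU.1 _ _).1 hr'
  rwa [e0] at this

end S12
end Paper

set_option linter.all false
namespace Paper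

/-- Uniform formulas. -/
inductive UF : Type
  | mem (i j : ℕ) : UF
  | eq (i j : ℕ) : UF
  | fal : UF
  | imp (φ ψ : UF) : UF
  | all (φ : UF) : UF

/-- A structure for the language of set theory. -/
structure Stc where
  N : Type
  E : N → N → Prop

def usat (s : Stc) : UF → (ℕ → s.N) → Prop
  | .mem i j, v => s.E (v i) (v j)
  | .eq i j, v => v i = v j
  | .fal, _ => False
  | .imp φ ψ, v => usat s φ v → usat s ψ v
  | .all φ, v => ∀ a, usat s φ (cs a v)

def UF.toS : UF → ∀ n : ℕ, (ℕ → Fin n) → SetFormula n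
  | .mem i j, _, r => .mem (r i) (r j)
  | .eq i j, _, r => .eq (r i) (r j)
  | .fal, _, _ => .fal
  | .imp φ ψ, n, r => .imp (φ.toS n r) (ψ.toS n r)
  | .all φ, n, r => .all (φ.toS (n+1) (cs (Fin.last n) (fun i => (r i).castSucc)))

theorem realize_toS (s : Stc) (φ : UF) : ∀ (n : ℕ) (r : ℕ → Fin n) (u : Fin n → s.N),
    Realize s.E (φ.toS n r) u ↔ usat s φ (fun i => u (r i)) := by
  induction φ with
  | mem i j => intro n r u; exact Iff.rfl
  | eq i j => intro n r u; exact Iff.rfl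
  | fal => intro n r u; exact Iff.rfl
  | imp φ ψ h1 h2 => intro n r u; simp only [UF.toS, Realize, usat, h1, h2]
  | all φ ih =>
    intro n r u
    simp only [UF.toS, Realize, usat, ih]
    refine forall_congr' fun a => ?_
    have : (fun i => (Fin.snoc u a : Fin (n+1) → s.N)
        (cs (Fin.last n) (fun i => (r i).castSucc) i)) = cs a (fun i => u (r i)) := by
      funext i
      cases i with
      | zero => simp [cs]
      | succ i => simp [cs]
    rw [this]

class UD (P : (s : Stc) → (ℕ → s.N) → Prop) : Prop where
  out : ∃ φ : UF, ∀ s v, usat s φ v ↔ P s v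

theorem UD.congr {P Q : (s : Stc) → (ℕ → s.N) → Prop} (h : UD P) (hq : ∀ s v, P s v ↔ Q s v) : UD Q :=
  ⟨h.out.imp fun _ h s v => (h s v).trans (hq s v)⟩

instance UD.fal : UD (fun _ _ => False) := ⟨.fal, fun _ _ => Iff.rfl⟩

instance UD.imp {P Q : (s : Stc) → (ℕ → s.N) → Prop} [h1 : UD P] [h2 : UD Q] :
    UD (fun s v => P s v → Q s v) := by
  obtain ⟨φ, a⟩ := h1.out
  obtain ⟨ψ, b⟩ := h2.out
  exact ⟨.imp φ ψ, fun s v => by simp only [usat]; rw [a, b]⟩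

instance UD.all {Q : (s : Stc) → (ℕ → s.N) → s.N → Prop}
    [h1 : UD (fun s w => Q s (fun i => w (i + 1)) (w 0))] :
    UD (fun s v => ∀ a, Q s v a) := by
  obtain ⟨φ, b⟩ := h1.out
  refine ⟨.all φ, fun s v => ?_⟩
  simp only [usat]
  exact forall_congr' fun a => b _ _

instance UD.not {P : (s : Stc) → (ℕ → s.N) → Prop} [h1 : UD P] : UD (fun s v => ¬ P s v) :=
  UD.imp (h1 := h1) (h2 := UD.fal)

instance UD.and {P Q : (s : Stc) → (ℕ → s.N) → Prop} [h1 : UD P] [h2 : UD Q] :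
    UD (fun s v => P s v ∧ Q s v) :=
  UD.congr (P := fun s v => ¬ (P s v → ¬ Q s v)) inferInstance (fun s v => by tauto)

instance UD.or {P Q : (s : Stc) → (ℕ → s.N) → Prop} [h1 : UD P] [h2 : UD Q] :
    UD (fun s v => P s v ∨ Q s v) :=
  UD.congr (P := fun s v => (¬ P s v → Q s v)) inferInstance (fun s v => by tauto)

instance UD.iff {P Q : (s : Stc) → (ℕ → s.N) → Prop} [h1 : UD P] [h2 : UD Q] :
    UD (fun s v => P s v ↔ Q s v) :=
  UD.congr (P := fun s v => (P s v → Q s v) ∧ (Q s v → P s v)) inferInstance (fun s v => by tauto)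

instance UD.ex {Q : (s : Stc) → (ℕ → s.N) → s.N → Prop}
    [h1 : UD (fun s w => Q s (fun i => w (i + 1)) (w 0))] :
    UD (fun s v => ∃ a, Q s v a) :=
  UD.congr (P := fun s v => ¬ ∀ a, ¬ Q s v a) inferInstance (fun s v => by simp)

instance UD.eq (i j : ℕ) : UD (fun s v => v i = v j) := ⟨.eq i j, fun _ _ => Iff.rfl⟩

instance UD.mem (i j : ℕ) : UD (fun s v => s.E (v i) (v j)) := ⟨.mem i j, fun _ _ => Iff.rfl⟩

theorem UD.sentence {P : (s : Stc) → Prop} (h : UD (fun s _ => P s)) (he : ∀ s, IsEmpty s.N → P s) :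
    ∃ ps : SetFormula 0, ∀ (N : Type) (E : N → N → Prop), Realize E ps ![] ↔ P ⟨N, E⟩ := by
  obtain ⟨φ, hφ⟩ := h.out
  refine ⟨.all (φ.toS 1 (fun _ => 0)), fun N E => ?_⟩
  simp only [Realize]
  have : ∀ a : N, Realize E (φ.toS 1 (fun _ => 0)) (Fin.snoc ![] a) ↔ P ⟨N, E⟩ := fun a =>
    (realize_toS ⟨N, E⟩ φ 1 (fun _ => 0) _).trans (hφ _ _)
  simp only [this]
  constructor
  · intro h
    rcases isEmpty_or_nonempty N with hN | ⟨⟨a⟩⟩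
    · exact he _ hN
    · exact h a
  · intro h _; exact h

section inst
variable (i j k l : ℕ)

instance : UD (fun s v => TransE s.E (v i)) := by unfold TransE; infer_instance
instance : UD (fun s v => OrdE s.E (v i)) := by unfold OrdE; infer_instance
instance : UD (fun s v => SubE s.E (v i) (v j)) := by unfold SubE; infer_instance
instance : UD (fun s v => LeE s.E (v i) (v j)) := by unfold LeE; infer_instance
instance : UD (fun s v => LimitE s.E (v i)) := by unfold LimitE; infer_instance
instance : UD (fun s v => OmegaSpecE s.E (v i)) := by unfold OmegaSpecE; infer_instance
instance : UD (fun s v => InfiniteOrdE s.E (v i)) := by unfold InfiniteOrdE; infer_instance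
instance : UD (fun s v => UPairE s.E (v i) (v j) (v k)) := by unfold UPairE; infer_instance
instance : UD (fun s v => OPairE s.E (v i) (v j) (v k)) := by unfold OPairE; infer_instance
instance : UD (fun s v => PairMemE s.E (v i) (v j) (v k)) := by unfold PairMemE; infer_instance
instance : UD (fun s v => IsFuncE s.E (v i) (v j) (v k)) := by unfold IsFuncE; infer_instance
instance : UD (fun s v => SurjE s.E (v i) (v j) (v k)) := by unfold SurjE; infer_instance
instance : UD (fun s v => InjE s.E (v i) (v j) (v k)) := by unfold InjE; infer_instance
instance : UD (fun s v => BijE s.E (v i) (v j) (v k)) := by unfold BijE; infer_instance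
instance : UD (fun s v => CardE s.E (v i)) := by unfold CardE; infer_instance
instance : UD (fun s v => InfCardE s.E (v i)) := by unfold InfCardE; infer_instance
instance : UD (fun s v => InterSpecE s.E (v i) (v j) (v k)) := by unfold InterSpecE; infer_instance
instance : UD (fun s v => UnboundedInE s.E (v i) (v j)) := by unfold UnboundedInE; infer_instance
instance : UD (fun s v => ClosedInE s.E (v i) (v j)) := by unfold ClosedInE; infer_instance
instance : UD (fun s v => ClubInE s.E (v i) (v j)) := by unfold ClubInE; infer_instance
instance : UD (fun s v => SeqSpecE s.E (v i) (v j)) := by unfold SeqSpecE; infer_instance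
instance : UD (fun s v => SubtleE s.E (v i)) := by unfold SubtleE; infer_instance
instance : UD (fun s v => ProperClassSubtleE s.E) := by unfold ProperClassSubtleE; infer_instance
instance : UD (fun s v => VHierE s.E (v i) (v j)) := by unfold VHierE; infer_instance
instance : UD (fun s v => VMemE s.E (v i) (v j)) := by unfold VMemE; infer_instance
instance : UD (fun s v => BadE s.E (v i) (v j) (v k)) := by unfold BadE; infer_instance

end inst

theorem pcs_sentence : ∃ ps : SetFormula 0, ∀ (N : Type) (E : N → N → Prop),
    Realize E ps ![] ↔ ProperClassSubtleE E :=
  UD.sentence (P := fun s => ProperClassSubtleE s.E) inferInstance (fun s h a => (h.false a).elim)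

section gen
variable {M : Type} (E : M → M → Prop)

def FstE (z x : M) : Prop := ∀ u, E u x ↔ ∃ p q, OPairE E z p q ∧ E u p
def SndE (z x : M) : Prop := ∀ u, E u x ↔ ∃ p q, OPairE E z p q ∧ E u q

def SpecE : ℕ → M → M → M → Prop
  | 0, a, b, z => E z a ∧ ¬ E z b
  | 1, a, b, z => E z a ∧ ∀ x, E x a → PairMemE E b x z
  | 2, a, b, z => E z a ∧ ∃ y, SndE E z y ∧ E y b
  | 3, a, b, z => E z a ∧ ∃ x y w, FstE E z x ∧ SndE E z y ∧ SndE E y w ∧ PairMemE E b x w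
  | 4, a, b, z => E z a ∧ ∃ x y w, FstE E z x ∧ SndE E z y ∧ FstE E y w ∧ E x w
  | 5, a, b, z => E z a ∧ ∃ x y w, FstE E z x ∧ SndE E z y ∧ FstE E y w ∧ E w x
  | 6, a, b, z => E z a ∧ ∃ x y w, FstE E z x ∧ SndE E z y ∧ FstE E y w ∧ x = w
  | 7, a, b, z => ∃ p, OPairE E p a b ∧ E z p
  | _, a, b, z => ∃ x, E z x ∧ PairMemE E b x a

def OpCE (n : ℕ) (T : M) : Prop :=
  ∀ a, E a T → ∀ b, E b T → ∀ c, (∀ z, E z c ↔ SpecE E n a b z) → E c T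

def ClTE (T : M) : Prop :=
  OpCE E 0 T ∧ OpCE E 1 T ∧ OpCE E 2 T ∧ OpCE E 3 T ∧ OpCE E 4 T ∧ OpCE E 5 T ∧ OpCE E 6 T ∧
    OpCE E 7 T ∧ OpCE E 8 T

def InDE (r S : M) : Prop :=
  ∃ θ, OrdE E θ ∧ ∀ T, E r T → (∀ a, E a θ → ∀ y, (∀ x, E x y ↔ VMemE E x a) → E y T) →
    ClTE E T → E S T

def PsiE : Prop :=
  ∀ r ξ, OrdE E ξ → ∃ κ, OrdE E κ ∧ E ξ κ ∧ ∀ S, InDE E r S → ¬ BadE E ξ κ S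

end gen

section inst2
variable (i j k l : ℕ)
instance : UD (fun s v => FstE s.E (v i) (v j)) := by unfold FstE; infer_instance
instance : UD (fun s v => SndE s.E (v i) (v j)) := by unfold SndE; infer_instance
instance (n : ℕ) : UD (fun s v => SpecE s.E n (v i) (v j) (v k)) := by
  match n with
  | 0 | 1 | 2 | 3 | 4 | 5 | 6 | 7 => simp only [SpecE]; infer_instance
  | n + 8 => simp only [SpecE]; infer_instance
instance (n : ℕ) : UD (fun s v => OpCE s.E n (v i)) := by unfold OpCE; infer_instance
instance : UD (fun s v => ClTE s.E (v i)) := by unfold ClTE; infer_instance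
instance : UD (fun s v => InDE s.E (v i) (v j)) := by unfold InDE; infer_instance
instance : UD (fun s v => PsiE s.E) := by unfold PsiE; infer_instance
end inst2

theorem psi_sentence : ∃ ps : SetFormula 0, ∀ (N : Type) (E : N → N → Prop),
    Realize E ps ![] ↔ PsiE E :=
  UD.sentence (P := fun s => PsiE s.E) inferInstance (fun s h a => (h.false a).elim)

section S13
variable {M : Type} [Mdl M]

theorem fstE_iff (z x : M) : FstE Mdl.E z x ↔ x = fst z := by
  have h : ∀ u, u ∊ fst z ↔ ∃ x y, z = pair x y ∧ u ∊ x := fun u => mem_mk (isSet_fst _) u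
  unfold FstE
  simp only [oPairE_iff]
  exact ⟨fun hx => sext fun u => (hx u).trans (h u).symm, fun e u => e ▸ h u⟩

theorem sndE_iff (z x : M) : SndE Mdl.E z x ↔ x = snd z := by
  have h : ∀ u, u ∊ snd z ↔ ∃ x y, z = pair x y ∧ u ∊ y := fun u => mem_mk (isSet_snd _) u
  unfold SndE
  simp only [oPairE_iff]
  exact ⟨fun hx => sext fun u => (hx u).trans (h u).symm, fun e u => e ▸ h u⟩

theorem specE_iff (n : ℕ) (a b z : M) : SpecE Mdl.E n a b z ↔ Spec n a b z := by
  match n with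
  | 0 | 1 | 2 | 3 | 4 | 5 | 6 | 7 => simp [SpecE, Spec, fstE_iff, sndE_iff, pairMemE_iff, oPairE_iff]
  | n + 8 => simp [SpecE, Spec, fstE_iff, sndE_iff, pairMemE_iff, oPairE_iff]

theorem opCE_iff (n : ℕ) (T : M) : OpCE Mdl.E n T ↔ OpC n T := by
  unfold OpCE OpC
  refine forall_congr' fun a => forall_congr' fun _ => forall_congr' fun b => forall_congr' fun _ => ?_
  simp only [specE_iff]
  constructor
  · intro h; exact h _ fun z => mem_op n a b z
  · intro h c hc
    have : c = op n a b := sext fun z => (hc z).trans (mem_op n a b z).symm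
    rwa [this]

theorem clTE_iff (T : M) : ClTE Mdl.E T ↔ ClT T := by
  simp only [ClTE, ClT, opCE_iff]

theorem inDE_iff (r S : M) : InDE Mdl.E r S ↔ InD r S := by
  unfold InDE InD
  refine exists_congr fun θ => and_congr_right fun hθ => forall_congr' fun T =>
    forall_congr' fun _ => ?_
  rw [clTE_iff]
  refine imp_congr_left (forall_congr' fun a => forall_congr' fun ha => ?_)
  have hO : Od a := OrdE.mem hθ ha
  simp only [vMemE_iff, hO, true_and]
  constructor
  · intro h; exact h _ fun z => Iff.rfl
  · intro h c hc
    have : c = V a := sext hc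
    rwa [this]

theorem psiE_iff : PsiE (M := M) Mdl.E ↔ Psi M := by
  unfold PsiE Psi
  simp only [inDE_iff, badE_iff]

end S13

theorem three_of_one (h : ¬ ∃ (M : Type) (E : M → M → Prop), IsZFCE E ∧ ProperClassSubtleE E ∧
        OrdSubtleDefE E) :
    ∃ φ : SetFormula 0, SubtleProves φ ∧ FaintPlusProvesSubtle φ ∧ NegProvesFaint φ := by
  obtain ⟨ps, hps⟩ := psi_sentence
  have hn : ∀ (M : Type) (E : M → M → Prop) (hz : IsZFCE E),
      Realize E ps.not ![] ↔ ¬ @Psi M ⟨E, hz⟩ := by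
    intro M E hz
    letI : Mdl M := ⟨E, hz⟩
    have : PsiE E ↔ Psi M := psiE_iff
    rw [← this, ← hps]
    rfl
  refine ⟨ps.not, ?_, ?_, ?_⟩
  · intro M E hz hs
    rw [hn M E hz]
    letI : Mdl M := ⟨E, hz⟩
    intro hp
    exact h ⟨_, ES (HD (emp : M)), (hd_inner emp).zfc, hd_pcs emp hp, hd_subtle emp hs⟩
  · intro M E hz hf hr
    rw [hn M E hz] at hr
    letI : Mdl M := ⟨E, hz⟩
    exact faint_subtle hf hr
  · intro M E hz hr
    rw [hn M E hz, not_not] at hr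
    letI : Mdl M := ⟨E, hz⟩
    exact psi_faint hr

theorem two_of_three (h : ∃ (M : Type) (E : M → M → Prop), IsZFCE E ∧ ProperClassSubtleE E ∧
        OrdSubtleDefE E) : ¬ ∃ φ : SetFormula 0, SubtleProves φ ∧ FaintPlusProvesSubtle φ := by
  rintro ⟨φ, ha, hb⟩
  obtain ⟨M, E, hz, hp, hs⟩ := h
  obtain ⟨ps, hps⟩ := pcs_sentence
  letI : Mdl M := ⟨E, hz⟩
  exact no_theta (M := M) φ ps hps ha hb hp hs

theorem final :
    ((¬ ∃ φ : SetFormula 0, SubtleProves φ ∧ FaintPlusProvesSubtle φ ∧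
        NegProvesFaint φ) ↔
      ¬ ∃ φ : SetFormula 0, SubtleProves φ ∧ FaintPlusProvesSubtle φ) ∧
    ((¬ ∃ φ : SetFormula 0, SubtleProves φ ∧ FaintPlusProvesSubtle φ) ↔
      ∃ (M : Type) (E : M → M → Prop), IsZFCE E ∧ ProperClassSubtleE E ∧
        OrdSubtleDefE E) := by
  have h13 : (¬ ∃ φ : SetFormula 0, SubtleProves φ ∧ FaintPlusProvesSubtle φ ∧ NegProvesFaint φ) →
      ∃ (M : Type) (E : M → M → Prop), IsZFCE E ∧ ProperClassSubtleE E ∧ OrdSubtleDefE E :=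
    fun h => by_contra fun h' => h (three_of_one h')
  have h21 : (¬ ∃ φ : SetFormula 0, SubtleProves φ ∧ FaintPlusProvesSubtle φ) →
      ¬ ∃ φ : SetFormula 0, SubtleProves φ ∧ FaintPlusProvesSubtle φ ∧ NegProvesFaint φ :=
    fun h ⟨φ, a, b, _⟩ => h ⟨φ, a, b⟩
  exact ⟨⟨fun h => two_of_three (h13 h), h21⟩, ⟨fun h => h13 (h21 h), two_of_three⟩⟩

end Paper


namespace Paper

/-- **Theorem 1.12.** The following statements are equivalent:
(1) there is no sentence `φ` in the language of set theory satisfying all three of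
    (a) `ZFC + "Ord is essentially subtle"` proves `φ`,
    (b) `ZFC + "Ord is essentially faint" + φ` proves "`Ord` is essentially subtle",
    (c) `ZFC + ¬φ` proves "`Ord` is essentially faint";
(2) there is no sentence `φ` satisfying (a) and (b);
(3) the theory `ZFC + "there is a proper class of subtle cardinals" +
    "Ord is essentially subtle"` is consistent.
(By the Gödel completeness theorem, consistency is rendered as the existence of a
model and provability as truth in all models.) -/
theorem no_difference_sentence_iff :
    ((¬ ∃ φ : SetFormula 0, SubtleProves φ ∧ FaintPlusProvesSubtle φ ∧
        NegProvesFaint φ) ↔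
      ¬ ∃ φ : SetFormula 0, SubtleProves φ ∧ FaintPlusProvesSubtle φ) ∧
    ((¬ ∃ φ : SetFormula 0, SubtleProves φ ∧ FaintPlusProvesSubtle φ) ↔
      ∃ (M : Type) (E : M → M → Prop), IsZFCE E ∧ ProperClassSubtleE E ∧
        OrdSubtleDefE E) := by
  exact final

end Paper
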